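/- arXiv:2002.12264 — 4 statements merged into one kernel-verified Lean document; each statement's English description precedes it below -/
import Mathlib

section
/- Let 1 ≤ p, q < ∞ and z ∈ 𝔻 with |z| ≥ 1/2. Then for every f ∈ RM(p,q), |f(z)| ≤ 4 (1-|z|)^{-(1/p + 1/q)} ρ_{p,q}(f). -/
open MeasureTheory Complex Real ENNReal

/-- Radial `L^p` average `( ∫₀¹ |f(r e^{iθ})|^p dr )^{1/p}` (sup over `r` if `p = ∞`),
valued in `ℝ≥0∞`. -/
noncomputable def radialLp (p : ℝ≥0∞) (f : ℂ → ℂ) (θ : ℝ) : ℝ≥0∞ :=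
  if p = ⊤ then
    ⨆ r : Set.Ico (0 : ℝ) 1,
      ENNReal.ofReal ‖f ((r : ℝ) * Complex.exp ((θ : ℂ) * Complex.I))‖
  else
    (∫⁻ r in Set.Ioo (0:ℝ) 1,
        ENNReal.ofReal
          (‖f ((r : ℝ) * Complex.exp ((θ : ℂ) * Complex.I))‖ ^ p.toReal)) ^ (1 / p.toReal)

/-- The mixed norm `ρ_{p,q}(f)`, valued in `ℝ≥0∞`; for `q < ∞` it is
`((1/2π) ∫₀^{2π} (radial L^p average)^q dθ)^{1/q}`, and for `q = ∞` the essential/radial sup. -/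
noncomputable def rhoE (p q : ℝ≥0∞) (f : ℂ → ℂ) : ℝ≥0∞ :=
  if q = ⊤ then ⨆ θ : Set.Ico (0 : ℝ) (2 * Real.pi), radialLp p f (θ : ℝ)
  else
    ((ENNReal.ofReal (2 * Real.pi))⁻¹ *
        ∫⁻ θ in Set.Ioo (0 : ℝ) (2 * Real.pi), (radialLp p f θ) ^ q.toReal) ^ (1 / q.toReal)

lemma aux_periodic (g : ℝ → ℝ≥0∞) (T : ℝ) (hT : 0 < T) (hg : ∀ x, g (x + T) = g x) (a b : ℝ) :
    ∫⁻ x in Set.Ioo a (a + T), g x = ∫⁻ x in Set.Ioo b (b + T), g x := by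
  rw [restrict_Ioo_eq_restrict_Ioc, restrict_Ioo_eq_restrict_Ioc]
  refine (isAddFundamentalDomain_Ioc hT a).setLIntegral_eq (isAddFundamentalDomain_Ioc hT b) g ?_
  rintro ⟨_, n, rfl⟩ x
  have : Function.Periodic g T := hg
  have h2 := this.int_mul n x
  simp only [AddSubgroup.vadd_def, vadd_eq_add, zsmul_eq_mul]
  rw [add_comm, h2]

lemma aux_periodic_shift (g : ℝ → ℝ≥0∞) (hg : ∀ x, g (x + 2 * π) = g x) (α : ℝ) :
    ∫⁻ x in Set.Ioo (-π) π, g (x + α) = ∫⁻ x in Set.Ioo 0 (2 * π), g x := by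
  have h := (measurePreserving_add_right volume α).setLIntegral_comp_preimage_emb
    (measurableEmbedding_addRight α) g (Set.Ioo (-π + α) (-π + α + 2 * π))
  have h2 : (fun x : ℝ => x + α) ⁻¹' Set.Ioo (-π + α) (-π + α + 2 * π) = Set.Ioo (-π) π := by
    ext x
    simp only [Set.mem_preimage, Set.mem_Ioo]
    constructor <;> rintro ⟨h1, h2⟩ <;> constructor <;> linarith
  rw [h2] at h
  rw [h, aux_periodic g (2 * π) (by positivity) hg _ 0, zero_add]

lemma aux_polar_meas (H : ℂ → ℝ≥0∞) (hH : Measurable H) :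
    Measurable (fun x : ℝ × ℝ => H (x.1 * Complex.exp ((x.2 : ℂ) * Complex.I))) := by
  apply hH.comp
  fun_prop

lemma aux_polar0 (H : ℂ → ℝ≥0∞) :
    ∫⁻ w, H w = ∫⁻ x : ℝ × ℝ in Set.Ioi (0 : ℝ) ×ˢ Set.Ioo (-π) π,
      ENNReal.ofReal x.1 * H (x.1 * Complex.exp ((x.2 : ℂ) * Complex.I)) := by
  rw [← Complex.lintegral_comp_polarCoord_symm]
  simp only [Complex.polarCoord_symm_apply, polarCoord_target, smul_eq_mul, Complex.exp_mul_I,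
    Complex.ofReal_cos, Complex.ofReal_sin]

lemma aux_polar1 (H : ℂ → ℝ≥0∞) (hH : Measurable H) :
    ∫⁻ w, H w = ∫⁻ r in Set.Ioi (0 : ℝ), ∫⁻ θ in Set.Ioo (-π) π,
      ENNReal.ofReal r * H (r * Complex.exp ((θ : ℂ) * Complex.I)) := by
  rw [aux_polar0, Measure.volume_eq_prod, setLIntegral_prod]
  have := aux_polar_meas H hH
  fun_prop

lemma aux_polar2 (H : ℂ → ℝ≥0∞) (hH : Measurable H) :
    ∫⁻ w, H w = ∫⁻ θ in Set.Ioo (-π) π, ∫⁻ r in Set.Ioi (0 : ℝ),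
      ENNReal.ofReal r * H (r * Complex.exp ((θ : ℂ) * Complex.I)) := by
  rw [aux_polar0, Measure.volume_eq_prod, setLIntegral_prod_symm]
  have := aux_polar_meas H hH
  fun_prop

lemma aux_circle (f : ℂ → ℂ) (z : ℂ) (d s : ℝ) (hs : 0 < s) (hsd : s < d)
    (hf : DifferentiableOn ℂ f (Metric.ball z d)) :
    ENNReal.ofReal (2 * π) * ‖f z‖ₑ ≤
      ∫⁻ θ in Set.Ioo (-π) π, ‖f (z + s * Complex.exp ((θ : ℂ) * Complex.I))‖ₑ := by
  have h1 : DiffContOnCl ℂ f (Metric.ball z |s|) := by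
    rw [abs_of_pos hs]
    exact hf.diffContOnCl_ball (Metric.closedBall_subset_ball hsd)
  have h2 := h1.circleAverage
  rw [circleAverage_def, intervalIntegral.integral_of_le (by positivity)] at h2
  have h3 : ∫ θ in Set.Ioc 0 (2 * π), f (circleMap z s θ) = ((2 * π : ℝ)) • f z := by
    rw [← h2, smul_smul, mul_inv_cancel₀ (by positivity), one_smul]
  have h4 : ENNReal.ofReal (2 * π) * ‖f z‖ₑ ≤ ∫⁻ θ in Set.Ioc 0 (2 * π), ‖f (circleMap z s θ)‖ₑ := by
    refine le_trans (le_of_eq ?_) (enorm_integral_le_lintegral_enorm _)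
    rw [h3, enorm_smul, Real.enorm_of_nonneg (by positivity)]
  refine h4.trans (le_of_eq ?_)
  rw [← restrict_Ioo_eq_restrict_Ioc]
  have h5 := aux_periodic_shift (fun θ => ‖f (circleMap z s θ)‖ₑ) (fun x => by
    rw [periodic_circleMap z s x]) 0
  rw [← h5]
  simp [circleMap]

lemma aux_area (f : ℂ → ℂ) (z : ℂ) (d : ℝ) (hd : 0 < d)
    (hf : DifferentiableOn ℂ f (Metric.ball z d)) (G : ℂ → ℝ≥0∞) (hG : Measurable G)
    (hfG : ∀ w ∈ Metric.ball z d, G w = ‖f w‖ₑ) :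
    ENNReal.ofReal (π * d ^ 2) * ‖f z‖ₑ ≤ ∫⁻ w in Metric.ball z d, G w := by
  set K : ℂ → ℝ≥0∞ := (Metric.ball z d).indicator G with hK
  have hKm : Measurable K := hG.indicator measurableSet_ball
  rw [← lintegral_indicator measurableSet_ball, ← hK,
    ← lintegral_add_left_eq_self K z, aux_polar1 _ (by fun_prop)]
  calc ENNReal.ofReal (π * d ^ 2) * ‖f z‖ₑ
      = ∫⁻ s in Set.Ioo 0 d, ENNReal.ofReal s * (ENNReal.ofReal (2 * π) * ‖f z‖ₑ) := by
        rw [lintegral_mul_const _ (by fun_prop), ← ofReal_integral_eq_lintegral_ofReal]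
        · rw [← mul_assoc, ← ENNReal.ofReal_mul' (by positivity)]
          congr 2
          rw [← integral_Ioc_eq_integral_Ioo, ← intervalIntegral.integral_of_le hd.le, integral_id]
          ring
        · exact (continuous_id.integrableOn_Icc (a := 0) (b := d)).mono_set Set.Ioo_subset_Icc_self
        · filter_upwards [ae_restrict_mem measurableSet_Ioo] with s hs using hs.1.le
    _ ≤ ∫⁻ s in Set.Ioo 0 d, ∫⁻ θ in Set.Ioo (-π) π,
          ENNReal.ofReal s * K (z + s * Complex.exp ((θ : ℂ) * Complex.I)) := by
        refine setLIntegral_mono' measurableSet_Ioo fun s hs => ?_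
        rw [lintegral_const_mul' _ _ (by simp)]
        gcongr
        refine (aux_circle f z d s hs.1 hs.2 hf).trans (le_of_eq ?_)
        refine lintegral_congr fun θ => ?_
        have : z + s * Complex.exp ((θ : ℂ) * Complex.I) ∈ Metric.ball z d := by
          simp [abs_of_pos hs.1, hs.2]
        rw [hK, Set.indicator_of_mem this, hfG _ this]
    _ ≤ _ := lintegral_mono_set (fun s hs => hs.1)

lemma aux_holder (μ : Measure ℝ) (h : ℝ → ℝ≥0∞) (hh : Measurable h) (p : ℝ) (hp : 1 ≤ p) :
    ∫⁻ x, h x ∂μ ≤ (∫⁻ x, h x ^ p ∂μ) ^ (1 / p) * μ Set.univ ^ (1 - 1 / p) := by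
  have := eLpNorm'_le_eLpNorm'_mul_rpow_measure_univ (μ := μ) (f := h) one_pos hp
    hh.aestronglyMeasurable
  simpa [eLpNorm'] using this

lemma aux_geom (a d r θ : ℝ) (hd : 0 < d) (had : a = 1 - d) (ha : 1 / 2 ≤ a) (hr : 0 < r)
    (hθ : θ ∈ Set.Ioo (-π) π)
    (h : (r * Complex.exp ((θ : ℂ) * Complex.I)) ∈ Metric.ball (a : ℂ) d) :
    r ∈ Set.Ioo (a - d) 1 ∧ θ ∈ Set.Ioo (-(π * d)) (π * d) := by
  rw [mem_ball_iff_norm] at h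
  have hsq : (r * Real.cos θ - a) ^ 2 + (r * Real.sin θ) ^ 2 < d ^ 2 := by
    have h1 : ‖(r * Complex.exp ((θ : ℂ) * Complex.I)) - a‖ ^ 2 < d ^ 2 := by gcongr
    rw [Complex.sq_norm, Complex.normSq_apply] at h1
    simp [Complex.exp_ofReal_mul_I_re, Complex.exp_ofReal_mul_I_im] at h1
    nlinarith
  have hcs := Real.sin_sq_add_cos_sq θ
  have hnorm : ‖(r * Complex.exp ((θ : ℂ) * Complex.I))‖ = r := by simp [abs_of_pos hr]
  have hna : ‖(a : ℂ)‖ = a := by simp; linarith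
  have e1 := norm_sub_norm_le (r * Complex.exp ((θ : ℂ) * Complex.I)) (a : ℂ)
  have e2 := norm_sub_norm_le (a : ℂ) (r * Complex.exp ((θ : ℂ) * Complex.I))
  rw [norm_sub_rev] at e2
  rw [hnorm, hna] at e1 e2
  refine ⟨⟨by linarith, by linarith⟩, ?_⟩
  have hcos : 0 < Real.cos θ := by
    by_contra hc
    push Not at hc
    have : r * a * Real.cos θ ≤ 0 := mul_nonpos_of_nonneg_of_nonpos (by nlinarith) hc
    have h9 : r ^ 2 * Real.sin θ ^ 2 + r ^ 2 * Real.cos θ ^ 2 = r ^ 2 := by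
      rw [← mul_add, hcs, mul_one]
    have h10 : d ^ 2 ≤ a ^ 2 := by gcongr; linarith
    nlinarith [sq_nonneg r]
  have hsin : a ^ 2 * Real.sin θ ^ 2 < d ^ 2 := by
    have : (r * Real.cos θ - a) ^ 2 + (r * Real.sin θ) ^ 2 - a ^ 2 * Real.sin θ ^ 2
      = (r - a * Real.cos θ) ^ 2 := by
      have : Real.sin θ ^ 2 = 1 - Real.cos θ ^ 2 := by linarith
      rw [mul_pow, this]; ring
    nlinarith [sq_nonneg (r - a * Real.cos θ)]
  have hsin2 : a * |Real.sin θ| < d := by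
    apply lt_of_pow_lt_pow_left₀ 2 hd.le
    rw [mul_pow, sq_abs]; exact hsin
  have hpi := Real.pi_pos
  have hθ2 : |θ| ≤ π / 2 := by
    by_contra hc
    push Not at hc
    have h1 : Real.cos |θ| ≤ 0 := Real.cos_nonpos_of_pi_div_two_le_of_le hc.le (by
      have : |θ| < π := abs_lt.2 ⟨hθ.1, hθ.2⟩
      linarith)
    rw [Real.cos_abs] at h1
    linarith
  have hj := Real.mul_abs_le_abs_sin hθ2
  have h6 : |θ| < π * d := by
    have h7 : 2 / π * |θ| < 2 * d := by nlinarith [abs_nonneg (Real.sin θ)]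
    have h8 : |θ| = π / 2 * (2 / π * |θ|) := by field_simp
    rw [h8]
    calc π / 2 * (2 / π * |θ|) < π / 2 * (2 * d) := by gcongr
      _ = π * d := by ring
  exact abs_lt.1 h6

lemma aux_core (G : ℂ → ℝ≥0∞) (hG : Measurable G) (a d p q : ℝ) (hp : 1 ≤ p) (hq : 1 ≤ q)
    (hd : 0 < d) (had : a = 1 - d) (ha : 1 / 2 ≤ a) :
    ∫⁻ w in Metric.ball (a : ℂ) d, G w ≤
      (∫⁻ θ in Set.Ioo (-π) π, ((∫⁻ r in Set.Ioo (0 : ℝ) 1,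
        G (r * Complex.exp ((θ : ℂ) * Complex.I)) ^ p) ^ (1 / p)) ^ q) ^ (1 / q) *
      (ENNReal.ofReal (2 * d) ^ (1 - 1 / p) * ENNReal.ofReal (2 * π * d) ^ (1 - 1 / q)) := by
  have hm := aux_polar_meas G hG
  set R : ℝ → ℝ≥0∞ := fun θ => (∫⁻ r in Set.Ioo (0 : ℝ) 1,
        G (r * Complex.exp ((θ : ℂ) * Complex.I)) ^ p) ^ (1 / p) with hR
  have hRm : Measurable R := by
    apply Measurable.pow_const
    exact (hm.pow_const p).lintegral_prod_left'
  have hq0 : 0 ≤ 1 / q := by positivity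
  have hp0 : 0 ≤ 1 / p := by positivity
  have hq1 : 0 ≤ 1 - 1 / q := by rw [sub_nonneg, div_le_one (by linarith)]; exact hq
  set K : ℂ → ℝ≥0∞ := (Metric.ball (a : ℂ) d).indicator G with hK
  have hKm : Measurable K := hG.indicator measurableSet_ball
  have hpi := Real.pi_pos
  rw [← lintegral_indicator measurableSet_ball, ← hK, aux_polar2 K hKm]
  have step1 : ∀ θ ∈ Set.Ioo (-π) π,
      ∫⁻ r in Set.Ioi (0 : ℝ), ENNReal.ofReal r * K (r * Complex.exp ((θ : ℂ) * Complex.I)) ≤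
      (Set.Ioo (-(π * d)) (π * d)).indicator (fun θ => R θ * ENNReal.ofReal (2 * d) ^ (1 - 1 / p)) θ := by
    intro θ hθ
    by_cases hθ2 : θ ∈ Set.Ioo (-(π * d)) (π * d)
    · rw [Set.indicator_of_mem hθ2]
      calc _ ≤ ∫⁻ r in Set.Ioi (0 : ℝ), (Set.Ioo (a - d) 1).indicator
                (fun r : ℝ => G (r * Complex.exp ((θ : ℂ) * Complex.I))) r := by
            refine setLIntegral_mono' measurableSet_Ioi fun r hr => ?_
            by_cases hb : (r * Complex.exp ((θ : ℂ) * Complex.I)) ∈ Metric.ball (a : ℂ) d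
            · have := (aux_geom a d r θ hd had ha hr hθ hb).1
              rw [hK, Set.indicator_of_mem hb, Set.indicator_of_mem this]
              refine mul_le_of_le_one_left' ?_
              exact ENNReal.ofReal_le_one.2 this.2.le
            · rw [hK, Set.indicator_of_notMem hb]
              simp
        _ ≤ ∫⁻ r, (Set.Ioo (a - d) 1).indicator
                (fun r : ℝ => G (r * Complex.exp ((θ : ℂ) * Complex.I))) r := setLIntegral_le_lintegral _ _
        _ = ∫⁻ r in Set.Ioo (a - d) 1, G (r * Complex.exp ((θ : ℂ) * Complex.I)) :=
            lintegral_indicator measurableSet_Ioo _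
        _ ≤ _ := aux_holder _ _ (hm.comp (measurable_id.prodMk measurable_const)) p hp
        _ ≤ _ := by
            rw [Measure.restrict_apply_univ, Real.volume_Ioo,
              show 1 - (a - d) = 2 * d by rw [had]; ring]
            refine mul_le_mul_left ?_ _
            refine ENNReal.rpow_le_rpow ?_ hp0
            exact lintegral_mono_set (Set.Ioo_subset_Ioo_left (by linarith))
    · rw [Set.indicator_of_notMem hθ2, nonpos_iff_eq_zero]
      rw [lintegral_eq_zero_iff' (by fun_prop)]
      filter_upwards [ae_restrict_mem measurableSet_Ioi] with r hr
      have hb : (r * Complex.exp ((θ : ℂ) * Complex.I)) ∉ Metric.ball (a : ℂ) d := fun hb =>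
        hθ2 (aux_geom a d r θ hd had ha hr hθ hb).2
      simp [hK, Set.indicator_of_notMem hb]
  calc _ ≤ ∫⁻ θ in Set.Ioo (-π) π, (Set.Ioo (-(π * d)) (π * d)).indicator
            (fun θ => R θ * ENNReal.ofReal (2 * d) ^ (1 - 1 / p)) θ :=
        setLIntegral_mono' measurableSet_Ioo step1
    _ ≤ ∫⁻ θ, (Set.Ioo (-(π * d)) (π * d)).indicator
            (fun θ => R θ * ENNReal.ofReal (2 * d) ^ (1 - 1 / p)) θ := setLIntegral_le_lintegral _ _
    _ = (∫⁻ θ in Set.Ioo (-(π * d)) (π * d), R θ) * ENNReal.ofReal (2 * d) ^ (1 - 1 / p) := by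
        rw [lintegral_indicator measurableSet_Ioo, lintegral_mul_const _ hRm]
    _ ≤ ((∫⁻ θ in Set.Ioo (-(π * d)) (π * d), R θ ^ q) ^ (1 / q) *
          ENNReal.ofReal (2 * π * d) ^ (1 - 1 / q)) * ENNReal.ofReal (2 * d) ^ (1 - 1 / p) := by
        gcongr
        refine (aux_holder _ R hRm q hq).trans (le_of_eq ?_)
        rw [Measure.restrict_apply_univ, Real.volume_Ioo]
        congr 3
        ring
    _ ≤ ((∫⁻ θ in Set.Ioo (-π) π, R θ ^ q) ^ (1 / q) *
          ENNReal.ofReal (2 * π * d) ^ (1 - 1 / q)) * ENNReal.ofReal (2 * d) ^ (1 - 1 / p) := by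
        gcongr <;> nlinarith
    _ = _ := by ring

lemma aux_const (p q d : ℝ) (hp : 1 ≤ p) (hq : 1 ≤ q) (hd : 0 < d) :
    (2 * d) ^ (1 - 1 / p) * (2 * π * d) ^ (1 - 1 / q) * (2 * π) ^ (1 / q) ≤
      (π * d ^ 2) * (4 * d ^ (-(1 / p + 1 / q))) := by
  have hpi := Real.pi_pos
  have h2 : (2 : ℝ) ^ (1 - 1 / p) ≤ 2 := by
    calc (2 : ℝ) ^ (1 - 1 / p) ≤ 2 ^ (1 : ℝ) := by
          apply Real.rpow_le_rpow_of_exponent_le (by norm_num)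
          have : 0 ≤ 1 / p := by positivity
          linarith
      _ = 2 := by simp
  have e : (2 * π) ^ (1 - 1 / q) * (2 * π) ^ (1 / q) = 2 * π := by
    rw [← Real.rpow_add (by positivity)]; simp
  have e2 : d ^ (1 - 1 / p) * d ^ (1 - 1 / q) = d ^ 2 * d ^ (-(1 / p + 1 / q)) := by
    rw [← Real.rpow_add hd, ← Real.rpow_natCast, ← Real.rpow_add hd]
    congr 1; push_cast; ring
  rw [Real.mul_rpow (by norm_num) hd.le, Real.mul_rpow (by positivity) hd.le]
  calc _ = 2 ^ (1 - 1 / p) * (d ^ (1 - 1 / p) * d ^ (1 - 1 / q)) *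
            ((2 * π) ^ (1 - 1 / q) * (2 * π) ^ (1 / q)) := by ring
    _ ≤ 2 * (d ^ (1 - 1 / p) * d ^ (1 - 1 / q)) * (2 * π) := by rw [e]; gcongr
    _ = _ := by rw [e2]; ring

/-- For `1 ≤ p, q < ∞` and `z ∈ 𝔻` with `|z| ≥ 1/2`, every `f ∈ RM(p,q)` satisfies
`|f(z)| ≤ 4 (1-|z|)^{-(1/p+1/q)} ρ_{p,q}(f)`. -/
theorem stmt_7 (p q : ℝ) (hp : 1 ≤ p) (hq : 1 ≤ q) (z : ℂ) (hz : ‖z‖ < 1)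
    (hz2 : (1:ℝ)/2 ≤ ‖z‖) (f : ℂ → ℂ)
    (hf : DifferentiableOn ℂ f (Metric.ball (0 : ℂ) 1))
    (hfin : rhoE (ENNReal.ofReal p) (ENNReal.ofReal q) f ≠ ⊤) :
    ENNReal.ofReal ‖f z‖
      ≤ ENNReal.ofReal (4 * (1 - ‖z‖) ^ (-(1 / p + 1 / q))) *
          rhoE (ENNReal.ofReal p) (ENNReal.ofReal q) f := by
  have hp0 : 0 < p := by linarith
  have hq0 : 0 < q := by linarith
  have hpi := Real.pi_pos
  set d := 1 - ‖z‖ with hd_def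
  have hd : 0 < d := by linarith
  set α := Complex.arg z with hα
  set u : ℂ := Complex.exp ((α : ℂ) * Complex.I) with hu
  have hun : ‖u‖ = 1 := by rw [hu, Complex.norm_exp_ofReal_mul_I]
  have hzu : (‖z‖ : ℂ) * u = z := Complex.norm_mul_exp_arg_mul_I z
  set F : ℂ → ℂ := fun w => f (w * u) with hF
  have hFd : DifferentiableOn ℂ F (Metric.ball 0 1) := by
    refine hf.comp (by fun_prop) fun w hw => ?_
    simpa [hun] using hw
  set G : ℂ → ℝ≥0∞ := (Metric.ball (0 : ℂ) 1).indicator (fun w => ‖F w‖ₑ) with hGdef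
  have hG : Measurable G := by
    have h1 : Measurable ((Metric.ball (0 : ℂ) 1).indicator F) := by
      classical
      rw [← Set.piecewise_eq_indicator]
      exact hFd.continuousOn.measurable_piecewise continuousOn_const measurableSet_ball
    have h2 : G = fun w => ‖(Metric.ball (0 : ℂ) 1).indicator F w‖ₑ := by
      funext w
      rw [hGdef, enorm_indicator_eq_indicator_enorm]
    rw [h2]
    exact h1.enorm
  have hsub : Metric.ball (‖z‖ : ℂ) d ⊆ Metric.ball 0 1 := by
    apply Metric.ball_subset_ball'
    simp [hd_def]
  have hA := aux_area F (‖z‖ : ℂ) d hd (hFd.mono hsub) G hG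
    (fun w hw => by rw [hGdef, Set.indicator_of_mem (hsub hw)])
  have hB := aux_core G hG ‖z‖ d p q hp hq hd (by simp [hd_def]) hz2
  have hFz : F (‖z‖ : ℂ) = f z := by simp only [hF, hzu]
  rw [hFz] at hA
  -- identify the integral
  have hrad : ∀ θ : ℝ, (∫⁻ r in Set.Ioo (0 : ℝ) 1,
        G (r * Complex.exp ((θ : ℂ) * Complex.I)) ^ p) ^ (1 / p) =
        radialLp (ENNReal.ofReal p) f (θ + α) := by
    intro θ
    rw [radialLp, if_neg ENNReal.ofReal_ne_top, ENNReal.toReal_ofReal hp0.le]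
    congr 1
    refine setLIntegral_congr_fun measurableSet_Ioo fun r hr => ?_
    have hb : (r * Complex.exp ((θ : ℂ) * Complex.I)) ∈ Metric.ball (0 : ℂ) 1 := by
      simp [abs_of_pos hr.1, hr.2]
    simp only [hGdef, Set.indicator_of_mem hb, hF]
    rw [← ENNReal.ofReal_rpow_of_nonneg (norm_nonneg _) hp0.le, ofReal_norm, mul_assoc, hu,
      ← Complex.exp_add]
    push_cast
    rw [add_mul]
  have hper : ∀ θ : ℝ, radialLp (ENNReal.ofReal p) f (θ + 2 * π) =
      radialLp (ENNReal.ofReal p) f θ := by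
    intro θ
    have : Complex.exp (((θ + 2 * π : ℝ) : ℂ) * Complex.I) =
        Complex.exp ((θ : ℂ) * Complex.I) := by
      push_cast
      rw [add_mul, Complex.exp_periodic]
    simp only [radialLp, this]
  simp only [hrad] at hB
  rw [aux_periodic_shift (fun θ => radialLp (ENNReal.ofReal p) f θ ^ q)
    (fun θ => by simp only [hper])] at hB
  set I := ∫⁻ θ in Set.Ioo 0 (2 * π), radialLp (ENNReal.ofReal p) f θ ^ q with hI
  have hrho : rhoE (ENNReal.ofReal p) (ENNReal.ofReal q) f =
      ((ENNReal.ofReal (2 * π))⁻¹ * I) ^ (1 / q) := by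
    rw [rhoE, if_neg ENNReal.ofReal_ne_top, ENNReal.toReal_ofReal hq0.le]
  have hIrho : I ^ (1 / q) = ENNReal.ofReal ((2 * π) ^ (1 / q)) *
      rhoE (ENNReal.ofReal p) (ENNReal.ofReal q) f := by
    rw [hrho, ← ENNReal.ofReal_rpow_of_nonneg (by positivity) (by positivity),
      ← ENNReal.mul_rpow_of_nonneg _ _ (by positivity), ← mul_assoc, ENNReal.mul_inv_cancel,
      one_mul]
    · simpa using hpi
    · exact ENNReal.ofReal_ne_top
  have hp1 : 0 ≤ 1 - 1 / p := by rw [sub_nonneg, div_le_one hp0]; exact hp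
  have hq1 : 0 ≤ 1 - 1 / q := by rw [sub_nonneg, div_le_one hq0]; exact hq
  rw [hIrho, ENNReal.ofReal_rpow_of_nonneg (by positivity) hp1,
    ENNReal.ofReal_rpow_of_nonneg (by positivity) hq1] at hB
  have hC := hA.trans hB
  rw [ofReal_norm]
  have hpos : ENNReal.ofReal (π * d ^ 2) ≠ 0 := by
    simp only [ne_eq, ENNReal.ofReal_eq_zero, not_le]; positivity
  rw [← ENNReal.mul_le_mul_iff_right hpos ENNReal.ofReal_ne_top]
  refine hC.trans ?_
  have hK := ENNReal.ofReal_le_ofReal (aux_const p q d hp hq hd)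
  rw [ENNReal.ofReal_mul (by positivity), ENNReal.ofReal_mul (by positivity),
    ENNReal.ofReal_mul (p := π * d ^ 2) (by positivity)] at hK
  rw [← mul_assoc (ENNReal.ofReal (π * d ^ 2))]
  refine le_trans (le_of_eq ?_) (mul_le_mul_left hK _)
  ring
end

section
/- Let 1 ≤ p, q ≤ ∞ and z ∈ 𝔻. There is a constant C = C(p,q) (independent of z) such that for every f ∈ RM(p,q), |f'(z)| ≤ C (1-|z|²)^{-(1/p + 1/q + 1)} ρ_{p,q}(f). -/
open MeasureTheory Complex Real ENNReal

/-- Normalized angular measure. -/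
noncomputable def angMeas : Measure ℝ :=
  (ENNReal.ofReal (2 * Real.pi))⁻¹ • (volume.restrict (Set.Ioo (0 : ℝ) (2 * Real.pi)))

/-- Squared Cauchy kernel. -/
noncomputable def kerK (z : ℂ) (s θ : ℝ) : ℝ≥0∞ :=
  ENNReal.ofReal ((‖circleMap 0 s θ - z‖ ^ 2)⁻¹)

lemma measurable_kerK (z : ℂ) (s : ℝ) : Measurable (kerK z s) := by
  unfold kerK
  apply ENNReal.measurable_ofReal.comp
  have : Continuous (fun θ => ‖circleMap 0 s θ - z‖ ^ 2) := by fun_prop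
  exact this.measurable.inv

lemma cauchy_bound (f : ℂ → ℂ) (hf : DifferentiableOn ℂ f (Metric.ball (0 : ℂ) 1)) (z : ℂ) (s : ℝ)
    (hzs : ‖z‖ < s) (hs : s < 1) :
    ENNReal.ofReal ‖deriv f z‖ ≤ ∫⁻ θ, ‖f (circleMap 0 s θ)‖ₑ * kerK z s θ ∂angMeas := by
  have hs0 : 0 < s := (norm_nonneg z).trans_lt hzs
  have h := two_pi_I_inv_smul_circleIntegral_sub_sq_inv_smul_of_differentiable
    (Metric.isOpen_ball) (Metric.closedBall_subset_ball hs) hf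
    (w₀ := z) (by simpa using hzs)
  rw [ofReal_norm, ← h, angMeas, lintegral_smul_measure, enorm_smul]
  have h1 : ‖(2 * (π:ℂ) * I)⁻¹‖ₑ = (ENNReal.ofReal (2 * π))⁻¹ := by
    rw [← ENNReal.ofReal_inv_of_pos (by positivity), ← ofReal_norm]
    simp [abs_of_pos Real.pi_pos]
  rw [h1, smul_eq_mul]
  gcongr
  rw [circleIntegral, intervalIntegral.integral_of_le (by positivity),
    MeasureTheory.integral_Ioc_eq_integral_Ioo]
  refine (enorm_integral_le_lintegral_enorm _).trans ?_
  apply lintegral_mono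
  intro θ
  simp only [deriv_circleMap, smul_eq_mul, kerK, enorm_mul]
  rw [mul_comm ‖f _‖ₑ, ← mul_assoc]
  gcongr
  rw [← ofReal_norm, ← ofReal_norm, ← ofReal_norm,
    ← ENNReal.ofReal_mul (by positivity), ← ENNReal.ofReal_mul (by positivity)]
  apply ENNReal.ofReal_le_ofReal
  simp only [norm_circleMap_zero, norm_I, norm_inv, norm_pow, mul_one, abs_of_pos hs0]
  exact mul_le_of_le_one_left (by positivity) hs.le

lemma kerK_mass (z : ℂ) (s : ℝ) (hzs : ‖z‖ < s) :
    ∫⁻ θ, kerK z s θ ∂angMeas = ENNReal.ofReal ((s ^ 2 - ‖z‖ ^ 2)⁻¹) := by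
  have hs0 : 0 < s := (norm_nonneg z).trans_lt hzs
  have hpos : 0 < s ^ 2 - ‖z‖ ^ 2 := by nlinarith [norm_nonneg z]
  have h := DiffContOnCl.circleAverage_poissonKernel_smul' (f := fun _ => (1:ℂ)) (c := 0) (R := s)
    (w := z) diffContOnCl_const (by simpa using hzs)
  rw [Real.circleAverage_def] at h
  simp only [sub_zero, norm_circleMap_zero, sq_abs, Complex.real_smul, mul_one] at h
  rw [intervalIntegral.integral_ofReal] at h
  have h2 : (2 * π)⁻¹ * ∫ θ in (0:ℝ)..2 * π, (s ^ 2 - ‖z‖ ^ 2) / ‖circleMap 0 s θ - z‖ ^ 2 = 1 := by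
    exact_mod_cast h
  simp only [div_eq_mul_inv] at h2
  rw [intervalIntegral.integral_const_mul, intervalIntegral.integral_of_le (by positivity),
    MeasureTheory.integral_Ioc_eq_integral_Ioo] at h2
  have hne : ∀ θ, ‖circleMap 0 s θ - z‖ ^ 2 ≠ 0 := by
    intro θ h0
    have : circleMap 0 s θ = z := by simpa [sub_eq_zero] using h0
    have h3 : ‖circleMap 0 s θ‖ = s := by simp [abs_of_pos hs0]
    rw [this] at h3
    linarith
  have hInt : IntegrableOn (fun θ => (‖circleMap 0 s θ - z‖ ^ 2)⁻¹) (Set.Ioo 0 (2 * π)) := by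
    have hc : Continuous (fun θ => (‖circleMap 0 s θ - z‖ ^ 2)⁻¹) :=
      Continuous.inv₀ (by fun_prop) hne
    exact (hc.continuousOn.integrableOn_Icc (a := 0) (b := 2 * π)).mono_set Set.Ioo_subset_Icc_self
  unfold kerK angMeas
  rw [lintegral_smul_measure, ← ofReal_integral_eq_lintegral_ofReal hInt
    (Filter.Eventually.of_forall fun θ => by positivity), smul_eq_mul,
    ← ENNReal.ofReal_inv_of_pos (by positivity), ← ENNReal.ofReal_mul (by positivity)]
  congr 1
  apply eq_inv_of_mul_eq_one_left
  rw [← h2]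
  ring

lemma dist_lower (z : ℂ) (s θ : ℝ) (hs : 0 ≤ s) : s - ‖z‖ ≤ ‖circleMap 0 s θ - z‖ := by
  have := norm_sub_norm_le (circleMap 0 s θ) z
  simpa [abs_of_nonneg hs] using this

lemma kerK_le (z : ℂ) (s θ : ℝ) (hzs : ‖z‖ < s) :
    kerK z s θ ≤ ENNReal.ofReal (((s - ‖z‖) ^ 2)⁻¹) := by
  have hs0 : 0 < s := (norm_nonneg z).trans_lt hzs
  have := dist_lower z s θ hs0.le
  have h1 : 0 < s - ‖z‖ := by linarith
  unfold kerK
  gcongr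

lemma kerK_comp (z : ℂ) (s t θ : ℝ) (hzs : ‖z‖ < s) (hzt : ‖z‖ < t) (hst : |t - s| ≤ s - ‖z‖) :
    kerK z s θ ≤ 4 * kerK z t θ := by
  have hs0 : 0 < s := (norm_nonneg z).trans_lt hzs
  have h0 := dist_lower z s θ hs0.le
  have h1 : 0 < s - ‖z‖ := by linarith
  have h2 : ‖circleMap 0 t θ - z‖ ≤ 2 * ‖circleMap 0 s θ - z‖ := by
    have e : circleMap 0 t θ - z = circleMap 0 (t - s) θ + (circleMap 0 s θ - z) := by
      simp [circleMap]; ring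
    have := norm_add_le (circleMap 0 (t - s) θ) (circleMap 0 s θ - z)
    rw [← e, norm_circleMap_zero] at this
    linarith
  unfold kerK
  have e4 : (4 : ℝ≥0∞) = ENNReal.ofReal 4 := by norm_num
  rw [e4, ← ENNReal.ofReal_mul (by norm_num)]
  apply ENNReal.ofReal_le_ofReal
  have ht' : 0 < ‖circleMap 0 t θ - z‖ := by
    have := dist_lower z t θ ((norm_nonneg z).trans hzt.le)
    linarith
  have hs' : 0 < ‖circleMap 0 s θ - z‖ := by linarith
  rw [inv_le_comm₀ (by positivity) (by positivity), mul_inv, inv_inv]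
  nlinarith

lemma holder_gen {α : Type*} [MeasurableSpace α] (ν : Measure α) (q : ℝ≥0∞) (hq : 1 ≤ q)
    (g : α → ℝ≥0∞) (hg : AEMeasurable g ν) :
    ∫⁻ x, g x ∂ν ≤ eLpNorm g q ν * ν Set.univ ^ (1 - 1 / q.toReal) := by
  have := eLpNorm_le_eLpNorm_mul_rpow_measure_univ (μ := ν) hq hg.aestronglyMeasurable
  simpa [eLpNorm_one_eq_lintegral_enorm] using this

lemma radial_holder (p : ℝ≥0∞) (hp : 1 ≤ p) (f : ℂ → ℂ)
    (hf : DifferentiableOn ℂ f (Metric.ball (0 : ℂ) 1)) (θ a b : ℝ) (ha : 0 < a) (hb : b < 1) :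
    ∫⁻ s in Set.Ioo a b, ‖f (circleMap 0 s θ)‖ₑ ≤
      ENNReal.ofReal (b - a) ^ (1 - 1 / p.toReal) * radialLp p f θ := by
  have hsub : Set.Ioo a b ⊆ Set.Ioo 0 1 := Set.Ioo_subset_Ioo ha.le hb.le
  have hcont : ContinuousOn (fun s : ℝ => f (circleMap 0 s θ)) (Set.Ioo a b) := by
    apply hf.continuousOn.comp (by unfold circleMap; fun_prop)
    intro s hs
    have := hsub hs
    simp [abs_of_pos this.1, this.2]
  have hm : AEMeasurable (fun s : ℝ => ‖f (circleMap 0 s θ)‖ₑ) (volume.restrict (Set.Ioo a b)) :=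
    (hcont.aemeasurable measurableSet_Ioo).enorm
  refine (holder_gen _ p hp _ hm).trans ?_
  rw [Measure.restrict_apply_univ, Real.volume_Ioo, mul_comm]
  gcongr
  unfold radialLp
  split_ifs with hpt
  · rw [hpt, eLpNorm_exponent_top]
    apply eLpNormEssSup_le_of_ae_enorm_bound
    filter_upwards [ae_restrict_mem measurableSet_Ioo] with s hs
    have h1 := hsub hs
    refine le_trans ?_ (le_iSup _ ⟨s, h1.1.le, h1.2⟩)
    simp [circleMap]
  · have hp0 : p ≠ 0 := (zero_lt_one.trans_le hp).ne'
    rw [eLpNorm_eq_lintegral_rpow_enorm_toReal hp0 hpt]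
    refine ENNReal.rpow_le_rpow ?_ (by positivity)
    refine (lintegral_mono_set hsub).trans (le_of_eq ?_)
    congr 1
    ext s
    rw [← ENNReal.ofReal_rpow_of_nonneg (norm_nonneg _) ENNReal.toReal_nonneg]
    simp [circleMap]

lemma ang_norm (p q : ℝ≥0∞) (hq : 1 ≤ q) (f : ℂ → ℂ) (c : ℝ≥0∞) (hc : c ≠ ⊤) (M : ℝ → ℝ≥0∞)
    (hM : ∀ θ, M θ ≤ c * radialLp p f θ) : eLpNorm M q angMeas ≤ c * rhoE p q f := by
  unfold rhoE
  split_ifs with hqt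
  · rw [hqt, eLpNorm_exponent_top]
    apply eLpNormEssSup_le_of_ae_enorm_bound
    unfold angMeas
    apply Measure.ae_smul_measure
    filter_upwards [ae_restrict_mem measurableSet_Ioo] with s hs
    refine (hM s).trans ?_
    gcongr
    exact le_iSup (fun θ : Set.Ico (0 : ℝ) (2 * Real.pi) => radialLp p f θ) ⟨s, hs.1.le, hs.2⟩
  · have hq0 : q ≠ 0 := (zero_lt_one.trans_le hq).ne'
    have hqp : 0 < q.toReal := ENNReal.toReal_pos hq0 hqt
    rw [eLpNorm_eq_lintegral_rpow_enorm_toReal hq0 hqt, angMeas, lintegral_smul_measure,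
      smul_eq_mul]
    have h1 : ∫⁻ θ in Set.Ioo 0 (2 * π), ‖M θ‖ₑ ^ q.toReal ≤
        c ^ q.toReal * ∫⁻ θ in Set.Ioo 0 (2 * π), radialLp p f θ ^ q.toReal := by
      rw [← lintegral_const_mul' _ _ (ENNReal.rpow_ne_top_of_nonneg hqp.le hc)]
      apply lintegral_mono
      intro θ
      simp only [enorm_eq_self]
      rw [← ENNReal.mul_rpow_of_nonneg _ _ hqp.le]
      gcongr
      exact hM θ
    calc _ ≤ ((ENNReal.ofReal (2 * π))⁻¹ * (c ^ q.toReal *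
            ∫⁻ θ in Set.Ioo 0 (2 * π), radialLp p f θ ^ q.toReal)) ^ (1 / q.toReal) := by gcongr
      _ = _ := by
        rw [mul_left_comm, ENNReal.mul_rpow_of_nonneg _ _ (by positivity), ← ENNReal.rpow_mul,
          mul_one_div_cancel hqp.ne', ENNReal.rpow_one]

lemma ang_holder (q : ℝ≥0∞) (hq : 1 ≤ q) (M K : ℝ → ℝ≥0∞) (hM : AEMeasurable M angMeas)
    (hK : Measurable K) (A B : ℝ≥0∞) (hB0 : B ≠ 0) (hA : ∫⁻ θ, K θ ∂angMeas ≤ A)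
    (hB : ∀ θ, K θ ≤ B) :
    ∫⁻ θ, M θ * K θ ∂angMeas ≤
      B ^ (1 / q.toReal) * eLpNorm M q angMeas * A ^ (1 - 1 / q.toReal) := by
  have hq1 : 0 ≤ 1 - 1 / q.toReal := by
    by_cases hqt : q = ⊤
    · simp [hqt]
    · have : 1 ≤ q.toReal := by
        rw [← ENNReal.toReal_one]; exact ENNReal.toReal_mono hqt hq
      have := (div_le_one (by linarith)).2 this
      linarith
  have hac := withDensity_absolutelyContinuous angMeas K
  have h1 := holder_gen (angMeas.withDensity K) q hq M (hM.mono_ac hac)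
  rw [lintegral_withDensity_eq_lintegral_mul₀ hK.aemeasurable hM, withDensity_apply _ .univ,
    Measure.restrict_univ] at h1
  simp only [Pi.mul_apply] at h1
  simp only [mul_comm (M _)]
  refine h1.trans ?_
  gcongr
  have h2 : angMeas.withDensity K ≤ B • angMeas := by
    rw [← withDensity_const]
    exact withDensity_mono (Filter.Eventually.of_forall hB)
  refine (eLpNorm_mono_measure M h2).trans ?_
  rw [eLpNorm_smul_measure_of_ne_zero hB0]
  simp

set_option maxHeartbeats 2000000 in
lemma average_bound (f : ℂ → ℂ) (hf : DifferentiableOn ℂ f (Metric.ball (0 : ℂ) 1)) (z : ℂ)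
    (a b t : ℝ) (hza : ‖z‖ < a) (hb : b < 1) (hzt : ‖z‖ < t)
    (hst : ∀ s ∈ Set.Ioo a b, |t - s| ≤ s - ‖z‖) :
    ∃ M : ℝ → ℝ≥0∞, Measurable M ∧
      (∀ θ, M θ = ∫⁻ s in Set.Ioo a b, ‖f (circleMap 0 s θ)‖ₑ) ∧
      ENNReal.ofReal (b - a) * ENNReal.ofReal ‖deriv f z‖ ≤
        4 * ∫⁻ θ, M θ * kerK z t θ ∂angMeas := by
  classical
  have ha0 : 0 < a := (norm_nonneg z).trans_lt hza
  obtain ⟨g, hgdef⟩ : ∃ g : ℂ → ℂ, g = (Metric.ball (0 : ℂ) 1).piecewise f (fun _ => 0) :=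
    ⟨_, rfl⟩
  have hg : Measurable g := by
    have := hf.continuousOn.measurable_piecewise (g := fun _ => (0:ℂ)) continuousOn_const
      Metric.isOpen_ball.measurableSet
    rw [hgdef]; exact this
  have hgf : ∀ s ∈ Set.Ioo a b, ∀ θ, g (circleMap 0 s θ) = f (circleMap 0 s θ) := by
    intro s hs θ
    rw [hgdef]
    apply Set.piecewise_eq_of_mem
    have h1 : 0 < s := ha0.trans hs.1
    have h2 : s < 1 := hs.2.trans hb
    simp [abs_of_pos h1, h2]
  have hjoint : Measurable (fun x : ℝ × ℝ => ‖g (circleMap 0 x.1 x.2)‖ₑ) := by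
    apply Measurable.enorm
    apply hg.comp
    apply Continuous.measurable
    unfold circleMap
    fun_prop
  have hjoint' : Measurable (fun x : ℝ × ℝ => ‖g (circleMap 0 x.2 x.1)‖ₑ) :=
    hjoint.comp measurable_swap
  have : SFinite angMeas := by unfold angMeas; infer_instance
  refine ⟨fun θ => ∫⁻ s in Set.Ioo a b, ‖g (circleMap 0 s θ)‖ₑ, hjoint'.lintegral_prod_right', ?_, ?_⟩
  · intro θ
    exact setLIntegral_congr_fun measurableSet_Ioo (fun s hs => by simp only [hgf s hs θ])
  calc ENNReal.ofReal (b - a) * ENNReal.ofReal ‖deriv f z‖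
      = ∫⁻ s in Set.Ioo a b, ENNReal.ofReal ‖deriv f z‖ := by
        rw [setLIntegral_const, Real.volume_Ioo, mul_comm]
    _ ≤ ∫⁻ s in Set.Ioo a b, ∫⁻ θ, ‖g (circleMap 0 s θ)‖ₑ * (4 * kerK z t θ) ∂angMeas := by
        apply setLIntegral_mono' measurableSet_Ioo
        intro s hs
        have hzs : ‖z‖ < s := hza.trans hs.1
        refine (cauchy_bound f hf z s hzs (hs.2.trans hb)).trans ?_
        apply lintegral_mono
        intro θ
        simp only [hgf s hs θ]
        gcongr
        exact kerK_comp z s t θ hzs hzt (hst s hs)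
    _ = ∫⁻ θ, (∫⁻ s in Set.Ioo a b, ‖g (circleMap 0 s θ)‖ₑ * (4 * kerK z t θ)) ∂angMeas := by
        apply lintegral_lintegral_swap
        apply Measurable.aemeasurable
        exact hjoint.mul (((measurable_kerK z t).comp measurable_snd).const_mul 4)
    _ = ∫⁻ θ, 4 * ((∫⁻ s in Set.Ioo a b, ‖g (circleMap 0 s θ)‖ₑ) * kerK z t θ) ∂angMeas := by
        apply lintegral_congr
        intro θ
        rw [lintegral_mul_const' _ _
          (ENNReal.mul_ne_top (by norm_num) (by unfold kerK; exact ENNReal.ofReal_ne_top))]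
        ring
    _ = _ := lintegral_const_mul' _ _ (by norm_num)

lemma inv_toReal_le_one (p : ℝ≥0∞) (hp : 1 ≤ p) : 1 / p.toReal ≤ 1 := by
  by_cases hqt : p = ⊤
  · simp [hqt]
  · have : 1 ≤ p.toReal := by
      rw [← ENNReal.toReal_one]; exact ENNReal.toReal_mono hqt hp
    exact (div_le_one (by linarith)).2 this

lemma real_bound (u v d x : ℝ) (hu : 0 ≤ u) (hv : 0 ≤ v) (hd : 0 < d) (hx : 0 < x)
    (hxd : x ≤ 2 * d) :
    (d / 3)⁻¹ * (4 * ((4 / d ^ 2) ^ u * (d / 3) ^ (1 - v) * (4 / d) ^ (1 - u))) ≤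
      16 * 3 ^ v * 2 ^ (v + u + 1) * x ^ (-(v + u + 1)) := by
  have e1 : (4 / d ^ 2) ^ u = 4 ^ u * d ^ (-(2 * u)) := by
    rw [Real.div_rpow (by norm_num) (by positivity), ← Real.rpow_natCast, ← Real.rpow_mul hd.le,
      Real.rpow_neg hd.le, div_eq_mul_inv]
    norm_num
  have e2 : (4 / d) ^ (1 - u) = 4 ^ (1 - u) * d ^ (-(1 - u)) := by
    rw [Real.div_rpow (by norm_num) hd.le, Real.rpow_neg hd.le, div_eq_mul_inv]
  have e3 : (d / 3)⁻¹ * (d / 3) ^ (1 - v) = 3 ^ v * d ^ (-v) := by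
    rw [← Real.rpow_neg_one (d / 3), ← Real.rpow_add (by positivity),
      show (-1 + (1 - v)) = -v by ring, Real.div_rpow hd.le (by norm_num),
      Real.rpow_neg (by norm_num : (0:ℝ) ≤ 3), div_inv_eq_mul, mul_comm]
  have e4 : (4:ℝ) ^ u * 4 ^ (1 - u) = 4 := by
    rw [← Real.rpow_add (by norm_num)]; norm_num
  have e5 : d ^ (-v) * (d ^ (-(2 * u)) * d ^ (-(1 - u))) = d ^ (-(v + u + 1)) := by
    rw [← Real.rpow_add hd, ← Real.rpow_add hd]; congr 1; ring
  have e6 : (2:ℝ) ^ (v + u + 1) * (2 * d) ^ (-(v + u + 1)) = d ^ (-(v + u + 1)) := by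
    rw [Real.mul_rpow (by norm_num) hd.le, ← mul_assoc, ← Real.rpow_add (by norm_num)]; simp
  have e7 : (2 * d) ^ (-(v + u + 1)) ≤ x ^ (-(v + u + 1)) :=
    Real.rpow_le_rpow_of_nonpos hx hxd (by linarith)
  calc _ = 4 * ((d / 3)⁻¹ * (d / 3) ^ (1 - v)) * ((4 / d ^ 2) ^ u * (4 / d) ^ (1 - u)) := by ring
    _ = 4 * 3 ^ v * ((4:ℝ) ^ u * 4 ^ (1 - u)) *
        (d ^ (-v) * (d ^ (-(2 * u)) * d ^ (-(1 - u)))) := by rw [e1, e2, e3]; ring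
    _ = 16 * 3 ^ v * (2 ^ (v + u + 1) * (2 * d) ^ (-(v + u + 1))) := by rw [e4, e5, e6]; ring
    _ ≤ 16 * 3 ^ v * (2 ^ (v + u + 1) * x ^ (-(v + u + 1))) := by gcongr
    _ = _ := by ring

/-- For `1 ≤ p, q ≤ ∞` there is a constant `C = C(p,q)` such that for every `f ∈ RM(p,q)`
and every `z ∈ 𝔻`, `|f'(z)| ≤ C (1-|z|²)^{-(1/p+1/q+1)} ρ_{p,q}(f)`. -/
theorem stmt_8 (p q : ℝ≥0∞) (hp : 1 ≤ p) (hq : 1 ≤ q) :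
    ∃ C : ℝ, 0 < C ∧ ∀ (f : ℂ → ℂ), DifferentiableOn ℂ f (Metric.ball (0 : ℂ) 1) →
      ∀ z : ℂ, ‖z‖ < 1 →
        ENNReal.ofReal ‖deriv f z‖
          ≤ ENNReal.ofReal
                (C * (1 - ‖z‖ ^ 2) ^ (-(1 / p.toReal + 1 / q.toReal + 1))) *
              rhoE p q f := by
  refine ⟨16 * 3 ^ (1 / p.toReal) * 2 ^ (1 / p.toReal + 1 / q.toReal + 1), by positivity, ?_⟩
  intro f hf z hz
  have hu1 := inv_toReal_le_one q hq
  have hv1 := inv_toReal_le_one p hp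
  have hu0 : 0 ≤ 1 / q.toReal := by positivity
  have hv0 : 0 ≤ 1 / p.toReal := by positivity
  have hn := norm_nonneg z
  obtain ⟨d, hd⟩ : ∃ d, d = 1 - ‖z‖ := ⟨_, rfl⟩
  have hd0 : 0 < d := by linarith
  have hzd : ‖z‖ = 1 - d := by linarith
  have key := real_bound (1 / q.toReal) (1 / p.toReal) d (1 - ‖z‖ ^ 2) hu0 hv0 hd0
    (by nlinarith) (by nlinarith)
  obtain ⟨M, hMm, hM, hle⟩ := average_bound f hf z (‖z‖ + d / 3) (‖z‖ + 2 * d / 3) (‖z‖ + d / 2)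
    (by linarith) (by linarith) (by linarith) (by
      intro s hs
      rw [abs_le]
      constructor <;> linarith [hs.1, hs.2])
  have hba : ‖z‖ + 2 * d / 3 - (‖z‖ + d / 3) = d / 3 := by ring
  have hM' : ∀ θ, M θ ≤ ENNReal.ofReal (d / 3) ^ (1 - 1 / p.toReal) * radialLp p f θ := by
    intro θ
    have := radial_holder p hp f hf θ (‖z‖ + d / 3) (‖z‖ + 2 * d / 3) (by linarith) (by linarith)
    rwa [hba, ← hM θ] at this
  have hmass : ∫⁻ θ, kerK z (‖z‖ + d / 2) θ ∂angMeas ≤ ENNReal.ofReal (4 / d) := by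
    rw [kerK_mass z _ (by linarith)]
    apply ENNReal.ofReal_le_ofReal
    rw [inv_le_comm₀ (by nlinarith) (by positivity), inv_div]
    nlinarith
  have hsup : ∀ θ, kerK z (‖z‖ + d / 2) θ ≤ ENNReal.ofReal (4 / d ^ 2) := by
    intro θ
    refine (kerK_le z _ θ (by linarith)).trans (le_of_eq ?_)
    congr 1
    rw [add_sub_cancel_left]
    field_simp
    try norm_num
  have h1 := ang_holder q hq M _ hMm.aemeasurable (measurable_kerK z (‖z‖ + d / 2)) _ _
    (by simpa using (by positivity : 0 < 4 / d ^ 2)) hmass hsup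
  have h2 := ang_norm p q hq f _
    (ENNReal.rpow_ne_top_of_nonneg (by linarith) ENNReal.ofReal_ne_top) M hM'
  rw [hba] at hle
  have h3 : ENNReal.ofReal (d / 3) * ENNReal.ofReal ‖deriv f z‖ ≤
      4 * (ENNReal.ofReal (4 / d ^ 2) ^ (1 / q.toReal) *
        (ENNReal.ofReal (d / 3) ^ (1 - 1 / p.toReal) * rhoE p q f) *
        ENNReal.ofReal (4 / d) ^ (1 - 1 / q.toReal)) := by
    refine hle.trans ?_
    gcongr
    refine h1.trans ?_
    gcongr
  have e4 : (4 : ℝ≥0∞) = ENNReal.ofReal 4 := by norm_num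
  calc ENNReal.ofReal ‖deriv f z‖
      = ENNReal.ofReal (d / 3)⁻¹ * (ENNReal.ofReal (d / 3) * ENNReal.ofReal ‖deriv f z‖) := by
        rw [← mul_assoc, ← ENNReal.ofReal_mul (by positivity), inv_mul_cancel₀ (by positivity)]
        simp
    _ ≤ ENNReal.ofReal (d / 3)⁻¹ * (4 * (ENNReal.ofReal (4 / d ^ 2) ^ (1 / q.toReal) *
        (ENNReal.ofReal (d / 3) ^ (1 - 1 / p.toReal) * rhoE p q f) *
        ENNReal.ofReal (4 / d) ^ (1 - 1 / q.toReal))) := by gcongr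
    _ = ENNReal.ofReal ((d / 3)⁻¹ * (4 * ((4 / d ^ 2) ^ (1 / q.toReal) *
          (d / 3) ^ (1 - 1 / p.toReal) * (4 / d) ^ (1 - 1 / q.toReal)))) * rhoE p q f := by
        rw [ENNReal.ofReal_mul (by positivity), ENNReal.ofReal_mul (by positivity),
          ENNReal.ofReal_mul (by positivity), ENNReal.ofReal_mul (by positivity),
          ENNReal.ofReal_rpow_of_pos (by positivity), ENNReal.ofReal_rpow_of_pos (by positivity),
          ENNReal.ofReal_rpow_of_pos (by positivity), ← e4]
        ring
    _ ≤ _ := by gcongr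
end

section
/- Let 1 ≤ s < ∞ and 0 < p, q ≤ ∞ with 1/p + 1/q = 1/s. Then there is a constant C > 0 such that for every f in the Hardy space H^s, ρ_{p,q}(f) ≤ C ‖f‖_{H^s}; in particular H^s ⊂ RM(p,q). -/
open MeasureTheory Complex Real ENNReal

/-- The Hardy space norm `‖f‖_{H^s} = sup_{0 ≤ r < 1} ((1/2π) ∫₀^{2π} |f(re^{iθ})|^s dθ)^{1/s}`,
valued in `ℝ≥0∞`. -/
noncomputable def hardyNorm (s : ℝ) (f : ℂ → ℂ) : ℝ≥0∞ :=
  ⨆ r : Set.Ico (0 : ℝ) 1,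
    ((ENNReal.ofReal (2 * Real.pi))⁻¹ *
        ∫⁻ θ in Set.Ioo (0 : ℝ) (2 * Real.pi),
          ENNReal.ofReal (‖f ((r : ℝ) * Complex.exp ((θ : ℂ) * Complex.I))‖ ^ s)) ^ (1 / s)


namespace HardyAux

open Metric Set Filter Topology ComplexConjugate

/-- Key identity for the Blaschke factor. -/
lemma blaschke_identity (R : ℝ) (u z : ℂ) :
    ‖(R:ℂ) ^ 2 - conj u * z‖ ^ 2 - R ^ 2 * ‖z - u‖ ^ 2
      = (R ^ 2 - ‖z‖ ^ 2) * (R ^ 2 - ‖u‖ ^ 2) := by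
  simp only [← Complex.normSq_eq_norm_sq, Complex.normSq_apply]
  simp [pow_two]
  ring

lemma blaschke_le {R : ℝ} (hR : 0 < R) {u z : ℂ} (hu : ‖u‖ < R) (hz : ‖z‖ ≤ R) :
    ‖z - u‖ ≤ ‖((R:ℂ) ^ 2 - conj u * z) / R‖ := by
  have h := blaschke_identity R u z
  have h2 : 0 ≤ (R ^ 2 - ‖z‖ ^ 2) * (R ^ 2 - ‖u‖ ^ 2) := by
    apply mul_nonneg <;> nlinarith [norm_nonneg u, norm_nonneg z]
  rw [norm_div, Complex.norm_real, Real.norm_of_nonneg hR.le, le_div_iff₀ hR]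
  apply le_of_sq_le_sq _ (norm_nonneg _)
  nlinarith

lemma blaschke_eq {R : ℝ} (hR : 0 < R) {u z : ℂ} (hz : ‖z‖ = R) :
    ‖z - u‖ = ‖((R:ℂ) ^ 2 - conj u * z) / R‖ := by
  have h := blaschke_identity R u z
  rw [norm_div, Complex.norm_real, Real.norm_of_nonneg hR.le, eq_div_iff hR.ne']
  rw [hz] at h
  have : (‖z - u‖ * R) ^ 2 = ‖(R:ℂ) ^ 2 - conj u * z‖ ^ 2 := by nlinarith
  exact (pow_left_inj₀ (by positivity) (norm_nonneg _) two_ne_zero).1 this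

lemma blaschke_ne {R : ℝ} (hR : 0 < R) {u z : ℂ} (hu : ‖u‖ < R) (hz : ‖z‖ ≤ R) :
    ((R:ℂ) ^ 2 - conj u * z) / R ≠ 0 := by
  apply div_ne_zero _ (by exact_mod_cast hR.ne')
  intro h
  rw [sub_eq_zero] at h
  have := congrArg norm h
  rw [norm_mul, norm_pow, Complex.norm_real, Real.norm_of_nonneg hR.le, Complex.norm_conj] at this
  nlinarith [norm_nonneg u, norm_nonneg z]

/-- Removal of finitely many zeros by a Blaschke product. -/
lemma exists_zero_free {R : ℝ} (hR : 0 < R) (S : Finset ℂ) :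
    ∀ f : ℂ → ℂ, AnalyticOnNhd ℂ f (closedBall 0 R) → (∀ z ∈ closedBall (0:ℂ) R, f z = 0 → z ∈ S) →
      (∀ u ∈ S, ‖u‖ < R) →
      ∃ G : ℂ → ℂ, AnalyticOnNhd ℂ G (closedBall 0 R) ∧ (∀ z ∈ closedBall (0:ℂ) R, G z ≠ 0) ∧
        (∀ z ∈ closedBall (0:ℂ) R, ‖f z‖ ≤ ‖G z‖) ∧ (∀ z ∈ sphere (0:ℂ) R, ‖f z‖ = ‖G z‖) := by
  classical
  induction S using Finset.induction_on with
  | empty =>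
    intro f hf hz _
    exact ⟨f, hf, fun z hz' h0 => by simpa using hz z hz' h0, fun _ _ => le_rfl, fun _ _ => rfl⟩
  | insert u S huS ih =>
    intro f hf hz hS
    have hu : ‖u‖ < R := hS u (by simp)
    have hub : u ∈ closedBall (0:ℂ) R := by simpa using hu.le
    have hnz : ¬ ∀ᶠ z in 𝓝 u, f z = 0 := by
      intro h
      have h2 : ∀ᶠ z in 𝓝 u, z ∈ ball (0:ℂ) R := isOpen_ball.mem_nhds (by simpa using hu)
      have h3 : ((insert u S : Finset ℂ) : Set ℂ) ∈ 𝓝 u := by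
        filter_upwards [h, h2] with z h h2
        exact hz z (ball_subset_closedBall h2) h
      exact infinite_of_mem_nhds u h3 (Finset.finite_toSet _)
    obtain ⟨n, g, hg, hgu, hfg⟩ := (hf u hub).exists_eventuallyEq_pow_smul_nonzero_iff.2 hnz
    let b : ℂ → ℂ := fun z => ((R:ℂ) ^ 2 - conj u * z) / R
    have hb : ∀ z, AnalyticAt ℂ b z := by
      intro z
      have : (R:ℂ) ≠ 0 := by exact_mod_cast hR.ne'
      unfold b
      fun_prop (disch := assumption)
    let G1 : ℂ → ℂ := fun z => if z = u then b z ^ n * g z else f z / (z - u) ^ n * b z ^ n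
    have hG1 : AnalyticOnNhd ℂ G1 (closedBall 0 R) := by
      intro z hz'
      by_cases hzu : z = u
      · subst hzu
        refine (((hb z).pow n).mul hg).congr ?_
        filter_upwards [hfg] with x hx
        by_cases hxz : x = z
        · simp [G1, hxz]
        · have : x - z ≠ 0 := sub_ne_zero.2 hxz
          simp only [G1, hxz, if_false, hx, smul_eq_mul, Pi.mul_apply, Pi.pow_apply]
          field_simp
      · have h1 : AnalyticAt ℂ (fun x => f x / (x - u) ^ n * b x ^ n) z := by
          have := hf z hz'
          have hb' := hb z
          have h0 : (z - u) ^ n ≠ 0 := pow_ne_zero _ (sub_ne_zero.2 hzu)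
          fun_prop (disch := assumption)
        refine h1.congr ?_
        filter_upwards [isOpen_ne.mem_nhds hzu] with x hx
        have hx' : x ≠ u := hx
        simp [G1, hx']
    have hbn : ∀ z ∈ closedBall (0:ℂ) R, b z ≠ 0 := fun z hz' =>
      blaschke_ne hR hu (by simpa using hz')
    have hfu : f u = (u - u) ^ n * g u := hfg.self_of_nhds
    obtain ⟨G, h1, h2, h3, h4⟩ := ih G1 hG1 (by
      intro z hz' h0
      by_cases hzu : z = u
      · subst hzu
        simp [G1, hgu, hbn z hz'] at h0
      · have : f z = 0 := by
          simp only [G1, hzu, if_false] at h0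
          have h5 : z - u ≠ 0 := sub_ne_zero.2 hzu
          simpa [h5, hbn z hz'] using h0
        have := hz z hz' this
        simpa [hzu] using this) (fun v hv => hS v (by simp [hv]))
    have hle : ∀ z ∈ closedBall (0:ℂ) R, ‖f z‖ ≤ ‖G1 z‖ := by
      intro z hz'
      have hzR : ‖z‖ ≤ R := by simpa using hz'
      have hbl : ‖z - u‖ ≤ ‖b z‖ := blaschke_le hR hu hzR
      by_cases hzu : z = u
      · subst hzu
        rw [hfu]
        simp only [G1, if_true, norm_mul, norm_pow]
        gcongr
      · simp only [G1, hzu, if_false, norm_mul, norm_pow, norm_div]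
        have h5 : 0 < ‖z - u‖ := norm_pos_iff.2 (sub_ne_zero.2 hzu)
        rw [div_mul_eq_mul_div, le_div_iff₀ (by positivity)]
        gcongr
    have heq : ∀ z ∈ sphere (0:ℂ) R, ‖f z‖ = ‖G1 z‖ := by
      intro z hz'
      have hzR : ‖z‖ = R := by simpa using hz'
      have hbl : ‖z - u‖ = ‖b z‖ := blaschke_eq hR hzR
      have hzu : z ≠ u := by rintro rfl; exact hu.ne hzR
      simp only [G1, hzu, if_false, norm_mul, norm_pow, norm_div]
      have h5 : 0 < ‖z - u‖ := norm_pos_iff.2 (sub_ne_zero.2 hzu)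
      rw [← hbl]
      field_simp
    exact ⟨G, h1, h2, fun z hz' => (hle z hz').trans (h3 z hz'),
      fun z hz' => (heq z hz').trans (h4 z hz')⟩

lemma poisson_nonneg {R : ℝ} {w z : ℂ} (hw : ‖w‖ < R) (hz : ‖z‖ = R) :
    0 ≤ poissonKernel 0 w z := by
  rw [poissonKernel_def]
  apply div_nonneg _ (by positivity)
  simp only [sub_zero, hz]
  nlinarith [norm_nonneg w]

lemma poisson_continuousOn {R : ℝ} {w : ℂ} (hw : ‖w‖ < R) :
    ContinuousOn (poissonKernel 0 w) (sphere 0 R) := by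
  have : ∀ z ∈ sphere (0:ℂ) R, ‖z - 0 - (w - 0)‖ ^ 2 ≠ 0 := by
    intro z hz
    have hz : ‖z‖ = R := by simpa using hz
    have : z - 0 - (w - 0) ≠ 0 := by
      simp only [sub_zero]
      intro h
      rw [sub_eq_zero.1 h] at hz
      exact hw.ne hz
    positivity
  unfold poissonKernel
  fun_prop (disch := assumption)

/-- Sub-mean value property with the Poisson kernel for zero-free functions. -/
lemma zero_free_poisson {R a : ℝ} (hR : 0 < R) {G : ℂ → ℂ}
    (hG : AnalyticOnNhd ℂ G (closedBall 0 R)) (hG0 : ∀ z ∈ closedBall (0:ℂ) R, G z ≠ 0)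
    {w : ℂ} (hw : ‖w‖ < R) :
    ‖G w‖ ^ a ≤ Real.circleAverage (fun z => poissonKernel 0 w z * ‖G z‖ ^ a) 0 R := by
  have hwb : w ∈ ball (0:ℂ) R := by simpa using hw
  have hwc := ball_subset_closedBall hwb
  have hharm : InnerProductSpace.HarmonicOnNhd (fun z => Real.log ‖G z‖) (closedBall 0 R) :=
    fun z hz => (hG z hz).harmonicAt_log_norm (hG0 z hz)
  have h1 := hharm.circleAverage_poissonKernel_smul hwb
  have h2 := (InnerProductSpace.HarmonicOnNhd.circleAverage_poissonKernel_smul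
    (f := fun _ : ℂ => (1:ℝ)) (c := 0) (R := R)
    (fun z _ => InnerProductSpace.harmonicAt_const _) hwb)
  have hGc : ContinuousOn G (sphere 0 R) := hG.continuousOn.mono sphere_subset_closedBall
  have hpos : ∀ z ∈ sphere (0:ℂ) R, ‖G z‖ ≠ 0 := fun z hz =>
    norm_ne_zero_iff.2 (hG0 z (sphere_subset_closedBall hz))
  have hP := poisson_continuousOn hw
  have c1 : ContinuousOn (fun z => poissonKernel 0 w z * ‖G z‖ ^ a) (sphere 0 R) :=
    hP.mul (hGc.norm.rpow_const fun z hz => Or.inl (hpos z hz))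
  have c2 : ContinuousOn (poissonKernel 0 w • fun z => Real.log ‖G z‖) (sphere 0 R) :=
    hP.smul (hGc.norm.log hpos)
  have c3 : ContinuousOn (poissonKernel 0 w • fun _ : ℂ => (1:ℝ)) (sphere 0 R) :=
    hP.smul continuousOn_const
  have i1 := c1.circleIntegrable hR.le
  have i2 := c2.circleIntegrable hR.le
  have i3 := c3.circleIntegrable hR.le
  set A := ‖G w‖ ^ a with hA
  set L := Real.log ‖G w‖ with hL
  have key : Real.circleAverage ((A * (1 - a * L)) • (poissonKernel 0 w • fun _ : ℂ => (1:ℝ)) +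
      (A * a) • (poissonKernel 0 w • fun z => Real.log ‖G z‖)) 0 R ≤
      Real.circleAverage (fun z => poissonKernel 0 w z * ‖G z‖ ^ a) 0 R := by
    apply Real.circleAverage_mono ((i3.const_smul).add (i2.const_smul)) i1
    intro z hz
    rw [abs_of_pos hR] at hz
    have hz' : ‖z‖ = R := by simpa using hz
    have hp := poisson_nonneg hw hz'
    simp only [Pi.add_apply, Pi.smul_apply, smul_eq_mul, Pi.mul_apply, mul_one]
    have hGz : 0 < ‖G z‖ := (norm_nonneg _).lt_of_ne' (hpos z hz)
    have hGw : 0 < ‖G w‖ := norm_pos_iff.2 (hG0 w hwc)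
    have : A * (1 + a * (Real.log ‖G z‖ - L)) ≤ ‖G z‖ ^ a := by
      have e := Real.add_one_le_exp (a * (Real.log ‖G z‖ - L))
      have : ‖G z‖ ^ a = A * Real.exp (a * (Real.log ‖G z‖ - L)) := by
        rw [hA, Real.rpow_def_of_pos hGz, Real.rpow_def_of_pos hGw, ← Real.exp_add]
        congr 1
        ring
      rw [this]
      have : 0 ≤ A := by positivity
      gcongr
      linarith
    nlinarith
  rw [Real.circleAverage_add i3.const_smul i2.const_smul, Real.circleAverage_smul,
    Real.circleAverage_smul, h1, h2] at key
  simp only [smul_eq_mul] at key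
  linarith

/-- There are radii arbitrarily close to `1` for which the Poisson inequality holds. -/
lemma exists_good_radius {f : ℂ → ℂ} (hf : DifferentiableOn ℂ f (ball 0 1)) {a : ℝ} (ha : 0 < a)
    {R0 : ℝ} (h0 : 0 ≤ R0) (h1 : R0 < 1) :
    ∃ R, R0 < R ∧ R < 1 ∧ ∀ w : ℂ, ‖w‖ < R →
      ‖f w‖ ^ a ≤ Real.circleAverage (fun z => poissonKernel 0 w z * ‖f z‖ ^ a) 0 R := by
  have hfa : AnalyticOnNhd ℂ f (ball 0 1) := hf.analyticOnNhd isOpen_ball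
  rcases hfa.eqOn_zero_or_eventually_ne_zero_of_preconnected
    (convex_ball (0:ℂ) 1).isPreconnected with h | h
  · refine ⟨(R0 + 1) / 2, by linarith, by linarith, fun w hw => ?_⟩
    have : f w = 0 := h (by simp; linarith)
    rw [this, norm_zero, Real.zero_rpow ha.ne']
    apply Real.circleAverage_nonneg_of_nonneg
    intro z hz
    rw [abs_of_pos (by linarith)] at hz
    exact mul_nonneg (poisson_nonneg hw (by simpa using hz)) (by positivity)
  · have hR1 : (R0 + 1) / 2 < 1 := by linarith
    have hfin : (closedBall (0:ℂ) ((R0 + 1) / 2) ∩ {z | f z = 0}).Finite := by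
      have h' : {z | f z ≠ 0} ∈ codiscreteWithin (closedBall (0:ℂ) ((R0 + 1) / 2)) :=
        (codiscreteWithin_mono (closedBall_subset_ball hR1)) h
      have := (isCompact_closedBall (0:ℂ) ((R0 + 1) / 2)).finite_sdiff_of_mem_codiscreteWithin h'
      refine this.subset ?_
      intro z hz
      exact ⟨hz.1, by simpa using hz.2⟩
    have hinf : ((Ioo R0 ((R0 + 1) / 2)) \ (norm '' (closedBall (0:ℂ) ((R0 + 1) / 2) ∩ {z | f z = 0}))).Infinite :=
      (Ioo_infinite (by linarith)).sdiff (hfin.image _)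
    obtain ⟨R, ⟨hRa, hRb⟩, hRn⟩ := hinf.nonempty
    have hRpos : 0 < R := by linarith
    refine ⟨R, hRa, by linarith, fun w hw => ?_⟩
    have hsub : closedBall (0:ℂ) R ⊆ closedBall (0:ℂ) ((R0 + 1) / 2) :=
      closedBall_subset_closedBall hRb.le
    obtain ⟨G, g1, g2, g3, g4⟩ := exists_zero_free hRpos
      ((hfin.subset (inter_subset_inter_left _ hsub)).toFinset) f
      (hfa.mono (closedBall_subset_ball (by linarith)))
      (fun z hz h0 => by simpa using ⟨by simpa using hz, h0⟩)
      (by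
        intro u hu
        have hu : ‖u‖ ≤ R ∧ f u = 0 := by simpa using hu
        refine lt_of_le_of_ne hu.1 fun h => hRn ⟨u, ⟨by simp; linarith, hu.2⟩, h⟩)
    have hwc : w ∈ closedBall (0:ℂ) R := by simpa using hw.le
    calc ‖f w‖ ^ a ≤ ‖G w‖ ^ a := by gcongr; exact g3 w hwc
      _ ≤ _ := zero_free_poisson hRpos g1 g2 hw
      _ = _ := by
        apply Real.circleAverage_congr_sphere
        intro z hz
        rw [abs_of_pos hRpos] at hz
        simp only [g4 z hz]


/-- The Poisson kernel of the unit disc. -/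
noncomputable def Pk (r t : ℝ) : ℝ := (1 - r ^ 2) / (1 - 2 * r * Real.cos t + r ^ 2)

lemma Pk_den_pos {r : ℝ} (h0 : 0 ≤ r) (h1 : r < 1) (t : ℝ) :
    0 < 1 - 2 * r * Real.cos t + r ^ 2 := by
  nlinarith [Real.cos_le_one t, mul_nonneg h0 (sub_nonneg.2 (Real.cos_le_one t))]

lemma Pk_nonneg {r : ℝ} (h0 : 0 ≤ r) (h1 : r < 1) (t : ℝ) : 0 ≤ Pk r t :=
  div_nonneg (by nlinarith) (Pk_den_pos h0 h1 t).le

lemma Pk_neg (r t : ℝ) : Pk r (-t) = Pk r t := by simp [Pk]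

lemma Pk_continuous {r : ℝ} (h0 : 0 ≤ r) (h1 : r < 1) : Continuous (Pk r) := by
  unfold Pk
  have := fun t => (Pk_den_pos h0 h1 t).ne'
  fun_prop (disch := assumption)

lemma Pk_le {r : ℝ} (h0 : 0 ≤ r) {r0 : ℝ} (hr : r ≤ r0) (h1 : r0 < 1) (t : ℝ) :
    Pk r t ≤ 2 / (1 - r0) := by
  have hd : (1 - r) ^ 2 ≤ 1 - 2 * r * Real.cos t + r ^ 2 := by
    nlinarith [mul_nonneg h0 (sub_nonneg.2 (Real.cos_le_one t))]
  unfold Pk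
  rw [div_le_div_iff₀ (Pk_den_pos h0 (by linarith) t) (by linarith)]
  nlinarith [mul_nonneg h0 (sub_nonneg.2 hr)]

lemma Pk_measurable : Measurable (fun z : ℝ × ℝ => Pk z.1 z.2) := by
  unfold Pk
  fun_prop

/-- Comparison of Poisson kernels. -/
lemma Pk_mul_le {r r' : ℝ} (h0 : 0 ≤ r) (hr : r ≤ r') (h1 : r' < 1) (t : ℝ) :
    Pk (r * r') t ≤ 8 * Pk r t := by
  have hrr : r * r' < 1 := by nlinarith
  have h0' : 0 ≤ r * r' := mul_nonneg h0 (h0.trans hr)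
  unfold Pk
  rw [← mul_div_assoc, div_le_div_iff₀ (Pk_den_pos h0' hrr t) (Pk_den_pos h0 (by linarith) t)]
  have a1 : 1 - (r * r') ^ 2 ≤ 2 * (1 - r ^ 2) := by
    have : r ^ 2 ≤ r * r' := by nlinarith
    nlinarith [sq_nonneg (r ^ 2 - 1), sq_nonneg r]
  have a2 : 1 - 2 * r * Real.cos t + r ^ 2 ≤
      4 * (1 - 2 * (r * r') * Real.cos t + (r * r') ^ 2) := by
    have hc := Real.cos_le_one t
    have hc' := Real.neg_one_le_cos t
    set c := Real.cos t
    set q := r * r'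
    have hq : q ≤ r := by nlinarith
    have hq1 : r - q ≤ 1 - q := by nlinarith
    have hsq : (1 - q) ^ 2 ≤ 1 - 2 * q * c + q ^ 2 := by nlinarith
    have e : 1 - 2 * r * c + r ^ 2 ≤ 2 * (1 - 2 * q * c + q ^ 2) + 2 * (r - q) ^ 2 := by
      nlinarith [sq_nonneg (1 - 2 * q * c + r * c), sq_nonneg (c * (2 * q - r) - 1), sq_nonneg (2*q - r), mul_nonneg (sub_nonneg.2 hc) (by linarith : 0 ≤ 1 + c), mul_nonneg (mul_nonneg (sub_nonneg.2 hc) (by linarith : 0 ≤ 1 + c)) (sq_nonneg (2 * q - r))]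
    nlinarith
  have b1 : 0 ≤ 1 - r ^ 2 := by nlinarith
  have b2 := Pk_den_pos h0 (by linarith : r < 1) t
  calc _ ≤ 2 * (1 - r ^ 2) * (4 * (1 - 2 * (r * r') * Real.cos t + (r * r') ^ 2)) :=
        mul_le_mul a1 a2 b2.le (by linarith)
    _ = _ := by ring

lemma Pk_mul_le_add {r r' : ℝ} (h0 : 0 ≤ r) (h1 : r < 1) (h0' : 0 ≤ r') (h1' : r' < 1) (t : ℝ) :
    Pk (r * r') t ≤ 8 * (Pk r t + Pk r' t) := by
  have p1 := Pk_nonneg h0 h1 t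
  have p2 := Pk_nonneg h0' h1' t
  rcases le_total r r' with h | h
  · linarith [Pk_mul_le h0 h h1' t]
  · rw [mul_comm r r']
    linarith [Pk_mul_le h0' h h1 t]

lemma re_cayley (r t : ℝ) :
    ((1 + r * Complex.exp (t * Complex.I)) / (1 - r * Complex.exp (t * Complex.I))).re = Pk r t := by
  have h := Real.sin_sq_add_cos_sq t
  have e1 : (1 - 2 * r * Real.cos t + r ^ 2) =
      Complex.normSq (1 - r * Complex.exp (t * Complex.I)) := by
    rw [Complex.normSq_apply]
    simp [Complex.exp_ofReal_mul_I_re, Complex.exp_ofReal_mul_I_im]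
    linear_combination (-r ^ 2) * h
  rw [Complex.div_re, ← add_div, Pk, e1]
  congr 1
  simp [Complex.exp_ofReal_mul_I_re, Complex.exp_ofReal_mul_I_im]
  linear_combination (-r ^ 2) * h

lemma poissonKernel_circle {R : ℝ} (hR : 0 < R) (r φ θ : ℝ) :
    poissonKernel 0 ((R * r : ℝ) * Complex.exp (φ * Complex.I)) (circleMap 0 R θ) =
      Pk r (φ - θ) := by
  rw [poissonKernel_eq_re_herglotzRieszKernel, Function.comp_apply, herglotzRieszKernel_def,
    ← re_cayley]
  congr 1
  have h2 : Complex.exp (φ * Complex.I) =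
      Complex.exp (θ * Complex.I) * Complex.exp ((φ - θ : ℝ) * Complex.I) := by
    rw [← Complex.exp_add]
    congr 1
    push_cast
    ring
  have h3 := Complex.exp_ne_zero (θ * Complex.I)
  have h4 : (R:ℂ) ≠ 0 := by exact_mod_cast hR.ne'
  rw [h2, circleMap_zero]
  simp only [sub_zero]
  push_cast
  refine Eq.trans ?_ (mul_div_mul_left _ _ (mul_ne_zero h4 h3))
  congr 1 <;> ring

lemma Pk_semigroup {r r' : ℝ} (h0 : 0 ≤ r) (h1 : r < 1) (h0' : 0 ≤ r') (h1' : r' < 1)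
    (θ φ : ℝ) :
    ∫ x in (0:ℝ)..(2 * Real.pi), Pk r (θ - x) * Pk r' (φ - x) =
      2 * Real.pi * Pk (r * r') (θ - φ) := by
  let b : ℂ := r' * Complex.exp (-φ * Complex.I)
  have hb : ‖b‖ = r' := by
    simp only [b, norm_mul, Complex.norm_real, Real.norm_of_nonneg h0']
    have := Complex.norm_exp_ofReal_mul_I (-φ)
    push_cast at this
    rw [this, mul_one]
  let F : ℂ → ℂ := fun z => (1 + b * z) / (1 - b * z)
  have hF : InnerProductSpace.HarmonicOnNhd (fun z => (F z).re) (closedBall 0 1) := by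
    intro z hz
    have hz : ‖z‖ ≤ 1 := by simpa using hz
    have hne : 1 - b * z ≠ 0 := by
      intro h
      have := congrArg norm (sub_eq_zero.1 h)
      rw [norm_mul, hb, norm_one] at this
      nlinarith [norm_nonneg z]
    have : AnalyticAt ℂ F z := by
      unfold F
      fun_prop (disch := assumption)
    exact this.harmonicAt_re
  have hFe : ∀ ρ x : ℝ, (F (ρ * Complex.exp (x * Complex.I))).re = Pk (ρ * r') (x - φ) := by
    intro ρ x
    rw [← re_cayley]
    have : b * (ρ * Complex.exp (x * Complex.I)) =
        ((ρ * r' : ℝ) : ℂ) * Complex.exp ((x - φ : ℝ) * Complex.I) := by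
      have : Complex.exp ((x - φ : ℝ) * Complex.I) =
          Complex.exp (-φ * Complex.I) * Complex.exp (x * Complex.I) := by
        rw [← Complex.exp_add]
        congr 1
        push_cast
        ring
      rw [this]
      simp only [b]
      push_cast
      ring
    simp only [F, this]
  have key := hF.circleAverage_poissonKernel_smul (w := (r : ℂ) * Complex.exp (θ * Complex.I))
    (by simp [abs_of_nonneg h0, h1])
  rw [hFe, Real.circleAverage_def] at key
  have : ∀ x : ℝ, (poissonKernel 0 ((r : ℂ) * Complex.exp (θ * Complex.I)) • fun z => (F z).re)
      (circleMap 0 1 x) = Pk r (θ - x) * Pk r' (φ - x) := by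
    intro x
    have p := poissonKernel_circle one_pos r θ x
    rw [one_mul] at p
    simp only [smul_eq_mul, Pi.mul_apply, p]
    have q := hFe 1 x
    rw [one_mul] at q
    rw [circleMap_zero, q, ← Pk_neg r' (x - φ), neg_sub]
  simp only [this, smul_eq_mul] at key
  rw [← key]
  have := Real.pi_pos
  field_simp

/-- Normalisation-free measure on the circle. -/
noncomputable abbrev mu : Measure ℝ := volume.restrict (Ioo (0:ℝ) (2 * Real.pi))

lemma lintegral_mu_eq {h : ℝ → ℝ} (hc : Continuous h) (hn : ∀ x, 0 ≤ h x) :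
    ∫⁻ x, ENNReal.ofReal (h x) ∂mu = ENNReal.ofReal (∫ x in (0:ℝ)..(2 * Real.pi), h x) := by
  have hp := Real.pi_pos
  rw [intervalIntegral.integral_of_le (by positivity), integral_Ioc_eq_integral_Ioo,
    ofReal_integral_eq_lintegral_ofReal]
  · exact (hc.integrableOn_Icc (a := 0) (b := 2 * Real.pi)).mono_set Ioo_subset_Icc_self
  · exact Eventually.of_forall hn

lemma lintegral_Pk_mul {r r' : ℝ} (h0 : 0 ≤ r) (h1 : r < 1) (h0' : 0 ≤ r') (h1' : r' < 1)
    (θ φ : ℝ) :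
    ∫⁻ x, ENNReal.ofReal (Pk r (θ - x)) * ENNReal.ofReal (Pk r' (φ - x)) ∂mu =
      ENNReal.ofReal (2 * Real.pi * Pk (r * r') (θ - φ)) := by
  rw [← Pk_semigroup h0 h1 h0' h1', ← lintegral_mu_eq]
  · refine lintegral_congr fun x => ?_
    rw [ENNReal.ofReal_mul (Pk_nonneg h0 h1 _)]
  · have := Pk_continuous h0 h1
    have := Pk_continuous h0' h1'
    fun_prop
  · exact fun x => mul_nonneg (Pk_nonneg h0 h1 _) (Pk_nonneg h0' h1' _)


lemma cs_sq {α : Type*} [MeasurableSpace α] (μ : Measure α) {f g : α → ℝ≥0∞}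
    (hf : Measurable f) (hg : Measurable g) :
    (∫⁻ a, f a * g a ∂μ) ^ 2 ≤ (∫⁻ a, f a ^ 2 ∂μ) * ∫⁻ a, g a ^ 2 ∂μ := by
  have h := ENNReal.lintegral_mul_le_Lp_mul_Lq μ Real.HolderConjugate.two_two hf.aemeasurable
    hg.aemeasurable
  have h2 := pow_le_pow_left' h 2
  simp only [Pi.mul_apply] at h2
  refine h2.trans (le_of_eq ?_)
  rw [mul_pow]
  congr 1 <;>
  · rw [← ENNReal.rpow_natCast, ← ENNReal.rpow_mul]
    norm_num

lemma cancel_sq {X Y : ℝ≥0∞} (hX : X ≠ ⊤) (h : X ^ 2 ≤ Y * X) : X ≤ Y := by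
  rcases eq_or_ne X 0 with h0 | h0
  · simp [h0]
  · rw [sq] at h
    exact (ENNReal.mul_le_mul_iff_left h0 hX).1 h

lemma tt_star {α β : Type*} [MeasurableSpace α] [MeasurableSpace β] (μ : Measure α)
    (ν : Measure β) [SFinite μ] [SFinite ν] {k : α → β → ℝ≥0∞}
    (hk : Measurable (Function.uncurry k)) {g : β → ℝ≥0∞} (hg : Measurable g)
    {h : α → ℝ≥0∞} (hh : ∀ a, h a = ∫⁻ x, k a x * g x ∂ν) {D : ℝ≥0∞}
    (hfin : ∫⁻ a, h a ^ 2 ∂μ ≠ ⊤)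
    (hT : ∫⁻ x, (∫⁻ a, k a x * h a ∂μ) ^ 2 ∂ν ≤ D * ∫⁻ a, h a ^ 2 ∂μ) :
    ∫⁻ a, h a ^ 2 ∂μ ≤ D * ∫⁻ x, g x ^ 2 ∂ν := by
  have hkg : Measurable (Function.uncurry fun a x => k a x * g x) := by
    exact hk.mul (hg.comp measurable_snd)
  have hm : Measurable h := by
    have : h = fun a => ∫⁻ x, k a x * g x ∂ν := funext hh
    rw [this]
    exact hkg.lintegral_prod_right
  have hkh : Measurable (Function.uncurry fun a x => k a x * h a) := by
    exact hk.mul (hm.comp measurable_fst)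
  have hTm : Measurable fun x => ∫⁻ a, k a x * h a ∂μ := hkh.lintegral_prod_left
  apply cancel_sq hfin
  have e : ∫⁻ a, h a ^ 2 ∂μ = ∫⁻ x, g x * ∫⁻ a, k a x * h a ∂μ ∂ν := by
    have e1 : ∀ a, h a ^ 2 = ∫⁻ x, k a x * g x * h a ∂ν := by
      intro a
      rw [lintegral_mul_const _ (hkg.of_uncurry_left (x := a)), ← hh, sq]
    simp_rw [e1]
    rw [lintegral_lintegral_swap]
    · refine lintegral_congr fun x => ?_
      rw [← lintegral_const_mul _ (hkh.of_uncurry_right (y := x))]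
      refine lintegral_congr fun a => ?_
      ring
    · exact (hkg.mul (hm.comp measurable_fst)).aemeasurable
  calc (∫⁻ a, h a ^ 2 ∂μ) ^ 2 = (∫⁻ x, g x * ∫⁻ a, k a x * h a ∂μ ∂ν) ^ 2 := by rw [← e]
    _ ≤ _ := cs_sq ν hg hTm
    _ ≤ (∫⁻ x, g x ^ 2 ∂ν) * (D * ∫⁻ a, h a ^ 2 ∂μ) := by gcongr
    _ = _ := by ring

lemma star_sq {α β : Type*} [MeasurableSpace α] [MeasurableSpace β] (μ : Measure α)
    (ν : Measure β) [SFinite μ] [SFinite ν] {k : α → β → ℝ≥0∞}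
    (hk : Measurable (Function.uncurry k)) {h : α → ℝ≥0∞} (hm : Measurable h) :
    ∫⁻ x, (∫⁻ a, k a x * h a ∂μ) ^ 2 ∂ν =
      ∫⁻ a, ∫⁻ b, (∫⁻ x, k a x * k b x ∂ν) * (h a * h b) ∂μ ∂μ := by
  have hkh : Measurable (Function.uncurry fun a x => k a x * h a) := by
    exact hk.mul (hm.comp measurable_fst)
  have hTm : Measurable fun x => ∫⁻ a, k a x * h a ∂μ := hkh.lintegral_prod_left
  have e1 : ∀ x, (∫⁻ a, k a x * h a ∂μ) ^ 2 =
      ∫⁻ a, (k a x * h a) * ∫⁻ b, k b x * h b ∂μ ∂μ := by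
    intro x
    rw [lintegral_mul_const _ (hkh.of_uncurry_right (y := x)), sq]
  simp_rw [e1]
  rw [lintegral_lintegral_swap]
  · refine lintegral_congr fun a => ?_
    have e2 : ∀ x, (k a x * h a) * ∫⁻ b, k b x * h b ∂μ =
        ∫⁻ b, (k a x * h a) * (k b x * h b) ∂μ := by
      intro x
      rw [lintegral_const_mul _ (hkh.of_uncurry_right (y := x))]
    simp_rw [e2]
    rw [lintegral_lintegral_swap]
    · refine lintegral_congr fun b => ?_
      have hab : Measurable fun x => k a x * k b x :=
        (hk.of_uncurry_left (x := a)).mul (hk.of_uncurry_left (x := b))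
      rw [← lintegral_mul_const _ hab]
      refine lintegral_congr fun x => ?_
      ring
    · refine Measurable.aemeasurable ?_
      exact ((hkh.of_uncurry_left (x := a)).comp measurable_fst).mul (hkh.comp measurable_swap)
  · refine Measurable.aemeasurable ?_
    exact (hkh.comp measurable_swap).mul (hTm.comp measurable_fst)

lemma lintegral_Pk {r : ℝ} (h0 : 0 ≤ r) (h1 : r < 1) (θ : ℝ) :
    ∫⁻ x, ENNReal.ofReal (Pk r (θ - x)) ∂mu = ENNReal.ofReal (2 * Real.pi) := by
  have := lintegral_Pk_mul h0 h1 le_rfl zero_lt_one θ θ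
  simpa [Pk] using this

lemma lintegral_Pk_mul_le {r : ℝ} (h0 : 0 ≤ r) (h1 : r < 1) (θ : ℝ) {g : ℝ → ℝ≥0∞} {B : ℝ≥0∞}
    (hB : ∀ x, g x ≤ B) :
    ∫⁻ x, ENNReal.ofReal (Pk r (θ - x)) * g x ∂mu ≤ ENNReal.ofReal (2 * Real.pi) * B := by
  calc _ ≤ ∫⁻ x, ENNReal.ofReal (Pk r (θ - x)) * B ∂mu := by
        gcongr with x
        exact hB x
    _ = _ := by
        rw [lintegral_mul_const, lintegral_Pk h0 h1]
        have := Pk_continuous h0 h1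
        fun_prop

/-- The linearised radial maximal function is bounded on `L²`. -/
lemma maximal_aux {ρ : ℝ → ℝ} (hρ : Measurable ρ) {r0 : ℝ} (hr0 : r0 < 1)
    (hρ0 : ∀ θ, 0 ≤ ρ θ) (hρ1 : ∀ θ, ρ θ ≤ r0) {g : ℝ → ℝ≥0∞} (hg : Measurable g)
    {B : ℝ≥0∞} (hB : B ≠ ⊤) (hgB : ∀ x, g x ≤ B) :
    ∫⁻ θ, (∫⁻ x, ENNReal.ofReal (Pk (ρ θ) (θ - x)) * g x ∂mu) ^ 2 ∂mu ≤
      ENNReal.ofReal (32 * Real.pi) ^ 2 * ∫⁻ x, g x ^ 2 ∂mu := by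
  set k : ℝ → ℝ → ℝ≥0∞ := fun θ x => ENNReal.ofReal (Pk (ρ θ) (θ - x)) with hkdef
  have hp := Real.pi_pos
  have hk : Measurable (Function.uncurry k) := by
    refine ENNReal.measurable_ofReal.comp ?_
    exact Pk_measurable.comp ((hρ.comp measurable_fst).prodMk (measurable_fst.sub measurable_snd))
  set h : ℝ → ℝ≥0∞ := fun θ => ∫⁻ x, k θ x * g x ∂mu with hhdef
  have hkg : Measurable (Function.uncurry fun a x => k a x * g x) := by
    exact hk.mul (hg.comp measurable_snd)
  have hm : Measurable h := hkg.lintegral_prod_right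
  have hkh : Measurable (Function.uncurry fun a x => k a x * h a) := by
    exact hk.mul (hm.comp measurable_fst)
  have hTm : Measurable fun x => ∫⁻ a, k a x * h a ∂mu := hkh.lintegral_prod_left
  have hlt : ∀ θ, ρ θ < 1 := fun θ => (hρ1 θ).trans_lt hr0
  have hM : ∀ θ, h θ ≤ ENNReal.ofReal (2 * Real.pi) * B := fun θ =>
    lintegral_Pk_mul_le (hρ0 θ) (hlt θ) θ hgB
  have hMt : ENNReal.ofReal (2 * Real.pi) * B ≠ ⊤ := ENNReal.mul_ne_top ENNReal.ofReal_ne_top hB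
  have bdd : ∀ (u : ℝ → ℝ≥0∞) (c : ℝ≥0∞), c ≠ ⊤ → (∀ x, u x ≤ c) → ∫⁻ x, u x ∂mu ≠ ⊤ := by
    intro u c hc hu
    refine ne_top_of_le_ne_top ?_ (lintegral_mono hu)
    rw [lintegral_const]
    exact ENNReal.mul_ne_top hc (measure_ne_top _ _)
  refine tt_star mu mu hk hg (h := h) (fun a => rfl) ?_ ?_
  · exact bdd _ ((ENNReal.ofReal (2 * Real.pi) * B) ^ 2) (ENNReal.pow_ne_top hMt)
      fun x => pow_le_pow_left' (hM x) 2
  · set Y := ∫⁻ x, (∫⁻ a, k a x * h a ∂mu) ^ 2 ∂mu with hY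
    have hkle : ∀ θ x, k θ x ≤ ENNReal.ofReal (2 / (1 - r0)) := fun θ x =>
      ENNReal.ofReal_le_ofReal (Pk_le (hρ0 θ) (hρ1 θ) hr0 _)
    have hYfin : Y ≠ ⊤ := by
      have c1 : ENNReal.ofReal (2 / (1 - r0)) * (ENNReal.ofReal (2 * Real.pi) * B) ≠ ⊤ :=
        ENNReal.mul_ne_top ENNReal.ofReal_ne_top hMt
      refine bdd _ ((ENNReal.ofReal (2 / (1 - r0)) * (ENNReal.ofReal (2 * Real.pi) * B) *
        mu univ) ^ 2) (ENNReal.pow_ne_top (ENNReal.mul_ne_top c1 (measure_ne_top _ _))) ?_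
      intro x
      refine pow_le_pow_left' ?_ 2
      rw [← lintegral_const]
      exact lintegral_mono fun a => mul_le_mul' (hkle a x) (hM a)
    apply cancel_sq hYfin
    have hK : ∀ a b, ∫⁻ x, k a x * k b x ∂mu ≤
        ENNReal.ofReal (16 * Real.pi) * (k a b + k b a) := by
      intro a b
      rw [hkdef]
      simp only
      rw [lintegral_Pk_mul (hρ0 a) (hlt a) (hρ0 b) (hlt b), ← neg_sub a b, Pk_neg,
        ← ENNReal.ofReal_add (Pk_nonneg (hρ0 a) (hlt a) _) (Pk_nonneg (hρ0 b) (hlt b) _),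
        ← ENNReal.ofReal_mul (by positivity)]
      refine ENNReal.ofReal_le_ofReal ?_
      have := Pk_mul_le_add (hρ0 a) (hlt a) (hρ0 b) (hlt b) (a - b)
      nlinarith
    have hkhh : Measurable (Function.uncurry fun a b => k a b * (h a * h b)) := by
      exact hk.mul ((hm.comp measurable_fst).mul (hm.comp measurable_snd))
    have hkhh' : Measurable (Function.uncurry fun a b => k b a * (h a * h b)) := by
      exact (hk.comp measurable_swap).mul ((hm.comp measurable_fst).mul (hm.comp measurable_snd))
    set Z := ∫⁻ x, h x * ∫⁻ a, k a x * h a ∂mu ∂mu with hZ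
    have z2 : ∫⁻ a, ∫⁻ b, k b a * (h a * h b) ∂mu ∂mu = Z := by
      refine lintegral_congr fun a => ?_
      rw [← lintegral_const_mul _ (hkh.of_uncurry_right (y := a))]
      refine lintegral_congr fun b => ?_
      ring
    have z1 : ∫⁻ a, ∫⁻ b, k a b * (h a * h b) ∂mu ∂mu = Z := by
      rw [lintegral_lintegral_swap hkhh.aemeasurable, ← z2]
      refine lintegral_congr fun a => lintegral_congr fun b => ?_
      ring
    have hYZ : Y ≤ ENNReal.ofReal (32 * Real.pi) * Z := by
      calc Y = _ := star_sq mu mu hk hm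
        _ ≤ ∫⁻ a, ∫⁻ b, ENNReal.ofReal (16 * Real.pi) *
              (k a b * (h a * h b) + k b a * (h a * h b)) ∂mu ∂mu := by
            refine lintegral_mono fun a => lintegral_mono fun b => ?_
            refine (mul_le_mul_left (hK a b) _).trans (le_of_eq ?_)
            ring
        _ = ENNReal.ofReal (16 * Real.pi) * (Z + Z) := by
            rw [← z1]
            nth_rewrite 2 [z1]
            rw [← z2]
            rw [← lintegral_add_left hkhh.lintegral_prod_right, ← lintegral_const_mul]
            · refine lintegral_congr fun a => ?_
              rw [← lintegral_add_left (hkhh.of_uncurry_left (x := a)), ← lintegral_const_mul]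
              exact (hkhh.of_uncurry_left (x := a)).add (hkhh'.of_uncurry_left (x := a))
            · exact hkhh.lintegral_prod_right.add hkhh'.lintegral_prod_right
        _ = _ := by
            rw [← two_mul, ← mul_assoc]
            congr 1
            rw [show (2:ℝ≥0∞) = ENNReal.ofReal 2 by simp, ← ENNReal.ofReal_mul (by positivity)]
            congr 1
            ring
    calc Y ^ 2 ≤ (ENNReal.ofReal (32 * Real.pi) * Z) ^ 2 := pow_le_pow_left' hYZ 2
      _ = ENNReal.ofReal (32 * Real.pi) ^ 2 * Z ^ 2 := mul_pow _ _ _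
      _ ≤ ENNReal.ofReal (32 * Real.pi) ^ 2 * ((∫⁻ x, h x ^ 2 ∂mu) * Y) := by
          gcongr
          exact cs_sq mu hm hTm
      _ = _ := by ring

lemma inner_int {x : ℝ} (hx : 0 < x) :
    ∫⁻ b in Ioo (0:ℝ) 1, ENNReal.ofReal (1 / (x + (1 - b)) * (Real.sqrt x / Real.sqrt (1 - b))) ≤
      ENNReal.ofReal Real.pi := by
  let F : ℝ → ℝ := fun b => -2 * Real.arctan (Real.sqrt (1 - b) / Real.sqrt x)
  have hc : ContinuousOn F (Icc 0 1) := by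
    unfold F
    fun_prop
  have hd : ∀ b ∈ Ioo (0:ℝ) 1, HasDerivAt F
      (1 / (x + (1 - b)) * (Real.sqrt x / Real.sqrt (1 - b))) b := by
    intro b hb
    have hb' : 0 < 1 - b := by linarith [hb.2]
    have h1 : HasDerivAt (fun b : ℝ => 1 - b) (-1) b := by
      simpa using (hasDerivAt_id b).const_sub 1
    have h2 := ((h1.sqrt hb'.ne').div_const (Real.sqrt x)).arctan.const_mul (-2)
    refine h2.congr_deriv ?_
    have s1 := Real.sq_sqrt hx.le
    have s2 := Real.sq_sqrt hb'.le
    have p1 := Real.sqrt_pos.2 hx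
    have p2 := Real.sqrt_pos.2 hb'
    rw [div_pow, s1, s2]
    set u := Real.sqrt x
    set v := Real.sqrt (1 - b)
    have hxb : x + (1 - b) ≠ 0 := by positivity
    have hxb' : 1 + (1 - b) / x ≠ 0 := by positivity
    have hx' := hx.ne'
    have e : 1 + (1 - b) / x = (x + (1 - b)) / u ^ 2 := by
      rw [s1]
      field_simp
    rw [e]
    field_simp
  have hn : ∀ b ∈ Ioo (0:ℝ) 1, 0 ≤ 1 / (x + (1 - b)) * (Real.sqrt x / Real.sqrt (1 - b)) := by
    intro b hb
    have hb' : 0 < 1 - b := by linarith [hb.2]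
    positivity
  have hi := intervalIntegral.integrableOn_deriv_of_nonneg hc hd hn
  have hI := intervalIntegral.integral_eq_sub_of_hasDerivAt_of_le zero_le_one hc hd
    ((intervalIntegrable_iff_integrableOn_Ioc_of_le zero_le_one).2 hi)
  rw [← ofReal_integral_eq_lintegral_ofReal (hi.mono_set Ioo_subset_Ioc_self)]
  · refine ENNReal.ofReal_le_ofReal ?_
    rw [← integral_Ioc_eq_integral_Ioo, ← intervalIntegral.integral_of_le zero_le_one, hI]
    simp only [F]
    have := Real.arctan_lt_pi_div_two (Real.sqrt (1 - 0) / Real.sqrt x)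
    rw [sub_self, Real.sqrt_zero, zero_div, Real.arctan_zero]
    linarith
  · filter_upwards [ae_restrict_mem measurableSet_Ioo] with b hb using hn b hb

lemma mul_le_sq_add (x y : ℝ≥0∞) : x * y ≤ x ^ 2 + y ^ 2 := by
  rcases le_total x y with h | h
  · calc x * y ≤ y * y := by gcongr
      _ ≤ _ := by rw [sq y]; exact le_add_self
  · calc x * y ≤ x * x := by gcongr
      _ ≤ _ := by rw [sq x]; exact le_self_add

noncomputable abbrev nu : Measure ℝ := volume.restrict (Ioo (0:ℝ) 1)

/-- A Hilbert-type inequality. -/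
lemma hilbert_ineq {h : ℝ → ℝ≥0∞} (hm : Measurable h) :
    ∫⁻ a, ∫⁻ b, ENNReal.ofReal (1 / ((1 - a) + (1 - b))) * (h a * h b) ∂nu ∂nu ≤
      2 * ENNReal.ofReal Real.pi * ∫⁻ a, h a ^ 2 ∂nu := by
  let J : ℝ → ℝ → ℝ≥0∞ := fun a b =>
    ENNReal.ofReal (1 / ((1 - a) + (1 - b)) * (Real.sqrt (1 - a) / Real.sqrt (1 - b))) * h a ^ 2
  have hJ : Measurable (Function.uncurry J) := by
    unfold J Function.uncurry
    fun_prop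
  have hJi : ∀ a ∈ Ioo (0:ℝ) 1, ∫⁻ b, J a b ∂nu ≤ ENNReal.ofReal Real.pi * h a ^ 2 := by
    intro a ha
    simp only [J]
    rw [lintegral_mul_const _ (by fun_prop)]
    gcongr
    exact inner_int (by linarith [ha.2])
  have hJI : ∫⁻ a, ∫⁻ b, J a b ∂nu ∂nu ≤ ENNReal.ofReal Real.pi * ∫⁻ a, h a ^ 2 ∂nu := by
    rw [← lintegral_const_mul _ (by fun_prop)]
    refine lintegral_mono_ae ?_
    filter_upwards [ae_restrict_mem measurableSet_Ioo] with a ha using hJi a ha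
  calc _ ≤ ∫⁻ a, ∫⁻ b, (J a b + J b a) ∂nu ∂nu := by
        refine lintegral_mono_ae ?_
        filter_upwards [ae_restrict_mem measurableSet_Ioo] with a ha
        refine lintegral_mono_ae ?_
        filter_upwards [ae_restrict_mem measurableSet_Ioo] with b hb
        have pa : 0 < 1 - a := by linarith [ha.2]
        have pb : 0 < 1 - b := by linarith [hb.2]
        have qa := Real.sqrt_pos.2 pa
        have qb := Real.sqrt_pos.2 pb
        have pab : 0 ≤ 1 / ((1 - a) + (1 - b)) := by positivity
        simp only [J]
        rw [add_comm (1 - b) (1 - a), ENNReal.ofReal_mul pab, ENNReal.ofReal_mul pab, mul_assoc,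
          mul_assoc, ← mul_add]
        gcongr
        set u := Real.sqrt (Real.sqrt (1 - a) / Real.sqrt (1 - b)) with hu
        have hu0 : 0 < u := Real.sqrt_pos.2 (by positivity)
        have e1 : Real.sqrt (1 - a) / Real.sqrt (1 - b) = u ^ 2 := by
          rw [hu, Real.sq_sqrt (by positivity)]
        have e2 : Real.sqrt (1 - b) / Real.sqrt (1 - a) = (u⁻¹) ^ 2 := by
          rw [inv_pow, ← e1, inv_div]
        rw [e1, e2, ENNReal.ofReal_pow hu0.le, ENNReal.ofReal_pow (by positivity), ← mul_pow,
          ← mul_pow]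
        refine le_trans (le_of_eq ?_) (mul_le_sq_add _ _)
        rw [mul_mul_mul_comm, ← ENNReal.ofReal_mul hu0.le, mul_inv_cancel₀ hu0.ne',
          ENNReal.ofReal_one, one_mul]
    _ = ∫⁻ a, ∫⁻ b, J a b ∂nu ∂nu + ∫⁻ a, ∫⁻ b, J b a ∂nu ∂nu := by
        rw [← lintegral_add_left hJ.lintegral_prod_right]
        refine lintegral_congr fun a => ?_
        rw [← lintegral_add_left (hJ.of_uncurry_left (x := a))]
    _ ≤ _ := by
        rw [lintegral_lintegral_swap (f := fun a b => J b a) (hJ.comp measurable_swap).aemeasurable,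
          ← two_mul, mul_assoc]
        gcongr

/-- Fejér–Riesz in the form of an `L²` bound for the Poisson integral on a radius. -/
lemma fejer_riesz_aux (θ : ℝ) {g : ℝ → ℝ≥0∞} (hg : Measurable g)
    {B : ℝ≥0∞} (hB : B ≠ ⊤) (hgB : ∀ x, g x ≤ B) :
    ∫⁻ r, (∫⁻ x, ENNReal.ofReal (Pk r (θ - x)) * g x ∂mu) ^ 2 ∂nu ≤
      ENNReal.ofReal (16 * Real.pi ^ 2) * ∫⁻ x, g x ^ 2 ∂mu := by
  set k : ℝ → ℝ → ℝ≥0∞ := fun r x => ENNReal.ofReal (Pk r (θ - x)) with hkdef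
  have hp := Real.pi_pos
  have hk : Measurable (Function.uncurry k) := by
    refine ENNReal.measurable_ofReal.comp ?_
    exact Pk_measurable.comp (measurable_fst.prodMk (measurable_const.sub measurable_snd))
  set h : ℝ → ℝ≥0∞ := fun θ => ∫⁻ x, k θ x * g x ∂mu with hhdef
  have hkg : Measurable (Function.uncurry fun a x => k a x * g x) := by
    exact hk.mul (hg.comp measurable_snd)
  have hm : Measurable h := hkg.lintegral_prod_right
  have hMt : ENNReal.ofReal (2 * Real.pi) * B ≠ ⊤ := ENNReal.mul_ne_top ENNReal.ofReal_ne_top hB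
  refine tt_star nu mu hk hg (h := h) (fun a => rfl) ?_ ?_
  · have : ∫⁻ a, h a ^ 2 ∂nu ≤ ∫⁻ a, (ENNReal.ofReal (2 * Real.pi) * B) ^ 2 ∂nu := by
      refine lintegral_mono_ae ?_
      filter_upwards [ae_restrict_mem measurableSet_Ioo] with a ha
      exact pow_le_pow_left' (lintegral_Pk_mul_le ha.1.le ha.2 θ hgB) 2
    refine ne_top_of_le_ne_top ?_ this
    rw [lintegral_const]
    exact ENNReal.mul_ne_top (ENNReal.pow_ne_top hMt) (measure_ne_top _ _)
  · rw [star_sq nu mu hk hm]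
    calc _ ≤ ∫⁻ a, ENNReal.ofReal (8 * Real.pi) *
          ∫⁻ b, ENNReal.ofReal (1 / ((1 - a) + (1 - b))) * (h a * h b) ∂nu ∂nu := by
          refine lintegral_mono_ae ?_
          filter_upwards [ae_restrict_mem measurableSet_Ioo] with a ha
          rw [← lintegral_const_mul _ (by fun_prop)]
          refine lintegral_mono_ae ?_
          filter_upwards [ae_restrict_mem measurableSet_Ioo] with b hb
          rw [← mul_assoc (ENNReal.ofReal (8 * Real.pi))]
          refine mul_le_mul_left ?_ _
          rw [lintegral_Pk_mul ha.1.le ha.2 hb.1.le hb.2, ← ENNReal.ofReal_mul (by positivity)]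
          refine ENNReal.ofReal_le_ofReal ?_
          obtain ⟨a0, a1⟩ := ha
          obtain ⟨b0, b1⟩ := hb
          have hab : a * b < 1 := by nlinarith
          have hab0 : 0 < a * b := by positivity
          have e : Pk (a * b) (θ - θ) = (1 + a * b) / (1 - a * b) := by
            rw [Pk, sub_self, Real.cos_zero,
              show 1 - 2 * (a * b) * 1 + (a * b) ^ 2 = (1 - a * b) * (1 - a * b) by ring,
              show 1 - (a * b) ^ 2 = (1 + a * b) * (1 - a * b) by ring,
              mul_div_mul_right _ _ (by linarith)]
          rw [e]
          have : (1 + a * b) / (1 - a * b) ≤ 4 * (1 / ((1 - a) + (1 - b))) := by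
            rw [mul_one_div, div_le_div_iff₀ (by linarith) (by linarith)]
            nlinarith [mul_pos (sub_pos.2 a1) (sub_pos.2 b1), mul_pos a0 (sub_pos.2 b1),
              mul_pos b0 (sub_pos.2 a1)]
          nlinarith
      _ = ENNReal.ofReal (8 * Real.pi) *
          ∫⁻ a, ∫⁻ b, ENNReal.ofReal (1 / ((1 - a) + (1 - b))) * (h a * h b) ∂nu ∂nu := by
          rw [lintegral_const_mul]
          have : Measurable (Function.uncurry fun a b =>
            ENNReal.ofReal (1 / ((1 - a) + (1 - b))) * (h a * h b)) := by
            unfold Function.uncurry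
            fun_prop
          exact this.lintegral_prod_right
      _ ≤ ENNReal.ofReal (8 * Real.pi) * (2 * ENNReal.ofReal Real.pi * ∫⁻ a, h a ^ 2 ∂nu) := by
          gcongr
          exact hilbert_ineq hm
      _ = _ := by
          rw [← mul_assoc]
          congr 1
          rw [show (2:ℝ≥0∞) = ENNReal.ofReal 2 by simp, ← ENNReal.ofReal_mul (by positivity),
            ← ENNReal.ofReal_mul (by positivity)]
          congr 1
          ring

/-- Points `r e^{iθ}`. -/
noncomputable abbrev pt (r θ : ℝ) : ℂ := (r : ℂ) * Complex.exp ((θ : ℂ) * Complex.I)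

lemma norm_pt {r : ℝ} (h0 : 0 ≤ r) (θ : ℝ) : ‖pt r θ‖ = r := by
  rw [norm_mul, Complex.norm_exp_ofReal_mul_I, Complex.norm_real, Real.norm_of_nonneg h0, mul_one]

lemma pt_mem {r : ℝ} (h0 : 0 ≤ r) (h1 : r < 1) (θ : ℝ) : pt r θ ∈ ball (0:ℂ) 1 := by
  rw [mem_ball_zero_iff, norm_pt h0]
  exact h1

lemma circle_continuous {f : ℂ → ℂ} (hf : DifferentiableOn ℂ f (ball 0 1)) {R : ℝ} (h0 : 0 ≤ R)
    (h1 : R < 1) : Continuous fun x => f (pt R x) := by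
  refine hf.continuousOn.comp_continuous ?_ fun x => pt_mem h0 h1 x
  fun_prop

lemma good_bound {f : ℂ → ℂ} (hf : DifferentiableOn ℂ f (ball 0 1)) {a : ℝ} (ha : 0 < a)
    {R : ℝ} (hR0 : 0 < R) (hR1 : R < 1)
    (hR : ∀ w : ℂ, ‖w‖ < R →
      ‖f w‖ ^ a ≤ Real.circleAverage (fun z => poissonKernel 0 w z * ‖f z‖ ^ a) 0 R)
    {r : ℝ} (h0 : 0 ≤ r) (h1 : r < 1) (φ : ℝ) :
    ENNReal.ofReal (‖f (pt (R * r) φ)‖ ^ a) ≤ ENNReal.ofReal (2 * Real.pi)⁻¹ *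
      ∫⁻ x, ENNReal.ofReal (Pk r (φ - x)) * ENNReal.ofReal (‖f (pt R x)‖ ^ a) ∂mu := by
  have hp := Real.pi_pos
  have h := hR (pt (R * r) φ) (by rw [norm_pt (by positivity)]; nlinarith)
  have hc := circle_continuous hf hR0.le hR1
  have hP := Pk_continuous h0 h1
  rw [Real.circleAverage_def, smul_eq_mul] at h
  have e : ∀ x, poissonKernel 0 (pt (R * r) φ) (circleMap 0 R x) * ‖f (circleMap 0 R x)‖ ^ a =
      Pk r (φ - x) * ‖f (pt R x)‖ ^ a := by
    intro x
    rw [poissonKernel_circle hR0, circleMap_zero]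
  simp only [e] at h
  refine (ENNReal.ofReal_le_ofReal h).trans ?_
  rw [ENNReal.ofReal_mul (by positivity), ← lintegral_mu_eq]
  · refine le_of_eq ?_
    congr 1
    refine lintegral_congr fun x => ?_
    rw [ENNReal.ofReal_mul (Pk_nonneg h0 h1 _)]
  · refine (hP.comp (by fun_prop)).mul (hc.norm.rpow_const fun x => Or.inr ha.le)
  · intro x
    exact mul_nonneg (Pk_nonneg h0 h1 _) (by positivity)

lemma ofReal_half_sq {x s : ℝ} (hx : 0 ≤ x) :
    ENNReal.ofReal (x ^ (s / 2)) ^ 2 = ENNReal.ofReal (x ^ s) := by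
  rw [← ENNReal.ofReal_pow (by positivity), ← Real.rpow_mul_natCast hx]
  norm_num

lemma hardy_le {f : ℂ → ℂ} {s : ℝ} (hs : 0 < s) {R : ℝ} (h0 : 0 ≤ R) (h1 : R < 1) :
    ∫⁻ x, ENNReal.ofReal (‖f (pt R x)‖ ^ s) ∂mu ≤
      ENNReal.ofReal (2 * Real.pi) * hardyNorm s f ^ s := by
  have hp := Real.pi_pos
  have h : ((ENNReal.ofReal (2 * Real.pi))⁻¹ *
      ∫⁻ x, ENNReal.ofReal (‖f (pt R x)‖ ^ s) ∂mu) ^ (1 / s) ≤ hardyNorm s f :=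
    le_iSup (fun r : Set.Ico (0 : ℝ) 1 => ((ENNReal.ofReal (2 * Real.pi))⁻¹ *
        ∫⁻ θ in Set.Ioo (0 : ℝ) (2 * Real.pi),
          ENNReal.ofReal (‖f ((r : ℝ) * Complex.exp ((θ : ℂ) * Complex.I))‖ ^ s)) ^ (1 / s))
      ⟨R, h0, h1⟩
  rw [one_div, ENNReal.rpow_inv_le_iff hs] at h
  rwa [ENNReal.inv_mul_le_iff (by simpa using hp) ENNReal.ofReal_ne_top] at h

lemma circle_bdd {f : ℂ → ℂ} (hf : DifferentiableOn ℂ f (ball 0 1)) {a : ℝ} (ha : 0 < a)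
    {R : ℝ} (hR0 : 0 < R) (hR1 : R < 1) :
    ∃ B : ℝ≥0∞, B ≠ ⊤ ∧ ∀ x, ENNReal.ofReal (‖f (pt R x)‖ ^ a) ≤ B := by
  obtain ⟨B, hB⟩ := (isCompact_closedBall (0:ℂ) R).exists_bound_of_continuousOn
    (hf.continuousOn.mono (closedBall_subset_ball hR1))
  refine ⟨ENNReal.ofReal (B ^ a), ENNReal.ofReal_ne_top, fun x => ENNReal.ofReal_le_ofReal ?_⟩
  have := hB (pt R x) (by rw [mem_closedBall_zero_iff, norm_pt hR0.le])
  gcongr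

/-- Linearised maximal bound. -/
lemma max_lin {f : ℂ → ℂ} (hf : DifferentiableOn ℂ f (ball 0 1)) {s : ℝ} (hs : 0 < s)
    {ρ : ℝ → ℝ} (hρ : Measurable ρ) {r0 : ℝ} (hr0 : r0 < 1)
    (hρ0 : ∀ θ, 0 ≤ ρ θ) (hρ1 : ∀ θ, ρ θ ≤ r0) :
    ∫⁻ θ, ENNReal.ofReal (‖f (pt (ρ θ) θ)‖ ^ s) ∂mu ≤
      ENNReal.ofReal (2 * Real.pi)⁻¹ ^ 2 * (ENNReal.ofReal (32 * Real.pi) ^ 2 *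
        (ENNReal.ofReal (2 * Real.pi) * hardyNorm s f ^ s)) := by
  have h00 : 0 ≤ r0 := (hρ0 0).trans (hρ1 0)
  have ha : 0 < s / 2 := by positivity
  obtain ⟨R, hR0, hR1, hR⟩ := exists_good_radius hf ha h00 hr0
  have hRp : 0 < R := h00.trans_lt hR0
  obtain ⟨B, hB, hgB⟩ := circle_bdd hf ha hRp hR1
  have hgm : Measurable fun x => ENNReal.ofReal (‖f (pt R x)‖ ^ (s / 2)) := by
    have := (circle_continuous hf hRp.le hR1).measurable
    exact (this.norm.pow_const _).ennreal_ofReal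
  have hmax := maximal_aux (ρ := fun θ => ρ θ / R) (hρ.div_const R) (r0 := r0 / R)
    ((div_lt_one hRp).2 hR0) (fun θ => div_nonneg (hρ0 θ) hRp.le)
    (fun θ => div_le_div_of_nonneg_right (hρ1 θ) hRp.le) hgm hB hgB
  have hL2 : ∫⁻ x, ENNReal.ofReal (‖f (pt R x)‖ ^ (s / 2)) ^ 2 ∂mu ≤
      ENNReal.ofReal (2 * Real.pi) * hardyNorm s f ^ s := by
    simp_rw [ofReal_half_sq (norm_nonneg _)]
    exact hardy_le hs hRp.le hR1
  calc _ ≤ ∫⁻ θ, ENNReal.ofReal (2 * Real.pi)⁻¹ ^ 2 *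
        (∫⁻ x, ENNReal.ofReal (Pk (ρ θ / R) (θ - x)) *
          ENNReal.ofReal (‖f (pt R x)‖ ^ (s / 2)) ∂mu) ^ 2 ∂mu := by
        refine lintegral_mono fun θ => ?_
        rw [← mul_pow, ← ofReal_half_sq (norm_nonneg _)]
        refine pow_le_pow_left' ?_ 2
        have := good_bound hf ha hRp hR1 hR (r := ρ θ / R) (div_nonneg (hρ0 θ) hRp.le)
          ((div_lt_one hRp).2 ((hρ1 θ).trans_lt hR0)) θ
        rwa [mul_div_cancel₀ _ hRp.ne'] at this
    _ = _ := lintegral_const_mul' _ _ (ENNReal.pow_ne_top ENNReal.ofReal_ne_top)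
    _ ≤ _ := by
        gcongr
        exact hmax.trans (by gcongr)

/-- Fejér–Riesz on a dilated function. -/
lemma fr_lin {f : ℂ → ℂ} (hf : DifferentiableOn ℂ f (ball 0 1)) {s : ℝ} (hs : 0 < s)
    {r0 : ℝ} (h00 : 0 ≤ r0) (hr0 : r0 < 1) : ∃ R, r0 < R ∧ R < 1 ∧ ∀ θ,
    ∫⁻ r, ENNReal.ofReal (‖f (pt (R * r) θ)‖ ^ s) ∂nu ≤
      ENNReal.ofReal (2 * Real.pi)⁻¹ ^ 2 * (ENNReal.ofReal (16 * Real.pi ^ 2) *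
        (ENNReal.ofReal (2 * Real.pi) * hardyNorm s f ^ s)) := by
  have ha : 0 < s / 2 := by positivity
  obtain ⟨R, hR0, hR1, hR⟩ := exists_good_radius hf ha h00 hr0
  have hRp : 0 < R := h00.trans_lt hR0
  refine ⟨R, hR0, hR1, fun θ => ?_⟩
  obtain ⟨B, hB, hgB⟩ := circle_bdd hf ha hRp hR1
  have hgm : Measurable fun x => ENNReal.ofReal (‖f (pt R x)‖ ^ (s / 2)) := by
    have := (circle_continuous hf hRp.le hR1).measurable
    exact (this.norm.pow_const _).ennreal_ofReal
  have hmax := fejer_riesz_aux θ hgm hB hgB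
  have hL2 : ∫⁻ x, ENNReal.ofReal (‖f (pt R x)‖ ^ (s / 2)) ^ 2 ∂mu ≤
      ENNReal.ofReal (2 * Real.pi) * hardyNorm s f ^ s := by
    simp_rw [ofReal_half_sq (norm_nonneg _)]
    exact hardy_le hs hRp.le hR1
  calc _ ≤ ∫⁻ r, ENNReal.ofReal (2 * Real.pi)⁻¹ ^ 2 *
        (∫⁻ x, ENNReal.ofReal (Pk r (θ - x)) *
          ENNReal.ofReal (‖f (pt R x)‖ ^ (s / 2)) ∂mu) ^ 2 ∂nu := by
        refine lintegral_mono_ae ?_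
        filter_upwards [ae_restrict_mem measurableSet_Ioo] with r hr
        rw [← mul_pow, ← ofReal_half_sq (norm_nonneg _)]
        refine pow_le_pow_left' ?_ 2
        exact good_bound hf ha hRp hR1 hR hr.1.le hr.2 θ
    _ = _ := lintegral_const_mul' _ _ (ENNReal.pow_ne_top ENNReal.ofReal_ne_top)
    _ ≤ _ := by
        gcongr
        exact hmax.trans (by gcongr)

/-- Fejér–Riesz inequality. -/
lemma fejer_riesz {f : ℂ → ℂ} (hf : DifferentiableOn ℂ f (ball 0 1)) (hfm : Measurable f)
    {s : ℝ} (hs : 0 < s) (θ : ℝ) :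
    ∫⁻ r, ENNReal.ofReal (‖f (pt r θ)‖ ^ s) ∂nu ≤
      ENNReal.ofReal (2 * Real.pi)⁻¹ ^ 2 * (ENNReal.ofReal (16 * Real.pi ^ 2) *
        (ENNReal.ofReal (2 * Real.pi) * hardyNorm s f ^ s)) := by
  have h1 : ∀ n : ℕ, 0 ≤ 1 - 1 / ((n:ℝ) + 1) := by
    intro n
    rw [sub_nonneg, div_le_one (by positivity)]
    linarith [(Nat.cast_nonneg n : (0:ℝ) ≤ n)]
  have h2 : ∀ n : ℕ, 1 - 1 / ((n:ℝ) + 1) < 1 := by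
    intro n
    have : 0 < 1 / ((n:ℝ) + 1) := by positivity
    linarith
  choose R hR0 hR1 hR using fun n : ℕ => fr_lin hf hs (h1 n) (h2 n)
  have hlim : Tendsto R atTop (𝓝 1) := by
    refine tendsto_of_tendsto_of_tendsto_of_le_of_le ?_ tendsto_const_nhds
      (fun n => (hR0 n).le) (fun n => (hR1 n).le)
    simpa using (tendsto_one_div_add_atTop_nhds_zero_nat (𝕜 := ℝ)).const_sub 1
  calc _ ≤ ∫⁻ r, liminf (fun n => ENNReal.ofReal (‖f (pt (R n * r) θ)‖ ^ s)) atTop ∂nu := by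
        refine lintegral_mono_ae ?_
        filter_upwards [ae_restrict_mem measurableSet_Ioo] with r hr
        refine le_of_eq (Tendsto.liminf_eq ?_).symm
        refine ENNReal.tendsto_ofReal ?_
        have hc : ContinuousAt f (pt r θ) :=
          hf.continuousOn.continuousAt (isOpen_ball.mem_nhds (pt_mem hr.1.le hr.2 θ))
        have h3 : Tendsto (fun n => pt (R n * r) θ) atTop (𝓝 (pt r θ)) := by
          have h4 : Tendsto (fun n => R n * r) atTop (𝓝 r) := by
            simpa using hlim.mul_const r
          have h5 : Continuous fun x : ℝ => pt x θ := by fun_prop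
          exact (h5.tendsto r).comp h4
        exact ((hc.tendsto.comp h3).norm).rpow_const (Or.inr hs.le)
    _ ≤ liminf (fun n => ∫⁻ r, ENNReal.ofReal (‖f (pt (R n * r) θ)‖ ^ s) ∂nu) atTop := by
        refine lintegral_liminf_le fun n => ?_
        fun_prop
    _ ≤ _ := by
        refine liminf_le_of_le (by isBoundedDefault) ?_
        intro b hb
        obtain ⟨n, hn⟩ := hb.exists
        exact hn.trans (hR n θ)

/-- Radial maximal theorem. -/
lemma maximal {f : ℂ → ℂ} (hf : DifferentiableOn ℂ f (ball 0 1)) (hfm : Measurable f)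
    {s : ℝ} (hs : 0 < s) :
    ∫⁻ θ, radialLp ⊤ f θ ^ s ∂mu ≤
      ENNReal.ofReal (2 * Real.pi)⁻¹ ^ 2 * (ENNReal.ofReal (32 * Real.pi) ^ 2 *
        (ENNReal.ofReal (2 * Real.pi) * hardyNorm s f ^ s)) := by
  have : Nonempty (Ico (0:ℝ) 1) := ⟨⟨0, by simp⟩⟩
  let q : ℕ → Ico (0:ℝ) 1 := TopologicalSpace.denseSeq _
  have hq : DenseRange q := TopologicalSpace.denseRange_denseSeq _
  have sel : ∀ n : ℕ, ∀ σ : {σ : ℝ → ℝ // Measurable σ ∧ (∀ θ, 0 ≤ σ θ) ∧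
      ∃ r0 < 1, ∀ θ, σ θ ≤ r0}, ∃ τ : {σ : ℝ → ℝ // Measurable σ ∧ (∀ θ, 0 ≤ σ θ) ∧
      ∃ r0 < 1, ∀ θ, σ θ ≤ r0}, ∀ θ, ‖f (pt (σ.1 θ) θ)‖ ≤ ‖f (pt (τ.1 θ) θ)‖ ∧
        ‖f (pt (q n) θ)‖ ≤ ‖f (pt (τ.1 θ) θ)‖ := by
    classical
    rintro n ⟨σ, hσ, hσ0, r0, hr0, hσ1⟩
    let S : Set ℝ := {θ | ‖f (pt (σ θ) θ)‖ < ‖f (pt (q n) θ)‖}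
    have hS : MeasurableSet S := by
      refine measurableSet_lt ?_ ?_ <;> fun_prop
    refine ⟨⟨S.piecewise (fun _ => (q n : ℝ)) σ, Measurable.piecewise hS measurable_const hσ,
      ?_, max r0 (q n), max_lt hr0 (q n).2.2, ?_⟩, ?_⟩
    · intro θ
      by_cases h : θ ∈ S
      · rw [piecewise_eq_of_mem _ _ _ h]
        exact (q n).2.1
      · rw [piecewise_eq_of_notMem _ _ _ h]
        exact hσ0 θ
    · intro θ
      by_cases h : θ ∈ S
      · rw [piecewise_eq_of_mem _ _ _ h]
        exact le_max_right _ _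
      · rw [piecewise_eq_of_notMem _ _ _ h]
        exact (hσ1 θ).trans (le_max_left _ _)
    · intro θ
      dsimp only
      by_cases h : θ ∈ S
      · rw [piecewise_eq_of_mem _ _ _ h]
        exact ⟨le_of_lt h, le_rfl⟩
      · rw [piecewise_eq_of_notMem _ _ _ h]
        exact ⟨le_rfl, not_lt.1 h⟩
  choose nxt hnxt using sel
  let ρ : ℕ → {σ : ℝ → ℝ // Measurable σ ∧ (∀ θ, 0 ≤ σ θ) ∧ ∃ r0 < 1, ∀ θ, σ θ ≤ r0} :=
    fun n => Nat.rec ⟨fun _ => 0, measurable_const, fun _ => le_rfl, 0, one_pos, fun _ => le_rfl⟩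
      (fun n σ => nxt n σ) n
  have hρs : ∀ n, ρ (n + 1) = nxt n (ρ n) := fun n => rfl
  let G : ℕ → ℝ → ℝ≥0∞ := fun n θ => ENNReal.ofReal (‖f (pt ((ρ n).1 θ) θ)‖ ^ s)
  have hGm : ∀ n, Measurable (G n) := by
    intro n
    have := (ρ n).2.1
    unfold G
    fun_prop
  have hGmono : Monotone G := by
    refine monotone_nat_of_le_succ fun n θ => ENNReal.ofReal_le_ofReal ?_
    have := (hnxt n (ρ n) θ).1
    rw [hρs]
    gcongr
  have hle : ∀ θ, radialLp ⊤ f θ ^ s ≤ ⨆ n, G n θ := by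
    intro θ
    rw [← ENNReal.le_rpow_inv_iff hs, radialLp, if_pos rfl]
    refine iSup_le fun r => ?_
    refine hq.induction_on (p := fun r : Ico (0:ℝ) 1 =>
      ENNReal.ofReal ‖f (pt r θ)‖ ≤ (⨆ n, G n θ) ^ s⁻¹) r ?_ ?_
    · refine isClosed_le ?_ continuous_const
      refine ENNReal.continuous_ofReal.comp (Continuous.norm ?_)
      exact hf.continuousOn.comp_continuous (by fun_prop) fun r => pt_mem r.2.1 r.2.2 θ
    · intro n
      rw [ENNReal.le_rpow_inv_iff hs, ENNReal.ofReal_rpow_of_nonneg (norm_nonneg _) hs.le]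
      refine le_trans ?_ (le_iSup (fun n => G n θ) (n + 1))
      refine ENNReal.ofReal_le_ofReal ?_
      have := (hnxt n (ρ n) θ).2
      rw [hρs]
      gcongr
  calc _ ≤ ∫⁻ θ, ⨆ n, G n θ ∂mu := lintegral_mono hle
    _ = ⨆ n, ∫⁻ θ, G n θ ∂mu := lintegral_iSup hGm hGmono
    _ ≤ _ := by
        refine iSup_le fun n => ?_
        obtain ⟨h1, h2, r0, h3, h4⟩ := (ρ n).2
        exact max_lin hf hs h1 h3 h2 h4

lemma radialLp_fin_le {f : ℂ → ℂ} (hfm : Measurable f) {s P : ℝ} (hs : 0 < s) (hP : s ≤ P)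
    (θ : ℝ) :
    ∫⁻ r, ENNReal.ofReal (‖f (pt r θ)‖ ^ P) ∂nu ≤
      radialLp ⊤ f θ ^ (P - s) * ∫⁻ r, ENNReal.ofReal (‖f (pt r θ)‖ ^ s) ∂nu := by
  rw [← lintegral_const_mul _ (by fun_prop)]
  refine lintegral_mono_ae ?_
  filter_upwards [ae_restrict_mem measurableSet_Ioo] with r hr
  have e : ‖f (pt r θ)‖ ^ P = ‖f (pt r θ)‖ ^ (P - s) * ‖f (pt r θ)‖ ^ s := by
    rw [← Real.rpow_add_of_nonneg (norm_nonneg _) (by linarith) hs.le]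
    congr 1
    ring
  rw [e, ENNReal.ofReal_mul (by positivity)]
  gcongr
  rw [← ENNReal.ofReal_rpow_of_nonneg (norm_nonneg _) (by linarith)]
  refine ENNReal.rpow_le_rpow ?_ (by linarith)
  rw [radialLp, if_pos rfl]
  exact le_iSup (fun r : Ico (0:ℝ) 1 => ENNReal.ofReal ‖f (pt r θ)‖) ⟨r, hr.1.le, hr.2⟩

noncomputable def K1 : ℝ≥0∞ := ENNReal.ofReal (2 * Real.pi)⁻¹ ^ 2 *
  (ENNReal.ofReal (32 * Real.pi) ^ 2 * ENNReal.ofReal (2 * Real.pi))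

noncomputable def K2 : ℝ≥0∞ := ENNReal.ofReal (2 * Real.pi)⁻¹ ^ 2 *
  (ENNReal.ofReal (16 * Real.pi ^ 2) * ENNReal.ofReal (2 * Real.pi))

lemma K1_ne : K1 ≠ ⊤ := by
  unfold K1
  finiteness

lemma K2_ne : K2 ≠ ⊤ := by
  unfold K2
  finiteness

lemma main_bound (s : ℝ) (hs : 1 ≤ s) (p q : ℝ≥0∞) (hp : 0 < p) (hq : 0 < q)
    (hpq : 1 / p + 1 / q = 1 / ENNReal.ofReal s) :
    ∃ c : ℝ≥0∞, c ≠ ⊤ ∧ ∀ f : ℂ → ℂ, DifferentiableOn ℂ f (ball (0 : ℂ) 1) → Measurable f →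
      hardyNorm s f ≠ ⊤ → rhoE p q f ≤ c * hardyNorm s f := by
  have hs0 : 0 < s := by linarith
  have hpi := Real.pi_pos
  have hd : (ENNReal.ofReal (2 * Real.pi))⁻¹ ≠ ⊤ := by
    rw [ENNReal.inv_ne_top]
    simpa using hpi
  have hmx : ∀ f : ℂ → ℂ, DifferentiableOn ℂ f (ball (0 : ℂ) 1) → Measurable f →
      ∫⁻ θ, radialLp ⊤ f θ ^ s ∂mu ≤ K1 * hardyNorm s f ^ s := by
    intro f hf hfm
    refine (maximal hf hfm hs0).trans (le_of_eq ?_)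
    rw [K1]
    ring
  have hfr : ∀ f : ℂ → ℂ, DifferentiableOn ℂ f (ball (0 : ℂ) 1) → Measurable f →
      ∀ θ, ∫⁻ r, ENNReal.ofReal (‖f (pt r θ)‖ ^ s) ∂nu ≤ K2 * hardyNorm s f ^ s := by
    intro f hf hfm θ
    refine (fejer_riesz hf hfm hs0 θ).trans (le_of_eq ?_)
    rw [K2]
    ring
  have root : ∀ K N : ℝ≥0∞, (K * N ^ s) ^ (1 / s) = K ^ (1 / s) * N := by
    intro K N
    rw [ENNReal.mul_rpow_of_nonneg _ _ (by positivity), ← ENNReal.rpow_mul,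
      mul_one_div_cancel hs0.ne', ENNReal.rpow_one]
  by_cases hpt : p = ⊤
  · subst hpt
    have hqs : q = ENNReal.ofReal s := by simpa using hpq
    subst hqs
    refine ⟨((ENNReal.ofReal (2 * Real.pi))⁻¹ * K1) ^ (1 / s),
      ENNReal.rpow_ne_top_of_nonneg (by positivity) (ENNReal.mul_ne_top hd K1_ne), ?_⟩
    intro f hf hfm _
    rw [rhoE, if_neg ENNReal.ofReal_ne_top, ENNReal.toReal_ofReal hs0.le, ← root, mul_assoc]
    gcongr
    exact hmx f hf hfm
  by_cases hqt : q = ⊤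
  · subst hqt
    have hps : p = ENNReal.ofReal s := by simpa using hpq
    subst hps
    refine ⟨K2 ^ (1 / s), ENNReal.rpow_ne_top_of_nonneg (by positivity) K2_ne, ?_⟩
    intro f hf hfm _
    rw [rhoE, if_pos rfl]
    refine iSup_le fun θ => ?_
    rw [radialLp, if_neg ENNReal.ofReal_ne_top, ENNReal.toReal_ofReal hs0.le, ← root]
    gcongr
    exact hfr f hf hfm θ
  have hP : 0 < p.toReal := ENNReal.toReal_pos hp.ne' hpt
  have hQ : 0 < q.toReal := ENNReal.toReal_pos hq.ne' hqt
  have hr : 1 / p.toReal + 1 / q.toReal = 1 / s := by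
    have := congrArg ENNReal.toReal hpq
    rw [ENNReal.toReal_add (by simpa using hp.ne') (by simpa using hq.ne')] at this
    simpa [ENNReal.toReal_ofReal hs0.le] using this
  set P := p.toReal
  set Q := q.toReal
  have hsP : s ≤ P := by
    have h1 : 0 < 1 / Q := by positivity
    have h2 : 1 / P ≤ 1 / s := by linarith
    exact (one_div_le_one_div hP hs0).1 h2
  refine ⟨((ENNReal.ofReal (2 * Real.pi))⁻¹ * K1) ^ (1 / Q) * K2 ^ (1 / P),
    ENNReal.mul_ne_top (ENNReal.rpow_ne_top_of_nonneg (by positivity)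
      (ENNReal.mul_ne_top hd K1_ne)) (ENNReal.rpow_ne_top_of_nonneg (by positivity) K2_ne), ?_⟩
  intro f hf hfm hN
  set N := hardyNorm s f
  have hKt : (K2 * N ^ s) ^ (Q / P) ≠ ⊤ :=
    ENNReal.rpow_ne_top_of_nonneg (by positivity)
      (ENNReal.mul_ne_top K2_ne (ENNReal.rpow_ne_top_of_nonneg hs0.le hN))
  have hpt' : ∀ θ, radialLp p f θ ^ Q ≤ radialLp ⊤ f θ ^ s * (K2 * N ^ s) ^ (Q / P) := by
    intro θ
    have h1 : radialLp p f θ = (∫⁻ r, ENNReal.ofReal (‖f (pt r θ)‖ ^ P) ∂nu) ^ (1 / P) := by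
      rw [radialLp, if_neg hpt]
    rw [h1, ← ENNReal.rpow_mul]
    have h2 := (radialLp_fin_le hfm hs0 hsP θ).trans (mul_le_mul_right (hfr f hf hfm θ) _)
    have h3 := ENNReal.rpow_le_rpow h2 (by positivity : 0 ≤ 1 / P * Q)
    refine h3.trans (le_of_eq ?_)
    rw [ENNReal.mul_rpow_of_nonneg _ _ (by positivity), ← ENNReal.rpow_mul]
    congr 2
    · field_simp at hr ⊢
      linarith
    · field_simp
  rw [rhoE, if_neg hqt]
  calc _ ≤ ((ENNReal.ofReal (2 * Real.pi))⁻¹ *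
        ((K1 * N ^ s) * (K2 * N ^ s) ^ (Q / P))) ^ (1 / Q) := by
        refine ENNReal.rpow_le_rpow ?_ (by positivity)
        refine mul_le_mul_right ?_ _
        refine (lintegral_mono hpt').trans ?_
        rw [lintegral_mul_const' _ _ hKt]
        exact mul_le_mul_left (hmx f hf hfm) _
    _ = _ := by
        have hQ' : 0 ≤ 1 / Q := by positivity
        have hP' : 0 ≤ 1 / P := by positivity
        have e1 : Q / P * (1 / Q) = 1 / P := by field_simp
        rw [← mul_assoc, ENNReal.mul_rpow_of_nonneg _ _ hQ', ← ENNReal.rpow_mul, e1, ← mul_assoc,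
          ENNReal.mul_rpow_of_nonneg _ _ hQ', ENNReal.mul_rpow_of_nonneg K2 _ hP',
          mul_mul_mul_comm]
        congr 1
        rw [← ENNReal.rpow_mul, ← ENNReal.rpow_mul,
          ← ENNReal.rpow_add_of_nonneg _ _ (by positivity) (by positivity), ← mul_add,
          add_comm (1 / Q), hr, mul_one_div_cancel hs0.ne', ENNReal.rpow_one]

lemma radialLp_congr {f g : ℂ → ℂ} (h : ∀ z ∈ ball (0:ℂ) 1, f z = g z) (p : ℝ≥0∞) (θ : ℝ) :
    radialLp p f θ = radialLp p g θ := by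
  unfold radialLp
  split_ifs
  · refine iSup_congr fun r => ?_
    rw [h _ (pt_mem r.2.1 r.2.2 θ)]
  · congr 1
    refine setLIntegral_congr_fun measurableSet_Ioo fun r hr => ?_
    simp only [h _ (pt_mem hr.1.le hr.2 θ)]

lemma rhoE_congr {f g : ℂ → ℂ} (h : ∀ z ∈ ball (0:ℂ) 1, f z = g z) (p q : ℝ≥0∞) :
    rhoE p q f = rhoE p q g := by
  unfold rhoE
  simp only [radialLp_congr h]

lemma hardyNorm_congr {f g : ℂ → ℂ} (h : ∀ z ∈ ball (0:ℂ) 1, f z = g z) (s : ℝ) :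
    hardyNorm s f = hardyNorm s g := by
  unfold hardyNorm
  refine iSup_congr fun r => ?_
  have : ∀ θ : ℝ, f (pt r θ) = g (pt r θ) := fun θ => h _ (pt_mem r.2.1 r.2.2 θ)
  simp only [pt] at this
  simp only [this]

end HardyAux

/-- For `1 ≤ s < ∞` and `0 < p, q ≤ ∞` with `1/p + 1/q = 1/s`, there is `C > 0` such that
`ρ_{p,q}(f) ≤ C ‖f‖_{H^s}` for every `f ∈ H^s`; in particular `H^s ⊆ RM(p,q)`. -/
theorem stmt_9 (s : ℝ) (hs : 1 ≤ s) (p q : ℝ≥0∞) (hp : 0 < p) (hq : 0 < q)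
    (hpq : 1 / p + 1 / q = 1 / ENNReal.ofReal s) :
    ∃ C : ℝ, 0 < C ∧ ∀ f : ℂ → ℂ, DifferentiableOn ℂ f (Metric.ball (0 : ℂ) 1) →
      hardyNorm s f ≠ ⊤ →
      rhoE p q f ≤ ENNReal.ofReal C * hardyNorm s f := by
  obtain ⟨c, hc, h⟩ := HardyAux.main_bound s hs p q hp hq hpq
  refine ⟨c.toReal + 1, by positivity, fun f hf hN => ?_⟩
  classical
  let g : ℂ → ℂ := (Metric.ball (0:ℂ) 1).piecewise f (fun _ => 0)
  have hfg : ∀ z ∈ Metric.ball (0:ℂ) 1, f z = g z := fun z hz =>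
    (Set.piecewise_eq_of_mem _ _ _ hz).symm
  have hg : DifferentiableOn ℂ g (Metric.ball 0 1) := hf.congr fun z hz => (hfg z hz).symm
  have hgm : Measurable g :=
    hf.continuousOn.measurable_piecewise continuousOn_const Metric.isOpen_ball.measurableSet
  rw [HardyAux.hardyNorm_congr hfg] at hN
  rw [HardyAux.hardyNorm_congr hfg, HardyAux.rhoE_congr hfg]
  refine (h g hg hgm hN).trans ?_
  gcongr
  rw [ENNReal.le_ofReal_iff_toReal_le hc (by positivity)]
  linarith
end

section
/- Let {n_k}_{k≥0} be a lacunary sequence of positive integers (i.e. n_{k+1}/n_k ≥ λ > 1 for all k), 1 ≤ p < ∞, 1 ≤ q ≤ ∞, and let f(z) = Σ_k α_k z^{n_k}. Then f ∈ RM(p,q) if and only if Σ_k |α_k|^p / n_k < ∞; moreover ρ_{p,q}(f) ≍ (Σ_k |α_k|^p / n_k)^{1/p} with implied constants independent of q. -/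
open MeasureTheory Complex Real ENNReal

lemma geom_dist (ρ : ℝ) (h0 : 0 < ρ) (h1 : ρ < 1) : ∃ T : ℝ, 0 < T ∧
    ∀ K : ℕ, ∑' k : ℕ, ENNReal.ofReal (ρ ^ (Int.natAbs ((k : ℤ) - (K : ℤ)))) ≤ ENNReal.ofReal T := by
  have hs : Summable (fun z : ℤ => ρ ^ z.natAbs) := by
    have hg := summable_geometric_of_lt_one h0.le h1
    apply Summable.of_nat_of_neg
    · simpa using hg
    · simpa using hg
  have hfin : ∑' z : ℤ, ENNReal.ofReal (ρ ^ z.natAbs) ≤ ENNReal.ofReal (∑' z : ℤ, ρ ^ z.natAbs) := by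
    rw [ENNReal.ofReal_tsum_of_nonneg (fun z => by positivity) hs]
  refine ⟨∑' z : ℤ, ρ ^ z.natAbs, ?_, fun K => ?_⟩
  · exact hs.tsum_pos (fun z => by positivity) 0 (by positivity)
  · refine le_trans ?_ hfin
    exact ENNReal.tsum_comp_le_tsum_of_injective (f := fun k : ℕ => (k : ℤ) - (K : ℤ))
      (fun a b h => by simpa using h) (fun z : ℤ => ENNReal.ofReal (ρ ^ z.natAbs))

lemma lac_pow (n : ℕ → ℕ) (lam : ℝ) (hlam : 1 < lam)
    (hlac : ∀ k, lam * (n k : ℝ) ≤ (n (k + 1) : ℝ)) (k l : ℕ) :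
    lam ^ l * (n k : ℝ) ≤ (n (k + l) : ℝ) := by
  induction l with
  | zero => simp
  | succ l ih =>
    calc lam ^ (l + 1) * (n k : ℝ) = lam * (lam ^ l * n k) := by ring
      _ ≤ lam * n (k + l) := by gcongr
      _ ≤ _ := hlac _

lemma scale_sum (n : ℕ → ℕ) (lam : ℝ) (hlam : 1 < lam) (hpos : ∀ k, 0 < n k)
    (hlac : ∀ k, lam * (n k : ℝ) ≤ (n (k + 1) : ℝ)) (b : ℝ) (hb : 0 < b) :
    ∃ C : ℝ, 0 < C ∧ ∀ v : ℝ, 0 < v →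
      ∑' k, ENNReal.ofReal (min (((n k : ℝ) * v) ^ b) (((n k : ℝ) * v) ^ (-b))) ≤ ENNReal.ofReal C := by
  have hl0 : 0 < lam := by linarith
  set ρ : ℝ := lam ^ (-b) with hρ
  have hρ0 : 0 < ρ := by positivity
  have hρ1 : ρ < 1 := Real.rpow_lt_one_of_one_lt_of_neg hlam (by linarith)
  obtain ⟨T, hT, hTs⟩ := geom_dist ρ hρ0 hρ1
  refine ⟨ρ⁻¹ * T, by positivity, fun v hv => ?_⟩
  have hex : ∃ k, 1 < (n k : ℝ) * v := by
    obtain ⟨l, hl⟩ := pow_unbounded_of_one_lt (1 / v) hlam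
    refine ⟨0 + l, ?_⟩
    have h1 := lac_pow n lam hlam hlac 0 l
    have h2 : (1 : ℝ) ≤ n 0 := by exact_mod_cast hpos 0
    rw [div_lt_iff₀ hv] at hl
    calc (1 : ℝ) < lam ^ l * v := hl
      _ = lam ^ l * 1 * v := by ring
      _ ≤ lam ^ l * n 0 * v := by gcongr
      _ ≤ _ := by gcongr
  classical
  set K := Nat.find hex with hK
  have hKs : 1 < (n K : ℝ) * v := Nat.find_spec hex
  have hKm : ∀ k, k < K → (n k : ℝ) * v ≤ 1 := fun k hk => not_lt.1 (Nat.find_min hex hk)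
  have key : ∀ k, min (((n k : ℝ) * v) ^ b) (((n k : ℝ) * v) ^ (-b)) ≤
      ρ⁻¹ * ρ ^ (Int.natAbs ((k : ℤ) - (K : ℤ))) := by
    intro k
    have hnk : (0 : ℝ) < n k := by exact_mod_cast hpos k
    have hx : 0 < (n k : ℝ) * v := by positivity
    have hpw : ∀ l : ℕ, ρ ^ l = (lam ^ l) ^ (-b) := by
      intro l
      rw [hρ, ← Real.rpow_natCast, ← Real.rpow_mul hl0.le, ← Real.rpow_natCast,
        ← Real.rpow_mul hl0.le, mul_comm]
    rcases lt_or_ge k K with h | h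
    · refine (min_le_left _ _).trans ?_
      obtain ⟨l, hl⟩ := Nat.exists_eq_add_of_lt h
      have e : Int.natAbs ((k : ℤ) - (K : ℤ)) = l + 1 := by omega
      rw [e, pow_succ, mul_comm (ρ ^ l), ← mul_assoc, inv_mul_cancel₀ hρ0.ne', one_mul, hpw,
        Real.rpow_neg (by positivity), ← Real.inv_rpow (by positivity)]
      apply Real.rpow_le_rpow hx.le _ hb.le
      have h1 := lac_pow n lam hlam hlac k l
      have h2 := hKm (k + l) (by omega)
      rw [le_inv_comm₀ hx (by positivity)]
      rw [le_inv_comm₀ (by positivity) hx, ← one_div, le_div_iff₀ (by positivity)]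
      calc (n k : ℝ) * v * lam ^ l = lam ^ l * n k * v := by ring
        _ ≤ n (k + l) * v := by gcongr
        _ ≤ 1 := h2
    · refine (min_le_right _ _).trans ?_
      obtain ⟨l, hl⟩ := Nat.exists_eq_add_of_le h
      have e : Int.natAbs ((k : ℤ) - (K : ℤ)) = l := by omega
      rw [e]
      have h3 : ρ ^ l ≤ ρ⁻¹ * ρ ^ l := by
        have : 1 ≤ ρ⁻¹ := (one_le_inv₀ hρ0).2 hρ1.le
        have h4 : 0 < ρ ^ l := by positivity
        nlinarith
      refine le_trans ?_ h3
      rw [hpw]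
      apply Real.rpow_le_rpow_of_nonpos (by positivity) _ (by linarith)
      have h1 := lac_pow n lam hlam hlac K l
      rw [hl]
      calc lam ^ l = lam ^ l * 1 := by ring
        _ ≤ lam ^ l * (n K * v) := by gcongr
        _ = lam ^ l * n K * v := by ring
        _ ≤ _ := by gcongr
  calc ∑' k, ENNReal.ofReal (min (((n k : ℝ) * v) ^ b) (((n k : ℝ) * v) ^ (-b)))
      ≤ ∑' k : ℕ, ENNReal.ofReal ρ⁻¹ * ENNReal.ofReal (ρ ^ (Int.natAbs ((k : ℤ) - (K : ℤ)))) := by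
        apply ENNReal.tsum_le_tsum
        intro k
        rw [← ENNReal.ofReal_mul (by positivity)]
        exact ENNReal.ofReal_le_ofReal (key k)
    _ ≤ _ := by
        rw [ENNReal.tsum_mul_left, ENNReal.ofReal_mul (by positivity)]
        gcongr
        exact hTs K

lemma holder_tsum (p : ℝ) (hp : 1 ≤ p) (w f : ℕ → ℝ≥0∞) :
    (∑' k, w k * f k) ^ p ≤ (∑' k, w k) ^ (p - 1) * ∑' k, w k * f k ^ p := by
  have hp0 : 0 < p := by linarith
  rw [← ENNReal.le_rpow_inv_iff hp0]
  rw [ENNReal.tsum_eq_iSup_sum]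
  refine iSup_le fun s => ?_
  refine (ENNReal.inner_le_weight_mul_Lp_of_nonneg s hp w f).trans ?_
  rw [ENNReal.mul_rpow_of_nonneg _ _ (by positivity), ← ENNReal.rpow_mul]
  have : (p - 1) * p⁻¹ = 1 - p⁻¹ := by field_simp
  rw [this]
  have h1 : 0 ≤ 1 - p⁻¹ := by
    have : p⁻¹ ≤ 1 := inv_le_one_of_one_le₀ hp
    linarith
  gcongr
  · exact ENNReal.sum_le_tsum s
  · exact ENNReal.sum_le_tsum s

lemma upper_core (p : ℝ) (hp : 1 ≤ p) (n : ℕ → ℕ) (lam : ℝ) (hlam : 1 < lam)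
    (hpos : ∀ k, 0 < n k) (hlac : ∀ k, lam * (n k : ℝ) ≤ (n (k + 1) : ℝ)) :
    ∃ C : ℝ, 0 < C ∧ ∀ c : ℕ → ℝ≥0∞,
      ∫⁻ x in Set.Ioi (0 : ℝ), (∑' k, c k * ENNReal.ofReal (Real.exp (-((n k : ℝ) * x)))) ^ p
        ≤ ENNReal.ofReal C * ∑' k, c k ^ p * ENNReal.ofReal ((n k : ℝ)⁻¹) := by
  have hp0 : 0 < p := by linarith
  have hb : 0 < 1 / p := by positivity
  have hb1 : 1 / p ≤ 1 := by rw [div_le_one hp0]; exact hp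
  obtain ⟨C, hC, hCs⟩ := scale_sum n lam hlam hpos hlac (1 / p) hb
  set b := 1 / p with hbdef
  have hG : 0 < Real.Gamma b := Real.Gamma_pos_of_pos hb
  refine ⟨(2 * C) ^ (p - 1) * Real.Gamma b, by positivity, fun c => ?_⟩
  have hw : ∀ x : ℝ, 0 < x → ∑' k, ENNReal.ofReal (((n k : ℝ) * x) ^ b * Real.exp (-((n k : ℝ) * x)))
      ≤ ENNReal.ofReal (2 * C) := by
    intro x hx
    rw [ENNReal.ofReal_mul (by norm_num)]
    refine le_trans ?_ (mul_le_mul_right (hCs x hx) _)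
    rw [← ENNReal.tsum_mul_left]
    apply ENNReal.tsum_le_tsum
    intro k
    rw [← ENNReal.ofReal_mul (by norm_num)]
    apply ENNReal.ofReal_le_ofReal
    have hnk : (0 : ℝ) < n k := by exact_mod_cast hpos k
    have hy : 0 < (n k : ℝ) * x := by positivity
    generalize (n k : ℝ) * x = y at hy
    rw [mul_min_of_nonneg _ _ (by norm_num)]
    apply le_min
    · have : Real.exp (-y) ≤ 1 := Real.exp_le_one_iff.2 (by linarith)
      have h2 : 0 < y ^ b := by positivity
      nlinarith
    · have h2 : 0 < y ^ b := by positivity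
      rw [Real.rpow_neg hy.le, Real.exp_neg, ← div_eq_mul_inv, ← div_eq_mul_inv, div_le_div_iff₀ (Real.exp_pos _) h2]
      have he := Real.quadratic_le_exp_of_nonneg hy.le
      rcases le_total y 1 with h | h
      · have : y ^ b ≤ 1 := Real.rpow_le_one hy.le h hb.le
        nlinarith
      · have : y ^ b ≤ y := by
          calc y ^ b ≤ y ^ (1 : ℝ) := Real.rpow_le_rpow_of_exponent_le h hb1
            _ = y := Real.rpow_one y
        nlinarith
  have hpt : ∀ x ∈ Set.Ioi (0 : ℝ), (∑' k, c k * ENNReal.ofReal (Real.exp (-((n k : ℝ) * x)))) ^ p ≤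
      ENNReal.ofReal ((2 * C) ^ (p - 1)) * ∑' k, c k ^ p * ENNReal.ofReal ((n k : ℝ) ^ (b - 1) *
        (x ^ (b - 1) * Real.exp (-((n k : ℝ) * x)))) := by
    intro x hx
    have hx : 0 < x := hx
    have h := holder_tsum p hp (fun k => ENNReal.ofReal (((n k : ℝ) * x) ^ b * Real.exp (-((n k : ℝ) * x))))
      (fun k => c k * ENNReal.ofReal (((n k : ℝ) * x) ^ (-b)))
    have e1 : ∀ k, ENNReal.ofReal (((n k : ℝ) * x) ^ b * Real.exp (-((n k : ℝ) * x))) *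
        (c k * ENNReal.ofReal (((n k : ℝ) * x) ^ (-b))) = c k * ENNReal.ofReal (Real.exp (-((n k : ℝ) * x))) := by
      intro k
      have hnk : (0 : ℝ) < n k := by exact_mod_cast hpos k
      have hy : 0 < (n k : ℝ) * x := by positivity
      rw [mul_left_comm, ← ENNReal.ofReal_mul (by positivity)]
      congr 2
      rw [Real.rpow_neg hy.le]
      field_simp
    have e2 : ∀ k, ENNReal.ofReal (((n k : ℝ) * x) ^ b * Real.exp (-((n k : ℝ) * x))) *
        (c k * ENNReal.ofReal (((n k : ℝ) * x) ^ (-b))) ^ p = c k ^ p * ENNReal.ofReal ((n k : ℝ) ^ (b - 1) *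
        (x ^ (b - 1) * Real.exp (-((n k : ℝ) * x)))) := by
      intro k
      have hnk : (0 : ℝ) < n k := by exact_mod_cast hpos k
      have hy : 0 < (n k : ℝ) * x := by positivity
      rw [ENNReal.mul_rpow_of_nonneg _ _ hp0.le, ENNReal.ofReal_rpow_of_pos (by positivity),
        mul_left_comm, ← ENNReal.ofReal_mul (by positivity)]
      congr 2
      rw [← Real.rpow_mul hy.le]
      have : -b * p = -1 := by rw [hbdef]; field_simp
      rw [this, ← mul_assoc, ← Real.mul_rpow hnk.le hx.le, mul_right_comm, ← Real.rpow_add hy]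
      congr 2
    simp only [e1, e2] at h
    refine h.trans ?_
    gcongr
    rw [← ENNReal.ofReal_rpow_of_pos (by positivity)]
    exact ENNReal.rpow_le_rpow (hw x hx) (by linarith)
  refine (setLIntegral_mono' measurableSet_Ioi hpt).trans ?_
  rw [lintegral_const_mul _ (by fun_prop), lintegral_tsum (by fun_prop),
    ENNReal.ofReal_mul (by positivity), mul_assoc]
  gcongr
  rw [← ENNReal.tsum_mul_left]
  apply ENNReal.tsum_le_tsum
  intro k
  have hnk : (0 : ℝ) < n k := by exact_mod_cast hpos k
  rw [lintegral_const_mul _ (by fun_prop), mul_left_comm]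
  gcongr
  have hintg := Real.integral_rpow_mul_exp_neg_mul_Ioi hb hnk
  have hii : IntegrableOn (fun t : ℝ => t ^ (b - 1) * Real.exp (-((n k : ℝ) * t))) (Set.Ioi 0) := by
    by_contra hcon
    rw [integral_undef hcon] at hintg
    have : 0 < (1 / (n k : ℝ)) ^ b * Real.Gamma b := by positivity
    linarith
  rw [← ofReal_integral_eq_lintegral_ofReal (hii.const_mul _)]
  · rw [integral_const_mul, hintg, ← ENNReal.ofReal_mul hG.le]
    apply ENNReal.ofReal_le_ofReal
    rw [one_div, Real.inv_rpow hnk.le, Real.rpow_sub_one hnk.ne']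
    apply le_of_eq
    field_simp
  · filter_upwards [ae_restrict_mem measurableSet_Ioi] with x hx
    have hx : 0 < x := hx
    simp only [Pi.zero_apply]
    positivity

lemma coeff_mul_lin (P : Polynomial ℝ) (A : ℝ) (hA : ∀ i, |P.coeff i| ≤ A) (c : ℝ) (hc : |c| ≤ 1) :
    ∀ i, |(P * (Polynomial.X - Polynomial.C c)).coeff i| ≤ 2 * A := by
  have hA0 : 0 ≤ A := (abs_nonneg _).trans (hA 0)
  have hm : ∀ i, |P.coeff i * c| ≤ A := by
    intro i
    rw [abs_mul]
    have := hA i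
    nlinarith [abs_nonneg (P.coeff i), abs_nonneg c]
  intro i
  cases i with
  | zero =>
    have := hm 0
    simp only [Polynomial.mul_coeff_zero, Polynomial.coeff_sub, Polynomial.coeff_X_zero,
      Polynomial.coeff_C_zero, zero_sub, mul_neg, abs_neg]
    linarith
  | succ i =>
    rw [Polynomial.coeff_mul_X_sub_C]
    have h1 := hm (i + 1)
    have h2 := hA i
    have := abs_sub (P.coeff i) (P.coeff (i + 1) * c)
    linarith

lemma poly_bound (M m : ℕ) (J : Finset ℕ) (y : ℕ → ℝ) (hy : ∀ j, |y j| ≤ 1) :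
    (∀ i, |(Polynomial.X ^ M * (Polynomial.X - Polynomial.C (1 : ℝ)) ^ m *
      ∏ j ∈ J, (Polynomial.X - Polynomial.C (y j))).coeff i| ≤ 2 ^ (m + J.card)) ∧
    (Polynomial.X ^ M * (Polynomial.X - Polynomial.C (1 : ℝ)) ^ m *
      ∏ j ∈ J, (Polynomial.X - Polynomial.C (y j))).natDegree ≤ M + m + J.card := by
  constructor
  · classical
    induction J using Finset.induction_on with
    | empty =>
      simp only [Finset.prod_empty, mul_one, Finset.card_empty, add_zero]
      induction m with
      | zero =>
        intro i
        simp only [pow_zero, mul_one, Polynomial.coeff_X_pow]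
        split_ifs <;> simp
      | succ m ih =>
        rw [pow_succ, ← mul_assoc, pow_succ, mul_comm ((2 : ℝ) ^ m)]
        exact coeff_mul_lin _ _ ih 1 (by simp)
    | insert a J ha ih =>
      rw [Finset.prod_insert ha, Finset.card_insert_of_notMem ha, mul_comm (_ - _), ← mul_assoc,
        ← add_assoc, pow_succ, mul_comm ((2 : ℝ) ^ _)]
      exact coeff_mul_lin _ _ ih _ (hy a)
  · refine Polynomial.natDegree_mul_le.trans ?_
    gcongr
    · refine Polynomial.natDegree_mul_le.trans ?_
      gcongr
      · exact Polynomial.natDegree_X_pow_le M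
      · exact (Polynomial.natDegree_pow_le).trans (by rw [Polynomial.natDegree_X_sub_C, mul_one])
    · refine (Polynomial.natDegree_prod_le _ _).trans ?_
      simp

lemma sep_bound (lam : ℝ) (hlam : 1 < lam) (t s : ℝ) (ht1 : 1 ≤ t) (ht2 : t ≤ 2)
    (hs : lam ≤ s ∨ s ≤ lam⁻¹) :
    Real.exp (-2) * (1 - lam⁻¹) ≤ |Real.exp (-t) - Real.exp (-(t * s))| := by
  have hl0 : 0 < lam := by linarith
  have hli : lam⁻¹ < 1 := inv_lt_one_of_one_lt₀ hlam
  have he : Real.exp (-2) ≤ Real.exp (-t) := Real.exp_le_exp.2 (by linarith)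
  have he0 := Real.exp_pos (-2)
  have e : Real.exp (-(t * s)) = Real.exp (-t) * Real.exp (t * (1 - s)) := by
    rw [← Real.exp_add]; congr 1; ring
  have e2 : Real.exp (-t) - Real.exp (-(t * s)) = Real.exp (-t) * (1 - Real.exp (t * (1 - s))) := by
    rw [e]; ring
  rw [e2, abs_mul, abs_of_pos (Real.exp_pos _)]
  apply mul_le_mul he _ (by linarith) (Real.exp_pos _).le
  rcases hs with h | h
  · have h1 : Real.exp (t * (1 - s)) ≤ lam⁻¹ := by
      have : Real.exp (t * (1 - s)) ≤ Real.exp (-(lam - 1)) := Real.exp_le_exp.2 (by nlinarith)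
      refine this.trans ?_
      rw [Real.exp_neg]
      apply inv_anti₀ hl0
      linarith [Real.add_one_le_exp (lam - 1)]
    refine le_trans ?_ (le_abs_self _)
    linarith
  · have h1 := Real.add_one_le_exp (t * (1 - s))
    rw [abs_sub_comm]
    refine le_trans ?_ (le_abs_self _)
    nlinarith

lemma far_bound (lam : ℝ) (hlam : 1 < lam) (t s b : ℝ) (ht1 : 1 ≤ t) (ht2 : t ≤ 2) (hs0 : 0 < s)
    (hb0 : 0 < b) (hb1 : b ≤ 1) (l M : ℕ)
    (hs : lam ^ l ≤ s ∨ s ≤ (lam⁻¹) ^ l) :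
    (Real.exp (-(t * s)) * (1 - Real.exp (-(t * s)))) ^ (M + 1) * s ^ b ≤
      2 ^ (M + 1) * ((lam⁻¹) ^ l) ^ M := by
  have hl0 : 0 < lam := by linarith
  have hli : lam⁻¹ < 1 := inv_lt_one_of_one_lt₀ hlam
  have hli0 : 0 < lam⁻¹ := by positivity
  have hY0 := Real.exp_pos (-(t * s))
  have hY1 : Real.exp (-(t * s)) ≤ 1 := Real.exp_le_one_iff.2 (by nlinarith)
  have hlow := Real.add_one_le_exp (-(t * s))
  have hlow2 := Real.add_one_le_exp (t * s)
  have hYs : Real.exp (-(t * s)) ≤ s⁻¹ := by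
    rw [Real.exp_neg]
    apply inv_anti₀ hs0
    nlinarith
  set Y := Real.exp (-(t * s))
  have hq0 : 0 ≤ Y * (1 - Y) := by nlinarith
  have hρl1 : (lam⁻¹) ^ l ≤ 1 := pow_le_one₀ hli0.le hli.le
  rcases hs with h | h
  · have hs1 : 1 ≤ s := (one_le_pow₀ hlam.le).trans h
    have h1 : s ^ b ≤ s := by
      calc s ^ b ≤ s ^ (1 : ℝ) := Real.rpow_le_rpow_of_exponent_le hs1 hb1
        _ = s := Real.rpow_one s
    have h2 : s⁻¹ ≤ (lam⁻¹) ^ l := by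
      rw [inv_pow]
      exact inv_anti₀ (by positivity) h
    have h3 : Y * (1 - Y) ≤ s⁻¹ := by nlinarith
    calc (Y * (1 - Y)) ^ (M + 1) * s ^ b ≤ (s⁻¹) ^ (M + 1) * s := by gcongr
      _ = (s⁻¹) ^ M := by rw [pow_succ]; field_simp
      _ ≤ ((lam⁻¹) ^ l) ^ M := by gcongr
      _ ≤ _ := by
        have : (1 : ℝ) ≤ 2 ^ (M + 1) := one_le_pow₀ (by norm_num)
        have h5 : 0 < ((lam⁻¹) ^ l) ^ M := by positivity
        nlinarith
  · have h1 : s ^ b ≤ 1 := Real.rpow_le_one hs0.le (h.trans hρl1) hb0.le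
    have h3 : Y * (1 - Y) ≤ 2 * (lam⁻¹) ^ l := by nlinarith
    calc (Y * (1 - Y)) ^ (M + 1) * s ^ b ≤ (2 * (lam⁻¹) ^ l) ^ (M + 1) * 1 := by gcongr
      _ = 2 ^ (M + 1) * (((lam⁻¹) ^ l) ^ M * (lam⁻¹) ^ l) := by rw [mul_pow, pow_succ ((lam⁻¹) ^ l)]; ring
      _ ≤ 2 ^ (M + 1) * (((lam⁻¹) ^ l) ^ M * 1) := by gcongr
      _ = _ := by ring

lemma interp (p : ℝ) (hp : 1 ≤ p) (n : ℕ → ℕ) (lam : ℝ) (hlam : 1 < lam)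
    (hpos : ∀ k, 0 < n k) (hlac : ∀ k, lam * (n k : ℝ) ≤ (n (k + 1) : ℝ)) (ε : ℝ) (hε : 0 < ε) :
    ∃ (D : ℕ) (Mc : ℝ), 0 < Mc ∧ ∀ (k : ℕ) (t : ℝ), 1 ≤ t → t ≤ 2 → ∃ a : ℕ → ℝ,
      (∀ i, |a i| ≤ Mc) ∧
      (∑ i ∈ Finset.range D, a i * (Real.exp (-t)) ^ (i + 1) = 1) ∧
      ∀ j, j ≠ k →
        |∑ i ∈ Finset.range D, a i * (Real.exp (-(t * ((n j : ℝ) / n k)))) ^ (i + 1)| *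
          ((n j : ℝ) / n k) ^ (1 / p) ≤ ε * (lam⁻¹) ^ (Int.natAbs ((j : ℤ) - (k : ℤ))) := by
  have hp0 : 0 < p := by linarith
  have hb : 0 < 1 / p := by positivity
  have hb1 : 1 / p ≤ 1 := by rw [div_le_one hp0]; exact hp
  have hl0 : 0 < lam := by linarith
  have hli : lam⁻¹ < 1 := inv_lt_one_of_one_lt₀ hlam
  have hli0 : 0 < lam⁻¹ := by positivity
  obtain ⟨κ, hκ⟩ : ∃ κ, κ = Real.exp (-2) * (1 - Real.exp (-1)) := ⟨_, rfl⟩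
  obtain ⟨δ, hδ⟩ : ∃ δ, δ = Real.exp (-2) * (1 - lam⁻¹) := ⟨_, rfl⟩
  have he1 : Real.exp (-1) < 1 := by rw [Real.exp_lt_one_iff]; norm_num
  have he2 : Real.exp (-2) < 1 := by rw [Real.exp_lt_one_iff]; norm_num
  have he20 := Real.exp_pos (-2)
  have hκ0 : 0 < κ := by rw [hκ]; apply mul_pos he20; linarith
  have hδ0 : 0 < δ := by rw [hδ]; apply mul_pos he20; linarith
  have hδ1 : δ ≤ 1 := by rw [hδ]; nlinarith
  obtain ⟨N, hN⟩ : ∃ N : ℕ, (lam⁻¹) ^ N < κ / 4 := exists_pow_lt_of_lt_one (by positivity) hli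
  obtain ⟨M, hM⟩ : ∃ M : ℕ, (1 / 2 : ℝ) ^ M < ε * (δ ^ (2 * N + 1) * (κ / 2) * (lam⁻¹) ^ N) :=
    exists_pow_lt_of_lt_one (by positivity) (by norm_num)
  -- use exponent `M + 1`, vanishing order `M + 2`
  have hM' : (1 / 2 : ℝ) ^ (M + 1) ≤ ε * (δ ^ (2 * N + 1) * (κ / 2) * (lam⁻¹) ^ N) := by
    refine le_trans ?_ hM.le
    exact pow_le_pow_of_le_one (by norm_num) (by norm_num) (by omega)
  set B0 : ℝ := κ ^ (M + 2) * δ ^ (2 * N + 1) with hB0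
  have hB0p : 0 < B0 := by positivity
  refine ⟨(M + 1) + (M + 2) + (2 * N + 1) + 1, 2 ^ ((M + 2) + (2 * N + 1)) / B0, by positivity, ?_⟩
  intro k t ht1 ht2
  have hnk : ∀ k, (0 : ℝ) < n k := fun k => by exact_mod_cast hpos k
  -- ratio bounds
  have hratio : ∀ j : ℕ, lam ^ (Int.natAbs ((j : ℤ) - (k : ℤ))) ≤ (n j : ℝ) / n k ∨
      (n j : ℝ) / n k ≤ (lam⁻¹) ^ (Int.natAbs ((j : ℤ) - (k : ℤ))) := by
    intro j
    rcases le_total k j with h | h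
    · left
      obtain ⟨l, rfl⟩ := Nat.exists_eq_add_of_le h
      have e : Int.natAbs (((k + l : ℕ) : ℤ) - (k : ℤ)) = l := by omega
      rw [e, le_div_iff₀ (hnk k)]
      exact lac_pow n lam hlam hlac k l
    · right
      obtain ⟨l, rfl⟩ := Nat.exists_eq_add_of_le h
      have e : Int.natAbs ((j : ℤ) - ((j + l : ℕ) : ℤ)) = l := by omega
      rw [e, div_le_iff₀ (hnk _), inv_pow, inv_mul_eq_div, le_div_iff₀ (by positivity), mul_comm]
      exact lac_pow n lam hlam hlac j l
  set y : ℕ → ℝ := fun j => Real.exp (-(t * ((n j : ℝ) / n k))) with hy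
  have hy0 : ∀ j, 0 < y j := fun j => Real.exp_pos _
  have hy1 : ∀ j, y j ≤ 1 := fun j => Real.exp_le_one_iff.2 (by
    have : 0 < (n j : ℝ) / n k := div_pos (hnk j) (hnk k)
    nlinarith)
  set J : Finset ℕ := (Finset.Icc (k - N) (k + N)).erase k with hJ
  have hJc : J.card ≤ 2 * N + 1 := by
    refine (Finset.card_erase_le).trans ?_
    rw [Nat.card_Icc]; omega
  obtain ⟨hco, hdeg⟩ := poly_bound (M + 1) (M + 2) J y (fun j => by
    rw [abs_of_pos (hy0 j)]; exact hy1 j)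
  set P : Polynomial ℝ := Polynomial.X ^ (M + 1) * (Polynomial.X - Polynomial.C (1 : ℝ)) ^ (M + 2) *
      ∏ j ∈ J, (Polynomial.X - Polynomial.C (y j)) with hP
  have hev : ∀ Y : ℝ, ∑ i ∈ Finset.range ((M + 1) + (M + 2) + (2 * N + 1) + 1), P.coeff i * Y ^ (i + 1)
      = Y ^ (M + 2) * (Y - 1) ^ (M + 2) * ∏ j ∈ J, (Y - y j) := by
    intro Y
    have h1 := Polynomial.eval_eq_sum_range' (p := P)
      (n := (M + 1) + (M + 2) + (2 * N + 1) + 1) (by omega) Y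
    have h2 : P.eval Y = Y ^ (M + 1) * (Y - 1) ^ (M + 2) * ∏ j ∈ J, (Y - y j) := by
      rw [hP]; simp [Polynomial.eval_prod]
    calc _ = (∑ i ∈ Finset.range ((M + 1) + (M + 2) + (2 * N + 1) + 1), P.coeff i * Y ^ i) * Y := by
            rw [Finset.sum_mul]
            exact Finset.sum_congr rfl fun i _ => by ring
      _ = _ := by rw [← h1, h2]; ring
  have habs : ∀ Y : ℝ, 0 ≤ Y → Y ≤ 1 → |Y ^ (M + 2) * (Y - 1) ^ (M + 2) * ∏ j ∈ J, (Y - y j)| =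
      (Y * (1 - Y)) ^ (M + 2) * ∏ j ∈ J, |Y - y j| := by
    intro Y h0 h1
    rw [abs_mul, abs_mul, abs_pow, abs_pow, Finset.abs_prod, abs_of_nonneg h0, abs_sub_comm,
      abs_of_nonneg (sub_nonneg.2 h1), mul_pow]
  set V : ℝ := Real.exp (-t) ^ (M + 2) * (Real.exp (-t) - 1) ^ (M + 2) *
    ∏ j ∈ J, (Real.exp (-t) - y j) with hV
  have het1 : Real.exp (-t) ≤ Real.exp (-1) := Real.exp_le_exp.2 (by linarith)
  have het2 : Real.exp (-2) ≤ Real.exp (-t) := Real.exp_le_exp.2 (by linarith)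
  have hVb : B0 ≤ |V| := by
    rw [hV, habs _ (Real.exp_pos _).le (by linarith), hB0]
    apply mul_le_mul
    · apply pow_le_pow_left₀ hκ0.le
      rw [hκ]
      apply mul_le_mul het2 (by linarith) (by linarith) (Real.exp_pos _).le
    · calc δ ^ (2 * N + 1) ≤ δ ^ J.card := pow_le_pow_of_le_one hδ0.le hδ1 hJc
        _ = ∏ j ∈ J, δ := by simp
        _ ≤ _ := by
          apply Finset.prod_le_prod (fun _ _ => hδ0.le)
          intro j hj
          rw [hδ]
          apply sep_bound lam hlam t _ ht1 ht2
          have hjk : j ≠ k := (Finset.mem_erase.1 hj).1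
          have hl1 : 1 ≤ Int.natAbs ((j : ℤ) - (k : ℤ)) := by omega
          rcases hratio j with h | h
          · left
            refine le_trans ?_ h
            calc lam = lam ^ 1 := (pow_one _).symm
              _ ≤ _ := pow_le_pow_right₀ hlam.le hl1
          · right
            refine h.trans ?_
            calc _ ≤ (lam⁻¹) ^ 1 := pow_le_pow_of_le_one hli0.le hli.le hl1
              _ = _ := pow_one _
    · positivity
    · apply pow_nonneg; apply mul_nonneg (Real.exp_pos _).le; linarith
  have hVp : 0 < |V| := lt_of_lt_of_le hB0p hVb
  have hV0 : V ≠ 0 := abs_pos.1 hVp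
  have hsum : ∀ Y : ℝ, ∑ i ∈ Finset.range ((M + 1) + (M + 2) + (2 * N + 1) + 1),
      P.coeff i / V * Y ^ (i + 1)
      = (Y ^ (M + 2) * (Y - 1) ^ (M + 2) * ∏ j ∈ J, (Y - y j)) / V := by
    intro Y
    rw [← hev, Finset.sum_div]
    exact Finset.sum_congr rfl fun i _ => by ring
  refine ⟨fun i => P.coeff i / V, fun i => ?_, ?_, fun j hjk => ?_⟩
  · rw [abs_div]
    apply div_le_div₀ (by positivity) _ hB0p hVb
    refine (hco i).trans ?_
    exact pow_le_pow_right₀ (by norm_num) (by omega)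
  · rw [hsum]
    exact div_self hV0
  · rw [hsum]
    set l := Int.natAbs ((j : ℤ) - (k : ℤ)) with hl
    have hsp : 0 < (n j : ℝ) / n k := div_pos (hnk j) (hnk k)
    by_cases hjJ : j ∈ J
    · have : ∏ i ∈ J, (Real.exp (-(t * ((n j : ℝ) / n k))) - y i) = 0 :=
        Finset.prod_eq_zero hjJ (by simp [hy])
      rw [this, mul_zero, zero_div, abs_zero, zero_mul]
      positivity
    · have hlN : N ≤ l := by
        by_contra hcon
        apply hjJ
        rw [hJ, Finset.mem_erase, Finset.mem_Icc]
        refine ⟨hjk, ?_, ?_⟩ <;> omega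
      rw [abs_div, habs _ (hy0 j).le (hy1 j), div_mul_eq_mul_div, div_le_iff₀ hVp]
      have hfar := far_bound lam hlam t _ (1 / p) ht1 ht2 hsp hb hb1 l (M + 1) (hratio j)
      have hprod : ∏ i ∈ J, |Real.exp (-(t * ((n j : ℝ) / n k))) - y i| ≤ 1 := by
        apply Finset.prod_le_one (fun _ _ => abs_nonneg _)
        intro i _
        have h1 := hy0 i
        have h2 := hy1 i
        have h3 := hy0 j
        have h4 := hy1 j
        rw [hy] at h3 h4
        rw [abs_le]
        constructor <;> simp only at h3 h4 <;> linarith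
      have hq0 : 0 ≤ Real.exp (-(t * ((n j : ℝ) / n k))) * (1 - Real.exp (-(t * ((n j : ℝ) / n k)))) :=
        mul_nonneg (hy0 j).le (sub_nonneg.2 (hy1 j))
      calc _ ≤ (Real.exp (-(t * ((n j : ℝ) / n k))) * (1 - Real.exp (-(t * ((n j : ℝ) / n k))))) ^ (M + 2) * 1 *
            ((n j : ℝ) / n k) ^ (1 / p) := by gcongr
        _ ≤ 2 ^ (M + 2) * ((lam⁻¹) ^ l) ^ (M + 1) := by rw [mul_one]; exact hfar
        _ ≤ ε * lam⁻¹ ^ l * B0 := ?_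
        _ ≤ _ := by gcongr
      obtain ⟨d, hd⟩ := Nat.exists_eq_add_of_le hlN
      have hr : ((lam⁻¹) ^ l) ^ (M + 1) ≤ (κ / 4) ^ (M + 1) * (lam⁻¹) ^ d := by
        rw [hd, pow_add lam⁻¹ N d, mul_pow]
        apply mul_le_mul
        · apply pow_le_pow_left₀ (by positivity) hN.le
        · have h1 : (lam⁻¹) ^ d ≤ 1 := pow_le_one₀ hli0.le hli.le
          calc ((lam⁻¹) ^ d) ^ (M + 1) ≤ ((lam⁻¹) ^ d) ^ 1 :=
                pow_le_pow_of_le_one (by positivity) h1 (by omega)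
            _ = _ := pow_one _
        · positivity
        · positivity
      calc (2 : ℝ) ^ (M + 2) * ((lam⁻¹) ^ l) ^ (M + 1)
          ≤ 2 ^ (M + 2) * ((κ / 4) ^ (M + 1) * (lam⁻¹) ^ d) := by gcongr
        _ = (1 / 2 : ℝ) ^ (M + 1) * (2 * κ ^ (M + 1) * (lam⁻¹) ^ d) := by
            have : (κ / 4) ^ (M + 1) = κ ^ (M + 1) * (1 / 2) ^ (M + 1) * (1 / 2) ^ (M + 1) := by
              rw [← mul_pow, ← mul_pow]; congr 1; ring
            rw [this]
            have h2 : (2 : ℝ) ^ (M + 2) * (1 / 2) ^ (M + 1) = 2 := by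
              rw [pow_succ, mul_right_comm, ← mul_pow]; norm_num
            calc _ = ((2 : ℝ) ^ (M + 2) * (1 / 2) ^ (M + 1)) * (κ ^ (M + 1) * (1 / 2) ^ (M + 1) * (lam⁻¹) ^ d) := by ring
              _ = _ := by rw [h2]; ring
        _ ≤ (ε * (δ ^ (2 * N + 1) * (κ / 2) * (lam⁻¹) ^ N)) * (2 * κ ^ (M + 1) * (lam⁻¹) ^ d) := by gcongr
        _ = _ := by rw [hd, hB0]; ring

lemma cov_le (c : ℝ) (hc : 0 < c) (F : ℝ → ℝ≥0∞) :
    ENNReal.ofReal c * ∫⁻ t in Set.Icc (1 : ℝ) 2, F (Real.exp (-(t * c))) ≤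
      ENNReal.ofReal (Real.exp (2 * c)) *
        ∫⁻ r in (fun t : ℝ => Real.exp (-(t * c))) '' Set.Icc (1 : ℝ) 2, F r := by
  have hder : ∀ t ∈ Set.Icc (1 : ℝ) 2, HasDerivWithinAt (fun t : ℝ => Real.exp (-(t * c)))
      (Real.exp (-(t * c)) * (-(1 * c))) (Set.Icc 1 2) t := fun t _ =>
    ((((hasDerivAt_id t).mul_const c).neg).exp).hasDerivWithinAt
  have hinj : Set.InjOn (fun t : ℝ => Real.exp (-(t * c))) (Set.Icc (1 : ℝ) 2) := by
    intro a _ b _ h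
    have := Real.exp_injective h
    have h2 : a * c = b * c := by linarith
    exact mul_right_cancel₀ hc.ne' h2
  rw [lintegral_image_eq_lintegral_abs_deriv_mul measurableSet_Icc hder hinj,
    ← lintegral_const_mul' _ _ ENNReal.ofReal_ne_top, ← lintegral_const_mul' _ _ ENNReal.ofReal_ne_top]
  apply setLIntegral_mono' measurableSet_Icc
  intro t ht
  rw [← mul_assoc, ← ENNReal.ofReal_mul (Real.exp_pos _).le]
  gcongr
  rw [abs_mul, abs_of_pos (Real.exp_pos _), abs_neg, one_mul, abs_of_pos hc, ← mul_assoc,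
    ← Real.exp_add]
  have : 1 ≤ Real.exp (2 * c + -(t * c)) := Real.one_le_exp (by nlinarith [ht.2])
  nlinarith

lemma overlap_sum (n : ℕ → ℕ) (hpos : ∀ k, 0 < n k) (C : ℝ) (hC : 0 < C)
    (hCs : ∀ v : ℝ, 0 < v →
      ∑' k, ENNReal.ofReal (min (((n k : ℝ) * v) ^ (1 : ℝ)) (((n k : ℝ) * v) ^ (-1 : ℝ))) ≤ ENNReal.ofReal C)
    (m : ℝ) (hm : 0 < m) (h : ℝ → ℝ≥0∞) (hh : Measurable h) :
    ∑' k, ∫⁻ r in (fun t : ℝ => Real.exp (-(t * (m / n k)))) '' Set.Icc (1 : ℝ) 2, h r ≤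
      ENNReal.ofReal (2 * C) * ∫⁻ r in Set.Ioo (0 : ℝ) 1, h r := by
  have hnk : ∀ k, (0 : ℝ) < n k := fun k => by exact_mod_cast hpos k
  have hmeas : ∀ k, MeasurableSet ((fun t : ℝ => Real.exp (-(t * (m / n k)))) '' Set.Icc (1 : ℝ) 2) := by
    intro k
    apply IsCompact.measurableSet
    apply isCompact_Icc.image
    fun_prop
  have hsub : ∀ k, ((fun t : ℝ => Real.exp (-(t * (m / n k)))) '' Set.Icc (1 : ℝ) 2) ⊆ Set.Ioo 0 1 := by
    rintro k _ ⟨t, ht, rfl⟩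
    refine ⟨Real.exp_pos _, ?_⟩
    simp only
    rw [Real.exp_lt_one_iff]
    have : 0 < m / n k := div_pos hm (hnk k)
    nlinarith [ht.1]
  have e : ∀ k, ∫⁻ r in (fun t : ℝ => Real.exp (-(t * (m / n k)))) '' Set.Icc (1 : ℝ) 2, h r =
      ∫⁻ r in Set.Ioo (0 : ℝ) 1,
        ((fun t : ℝ => Real.exp (-(t * (m / n k)))) '' Set.Icc (1 : ℝ) 2).indicator h r := by
    intro k
    rw [setLIntegral_indicator (hmeas k), Set.inter_eq_left.2 (hsub k)]
  simp_rw [e]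
  rw [← lintegral_tsum (fun k => (hh.indicator (hmeas k)).aemeasurable),
    ← lintegral_const_mul _ hh]
  apply setLIntegral_mono' measurableSet_Ioo
  intro r hr
  have hv : 0 < -Real.log r / m := div_pos (by linarith [Real.log_neg hr.1 hr.2]) hm
  calc _ ≤ ∑' k, (ENNReal.ofReal 2 * ENNReal.ofReal (min (((n k : ℝ) * (-Real.log r / m)) ^ (1 : ℝ))
            (((n k : ℝ) * (-Real.log r / m)) ^ (-1 : ℝ)))) * h r := by
        apply ENNReal.tsum_le_tsum
        intro k
        by_cases hmem : r ∈ ((fun t : ℝ => Real.exp (-(t * (m / n k)))) '' Set.Icc (1 : ℝ) 2)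
        · rw [Set.indicator_of_mem hmem]
          obtain ⟨t, ht, rfl⟩ := hmem
          have hx : (n k : ℝ) * (-Real.log (Real.exp (-(t * (m / n k)))) / m) = t := by
            have := (hnk k).ne'
            rw [Real.log_exp]
            field_simp
          simp only [hx]
          rw [← ENNReal.ofReal_mul (by norm_num)]
          conv_lhs => rw [← one_mul (h _)]
          gcongr
          rw [ENNReal.one_le_ofReal, mul_min_of_nonneg _ _ (by norm_num)]
          apply le_min
          · rw [Real.rpow_one]; linarith [ht.1]
          · rw [Real.rpow_neg_one, ← div_eq_mul_inv, one_le_div (by linarith [ht.1])]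
            exact ht.2
        · rw [Set.indicator_of_notMem hmem]
          exact bot_le
    _ = (ENNReal.ofReal 2 * ∑' k, ENNReal.ofReal (min (((n k : ℝ) * (-Real.log r / m)) ^ (1 : ℝ))
            (((n k : ℝ) * (-Real.log r / m)) ^ (-1 : ℝ)))) * h r := by
        rw [ENNReal.tsum_mul_right, ENNReal.tsum_mul_left]
    _ ≤ _ := by
        rw [ENNReal.ofReal_mul (by norm_num)]
        gcongr
        exact hCs _ hv

lemma schur_bound (p : ℝ) (hp : 1 ≤ p) (n : ℕ → ℕ) (hpos : ∀ k, 0 < n k) (ρ : ℝ) (hρ : 0 < ρ) (T ε : ℝ)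
    (hε : 0 < ε) (hT : 0 < T)
    (hTs : ∀ K : ℕ, ∑' k : ℕ, ENNReal.ofReal (ρ ^ (Int.natAbs ((k : ℤ) - (K : ℤ)))) ≤ ENNReal.ofReal T)
    (d : ℕ → ℝ≥0∞) :
    ∑' k : ℕ, (∑' j : ℕ, d j * ENNReal.ofReal (ε * ρ ^ (Int.natAbs ((j : ℤ) - (k : ℤ))) *
        ((n k : ℝ) / n j) ^ (1 / p))) ^ p * ENNReal.ofReal ((n k : ℝ)⁻¹) ≤
      ENNReal.ofReal (ε * T) ^ p * ∑' k, d k ^ p * ENNReal.ofReal ((n k : ℝ)⁻¹) := by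
  have hp0 : 0 < p := by linarith
  have hnk : ∀ k, (0 : ℝ) < n k := fun k => by exact_mod_cast hpos k
  have hinv : ∀ k, ENNReal.ofReal ((n k : ℝ)⁻¹) = ENNReal.ofReal ((n k : ℝ) ^ (-(1 / p))) ^ p := by
    intro k
    have := hnk k
    rw [ENNReal.ofReal_rpow_of_pos (by positivity), ← Real.rpow_mul (hnk k).le]
    have e : -(1 / p) * p = -1 := by field_simp
    rw [e, Real.rpow_neg_one]
  have hk : ∀ k : ℕ, (∑' j : ℕ, d j * ENNReal.ofReal (ε * ρ ^ (Int.natAbs ((j : ℤ) - (k : ℤ))) *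
        ((n k : ℝ) / n j) ^ (1 / p))) ^ p * ENNReal.ofReal ((n k : ℝ)⁻¹) ≤
      ENNReal.ofReal ε ^ p * (ENNReal.ofReal T ^ (p - 1) * ∑' j : ℕ,
        ENNReal.ofReal (ρ ^ (Int.natAbs ((j : ℤ) - (k : ℤ)))) * (d j ^ p * ENNReal.ofReal ((n j : ℝ)⁻¹))) := by
    intro k
    rw [hinv, ← ENNReal.mul_rpow_of_nonneg _ _ hp0.le, ← ENNReal.tsum_mul_right]
    have e : ∀ j : ℕ, d j * ENNReal.ofReal (ε * ρ ^ (Int.natAbs ((j : ℤ) - (k : ℤ))) *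
        ((n k : ℝ) / n j) ^ (1 / p)) * ENNReal.ofReal ((n k : ℝ) ^ (-(1 / p))) =
        ENNReal.ofReal ε * (ENNReal.ofReal (ρ ^ (Int.natAbs ((j : ℤ) - (k : ℤ)))) *
          (d j * ENNReal.ofReal ((n j : ℝ) ^ (-(1 / p))))) := by
      intro j
      have h1 := hnk k
      have h2 := hnk j
      rw [mul_assoc, ← ENNReal.ofReal_mul (by positivity), mul_left_comm _ (d j), mul_left_comm _ (d j),
        ← ENNReal.ofReal_mul (by positivity), ← ENNReal.ofReal_mul (by positivity)]
      congr 2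
      rw [Real.div_rpow h1.le h2.le, Real.rpow_neg h1.le, Real.rpow_neg h2.le]
      field_simp
    simp_rw [e]
    rw [ENNReal.tsum_mul_left, ENNReal.mul_rpow_of_nonneg _ _ hp0.le]
    gcongr
    refine (holder_tsum p hp _ _).trans ?_
    have h1 : 0 ≤ p - 1 := by linarith
    gcongr with j
    · exact hTs k
    · rw [ENNReal.mul_rpow_of_nonneg _ _ hp0.le, ← hinv]
  refine (ENNReal.tsum_le_tsum hk).trans ?_
  rw [ENNReal.tsum_mul_left, ENNReal.tsum_mul_left, ENNReal.tsum_comm]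
  have h3 : ∀ j : ℕ, ∑' k : ℕ, ENNReal.ofReal (ρ ^ (Int.natAbs ((j : ℤ) - (k : ℤ)))) *
      (d j ^ p * ENNReal.ofReal ((n j : ℝ)⁻¹)) ≤ ENNReal.ofReal T * (d j ^ p * ENNReal.ofReal ((n j : ℝ)⁻¹)) := by
    intro j
    rw [ENNReal.tsum_mul_right]
    gcongr
    refine le_trans (le_of_eq ?_) (hTs j)
    congr 1
    ext k
    congr 2
    omega
  calc _ ≤ ENNReal.ofReal ε ^ p * (ENNReal.ofReal T ^ (p - 1) *
        ∑' j : ℕ, ENNReal.ofReal T * (d j ^ p * ENNReal.ofReal ((n j : ℝ)⁻¹))) := by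
        gcongr with j
        exact h3 j
    _ = _ := by
        have h4 : ENNReal.ofReal T ^ (p - 1) * ENNReal.ofReal T = ENNReal.ofReal T ^ p := by
          conv_lhs => rw [← ENNReal.rpow_one (ENNReal.ofReal T), ← ENNReal.rpow_mul, one_mul]
          rw [← ENNReal.rpow_add _ _ (by simpa using hT) ENNReal.ofReal_ne_top]
          congr 1
          ring
        rw [ENNReal.tsum_mul_left, ← mul_assoc (_ ^ (p - 1)), h4, ENNReal.ofReal_mul hε.le,
          ENNReal.mul_rpow_of_nonneg _ _ hp0.le, mul_assoc]

lemma lower_core (p : ℝ) (hp : 1 ≤ p) (n : ℕ → ℕ) (lam : ℝ) (hlam : 1 < lam)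
    (hpos : ∀ k, 0 < n k) (hlac : ∀ k, lam * (n k : ℝ) ≤ (n (k + 1) : ℝ)) :
    ∃ C : ℝ, 0 < C ∧ ∀ (d : ℕ → ℂ) (g : ℝ → ℂ), Continuous g →
      (∑' k, ‖d k‖ₑ ^ p * ENNReal.ofReal ((n k : ℝ)⁻¹) ≠ ⊤) →
      (∀ r ∈ Set.Icc (0 : ℝ) 1, HasSum (fun j => d j * (r : ℂ) ^ n j) (g r)) →
      ∑' k, ‖d k‖ₑ ^ p * ENNReal.ofReal ((n k : ℝ)⁻¹) ≤
        ENNReal.ofReal C * ∫⁻ r in Set.Ioo (0 : ℝ) 1, ‖g r‖ₑ ^ p := by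
  have hp0 : 0 < p := by linarith
  have hp1 : 0 ≤ p - 1 := by linarith
  have hl0 : 0 < lam := by linarith
  have hli : lam⁻¹ < 1 := inv_lt_one_of_one_lt₀ hlam
  have hli0 : 0 < lam⁻¹ := by positivity
  have hnk : ∀ k, (0 : ℝ) < n k := fun k => by exact_mod_cast hpos k
  obtain ⟨T, hT, hTs⟩ := geom_dist lam⁻¹ hli0 hli
  obtain ⟨ε, hεdef⟩ : ∃ ε, ε = 1 / (2 * T) := ⟨_, rfl⟩
  have hε : 0 < ε := by rw [hεdef]; positivity
  have hεT : ε * T = 1 / 2 := by rw [hεdef]; field_simp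
  obtain ⟨D, Mc, hMc, hintg⟩ := interp p hp n lam hlam hpos hlac ε hε
  obtain ⟨C1, hC1, hC1s⟩ := scale_sum n lam hlam hpos hlac 1 one_pos
  obtain ⟨K, hK⟩ : ∃ K : ℝ≥0∞, K = (2 : ℝ≥0∞) ^ (p - 1) * (ENNReal.ofReal Mc ^ p * ((D : ℝ≥0∞) ^ (p - 1) *
    ∑ i ∈ Finset.range D, ENNReal.ofReal (Real.exp (2 * ((i : ℝ) + 1))) * ENNReal.ofReal (2 * C1))) := ⟨_, rfl⟩
  have hKtop : K ≠ ⊤ := by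
    rw [hK]
    refine ENNReal.mul_ne_top (ENNReal.rpow_ne_top_of_nonneg hp1 (by simp)) ?_
    refine ENNReal.mul_ne_top (ENNReal.rpow_ne_top_of_nonneg hp0.le (by simp)) ?_
    refine ENNReal.mul_ne_top (ENNReal.rpow_ne_top_of_nonneg hp1 (by simp)) ?_
    exact ENNReal.sum_ne_top.2 fun i _ => ENNReal.mul_ne_top ENNReal.ofReal_ne_top ENNReal.ofReal_ne_top
  refine ⟨2 * K.toReal + 1, by positivity, fun d g hg hS hsum => ?_⟩
  obtain ⟨S, hSdef⟩ : ∃ S, S = ∑' k, ‖d k‖ₑ ^ p * ENNReal.ofReal ((n k : ℝ)⁻¹) := ⟨_, rfl⟩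
  obtain ⟨I, hI⟩ : ∃ I, I = ∫⁻ r in Set.Ioo (0 : ℝ) 1, ‖g r‖ₑ ^ p := ⟨_, rfl⟩
  rw [← hSdef] at hS
  rw [← hSdef, ← hI]
  set Z : ℕ → ℝ≥0∞ := fun k => ∑' j : ℕ, ‖d j‖ₑ *
    ENNReal.ofReal (ε * lam⁻¹ ^ (Int.natAbs ((j : ℤ) - (k : ℤ))) * ((n k : ℝ) / n j) ^ (1 / p)) with hZ
  have hpt : ∀ (k : ℕ), ∀ t ∈ Set.Icc (1 : ℝ) 2, ‖d k‖ₑ ≤ ENNReal.ofReal Mc *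
      ∑ i ∈ Finset.range D, ‖g (Real.exp (-(t * (((i : ℝ) + 1) / n k))))‖ₑ + Z k := by
    intro k t ht
    obtain ⟨a, ha, hak, haj⟩ := hintg k t ht.1 ht.2
    set R : ℕ → ℝ := fun j => ∑ i ∈ Finset.range D, a i * (Real.exp (-(t * ((n j : ℝ) / n k)))) ^ (i + 1) with hR
    have hRk : R k = 1 := by
      rw [hR]; simp only; rw [div_self (hnk k).ne', mul_one]; exact hak
    have h1 : HasSum (fun j => d j * (R j : ℂ))
        (∑ i ∈ Finset.range D, (a i : ℂ) * g (Real.exp (-(t * (((i : ℝ) + 1) / n k))))) := by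
      have h2 : HasSum (fun j => ∑ i ∈ Finset.range D,
          (a i : ℂ) * (d j * ((Real.exp (-(t * (((i : ℝ) + 1) / n k))) : ℝ) : ℂ) ^ n j))
        (∑ i ∈ Finset.range D, (a i : ℂ) * g (Real.exp (-(t * (((i : ℝ) + 1) / n k))))) := by
        apply hasSum_sum
        intro i _
        apply HasSum.mul_left
        apply hsum
        refine ⟨(Real.exp_pos _).le, Real.exp_le_one_iff.2 ?_⟩
        have : 0 < ((i : ℝ) + 1) / n k := div_pos (by positivity) (hnk k)
        nlinarith [ht.1]
      convert h2 using 2 with j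
      rw [hR]
      simp only
      rw [Complex.ofReal_sum, Finset.mul_sum]
      apply Finset.sum_congr rfl
      intro i _
      rw [Complex.ofReal_mul, mul_left_comm]
      congr 2
      rw [← Complex.ofReal_pow]
      congr 1
      rw [← Real.exp_nat_mul, ← Real.exp_nat_mul]
      congr 1
      push_cast
      ring
    have h3 := (h1.update k 0)
    have h4 : d k = (∑ i ∈ Finset.range D, (a i : ℂ) * g (Real.exp (-(t * (((i : ℝ) + 1) / n k))))) -
        ∑' j, Function.update (fun j => d j * (R j : ℂ)) k 0 j := by
      rw [h3.tsum_eq, hRk]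
      simp
    calc ‖d k‖ₑ ≤ ‖∑ i ∈ Finset.range D, (a i : ℂ) * g (Real.exp (-(t * (((i : ℝ) + 1) / n k))))‖ₑ +
          ‖∑' j, Function.update (fun j => d j * (R j : ℂ)) k 0 j‖ₑ := by
          conv_lhs => rw [h4]
          exact enorm_sub_le
      _ ≤ _ := by
        apply add_le_add
        · refine (enorm_sum_le _ _).trans ?_
          rw [Finset.mul_sum]
          gcongr with i hi
          rw [enorm_mul]
          gcongr
          rw [← ofReal_norm, Complex.norm_real]
          exact ENNReal.ofReal_le_ofReal (ha i)
        · refine (enorm_tsum_le_tsum_enorm).trans ?_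
          rw [hZ]
          apply ENNReal.tsum_le_tsum
          intro j
          by_cases hjk : j = k
          · subst hjk
            simp
          · rw [Function.update_of_ne hjk, enorm_mul]
            gcongr
            rw [← ofReal_norm, Complex.norm_real]
            apply ENNReal.ofReal_le_ofReal
            have h5 := haj j hjk
            have h6 : 0 < ((n j : ℝ) / n k) ^ (1 / p) := Real.rpow_pos_of_pos (div_pos (hnk j) (hnk k)) _
            rw [← le_div_iff₀ h6] at h5
            refine h5.trans (le_of_eq ?_)
            rw [div_eq_mul_inv]
            congr 1
            rw [← Real.inv_rpow (div_pos (hnk j) (hnk k)).le, inv_div]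
  have hptp : ∀ (k : ℕ), ∀ t ∈ Set.Icc (1 : ℝ) 2, ‖d k‖ₑ ^ p ≤ (2 : ℝ≥0∞) ^ (p - 1) * (ENNReal.ofReal Mc ^ p *
      ((D : ℝ≥0∞) ^ (p - 1) * ∑ i ∈ Finset.range D, ‖g (Real.exp (-(t * (((i : ℝ) + 1) / n k))))‖ₑ ^ p) + Z k ^ p) := by
    intro k t ht
    refine (ENNReal.rpow_le_rpow (hpt k t ht) hp0.le).trans ?_
    refine (ENNReal.rpow_add_le_mul_rpow_add_rpow _ _ hp).trans ?_
    gcongr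
    rw [ENNReal.mul_rpow_of_nonneg _ _ hp0.le]
    gcongr
    refine (ENNReal.rpow_sum_le_const_mul_sum_rpow _ _ hp).trans ?_
    rw [Finset.card_range]
  have hk : ∀ k : ℕ, ‖d k‖ₑ ^ p ≤ (2 : ℝ≥0∞) ^ (p - 1) * (ENNReal.ofReal Mc ^ p *
      ((D : ℝ≥0∞) ^ (p - 1) * ∑ i ∈ Finset.range D,
        ∫⁻ t in Set.Icc (1 : ℝ) 2, ‖g (Real.exp (-(t * (((i : ℝ) + 1) / n k))))‖ₑ ^ p) + Z k ^ p) := by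
    intro k
    have hm : ∀ i : ℕ, Measurable (fun t : ℝ => ‖g (Real.exp (-(t * (((i : ℝ) + 1) / n k))))‖ₑ ^ p) := by
      intro i
      have : Continuous (fun t : ℝ => g (Real.exp (-(t * (((i : ℝ) + 1) / n k))))) := by fun_prop
      exact this.measurable.enorm.pow_const p
    have h1 := setLIntegral_mono' (μ := volume) measurableSet_Icc (hptp k)
    have hv : volume (Set.Icc (1 : ℝ) 2) = 1 := by rw [Real.volume_Icc]; norm_num
    have hms : Measurable (fun t : ℝ => ∑ i ∈ Finset.range D, ‖g (Real.exp (-(t * (((i : ℝ) + 1) / n k))))‖ₑ ^ p) :=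
      Finset.measurable_sum _ fun i _ => hm i
    rw [setLIntegral_const, hv, mul_one, lintegral_const_mul _ (by fun_prop), lintegral_add_right _ (by fun_prop),
      lintegral_const_mul _ (by fun_prop), lintegral_const_mul _ hms,
      lintegral_finsetSum _ (fun i _ => hm i), setLIntegral_const, hv, mul_one] at h1
    exact h1
  have hgm : Measurable (fun r => ‖g r‖ₑ ^ p) := hg.measurable.enorm.pow_const p
  have hI1 : ∀ i : ℕ, ∑' k : ℕ, (∫⁻ t in Set.Icc (1 : ℝ) 2, ‖g (Real.exp (-(t * (((i : ℝ) + 1) / n k))))‖ₑ ^ p) *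
      ENNReal.ofReal ((n k : ℝ)⁻¹) ≤
      ENNReal.ofReal (Real.exp (2 * ((i : ℝ) + 1))) * ENNReal.ofReal (2 * C1) * I := by
    intro i
    have hi : (0 : ℝ) < (i : ℝ) + 1 := by positivity
    rw [mul_assoc, hI]
    refine le_trans ?_ (mul_le_mul_right (overlap_sum n hpos C1 hC1 hC1s ((i : ℝ) + 1) hi _ hgm) _)
    rw [← ENNReal.tsum_mul_left]
    apply ENNReal.tsum_le_tsum
    intro k
    have hc : 0 < ((i : ℝ) + 1) / n k := div_pos hi (hnk k)
    have h1 : (1 : ℝ) ≤ n k := by exact_mod_cast hpos k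
    rw [mul_comm]
    calc _ ≤ ENNReal.ofReal (((i : ℝ) + 1) / n k) *
          ∫⁻ t in Set.Icc (1 : ℝ) 2, ‖g (Real.exp (-(t * (((i : ℝ) + 1) / n k))))‖ₑ ^ p := by
          gcongr
          rw [← one_div]
          gcongr
          simp
      _ ≤ _ := cov_le _ hc (fun r => ‖g r‖ₑ ^ p)
      _ ≤ _ := by
          gcongr
          exact div_le_self hi.le h1
  have hZs : ∑' k, Z k ^ p * ENNReal.ofReal ((n k : ℝ)⁻¹) ≤ ENNReal.ofReal (1 / 2) ^ p * S := by
    have := schur_bound p hp n hpos lam⁻¹ hli0 T ε hε hT hTs (fun j => ‖d j‖ₑ)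
    rw [hεT, ← hSdef] at this
    exact this
  have hhalf : (2 : ℝ≥0∞) ^ (p - 1) * ENNReal.ofReal (1 / 2) ^ p = ENNReal.ofReal (1 / 2) := by
    rw [← ENNReal.ofReal_ofNat 2, ENNReal.ofReal_rpow_of_pos (by norm_num), ENNReal.ofReal_rpow_of_pos (by norm_num),
      ← ENNReal.ofReal_mul (by positivity)]
    congr 1
    rw [Real.rpow_sub_one (by norm_num), div_mul_eq_mul_div, ← Real.mul_rpow (by norm_num) (by norm_num)]
    norm_num
  have hmain : S ≤ K * I + ENNReal.ofReal (1 / 2) * S := by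
    calc S ≤ ∑' k, ((2 : ℝ≥0∞) ^ (p - 1) * (ENNReal.ofReal Mc ^ p *
      ((D : ℝ≥0∞) ^ (p - 1) * ∑ i ∈ Finset.range D,
        ∫⁻ t in Set.Icc (1 : ℝ) 2, ‖g (Real.exp (-(t * (((i : ℝ) + 1) / n k))))‖ₑ ^ p) + Z k ^ p)) *
          ENNReal.ofReal ((n k : ℝ)⁻¹) := by
          rw [hSdef]
          apply ENNReal.tsum_le_tsum
          intro k
          gcongr
          exact hk k
      _ = (2 : ℝ≥0∞) ^ (p - 1) * (ENNReal.ofReal Mc ^ p *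
      ((D : ℝ≥0∞) ^ (p - 1) * ∑ i ∈ Finset.range D, ∑' k,
        (∫⁻ t in Set.Icc (1 : ℝ) 2, ‖g (Real.exp (-(t * (((i : ℝ) + 1) / n k))))‖ₑ ^ p) * ENNReal.ofReal ((n k : ℝ)⁻¹))
          + ∑' k, Z k ^ p * ENNReal.ofReal ((n k : ℝ)⁻¹)) := by
          simp_rw [mul_assoc, add_mul, mul_assoc, Finset.sum_mul]
          rw [ENNReal.tsum_mul_left, ENNReal.tsum_add, ENNReal.tsum_mul_left, ENNReal.tsum_mul_left,
            Summable.tsum_finsetSum (fun _ _ => ENNReal.summable)]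
      _ ≤ (2 : ℝ≥0∞) ^ (p - 1) * (ENNReal.ofReal Mc ^ p *
      ((D : ℝ≥0∞) ^ (p - 1) * ∑ i ∈ Finset.range D,
        ENNReal.ofReal (Real.exp (2 * ((i : ℝ) + 1))) * ENNReal.ofReal (2 * C1) * I)
          + ENNReal.ofReal (1 / 2) ^ p * S) := by
          gcongr with i
          exact hI1 i
      _ = _ := by
          rw [mul_add, ← mul_assoc _ (_ ^ p) S, hhalf, hK, ← Finset.sum_mul]
          simp only [mul_assoc]
  by_cases hItop : I = ⊤
  · rw [hItop, ENNReal.mul_top]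
    · exact le_top
    · simp only [ne_eq, ENNReal.ofReal_eq_zero, not_le]
      positivity
  have hKI : K * I ≠ ⊤ := ENNReal.mul_ne_top hKtop hItop
  rw [← ENNReal.ofReal_toReal hS, ← ENNReal.ofReal_toReal hKI, ← ENNReal.ofReal_mul (by norm_num),
    ← ENNReal.ofReal_add (by positivity) (by positivity), ENNReal.ofReal_le_ofReal_iff (by positivity)] at hmain
  rw [← ENNReal.ofReal_toReal hS, ← ENNReal.ofReal_toReal hItop, ← ENNReal.ofReal_mul (by positivity)]
  apply ENNReal.ofReal_le_ofReal
  rw [ENNReal.toReal_mul] at hmain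
  have := ENNReal.toReal_nonneg (a := I)
  linarith

lemma scale_int (s : ℝ) (hs : 1 / 2 ≤ s) (hs1 : s < 1) (F : ℝ → ℝ≥0∞) :
    ∫⁻ r in Set.Ioo (0 : ℝ) 1, F (s * r) ≤ 2 * ∫⁻ r in Set.Ioo (0 : ℝ) 1, F r := by
  have hs0 : 0 < s := by linarith
  have hder : ∀ t ∈ Set.Ioo (0 : ℝ) 1, HasDerivWithinAt (fun t : ℝ => s * t) (s * 1) (Set.Ioo 0 1) t :=
    fun t _ => ((hasDerivAt_id t).const_mul s).hasDerivWithinAt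
  have hinj : Set.InjOn (fun t : ℝ => s * t) (Set.Ioo (0 : ℝ) 1) := fun a _ b _ h =>
    mul_left_cancel₀ hs0.ne' h
  have hsub : (fun t : ℝ => s * t) '' Set.Ioo (0 : ℝ) 1 ⊆ Set.Ioo 0 1 := by
    rintro _ ⟨t, ht, rfl⟩
    exact ⟨mul_pos hs0 ht.1, by simp only; nlinarith [ht.1, ht.2]⟩
  refine le_trans ?_ (mul_le_mul_right (lintegral_mono_set hsub) _)
  rw [lintegral_image_eq_lintegral_abs_deriv_mul measurableSet_Ioo hder hinj,
    ← lintegral_const_mul' _ _ (by simp)]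
  apply lintegral_mono
  intro r
  simp only
  rw [← mul_assoc, mul_one, abs_of_pos hs0, ← ENNReal.ofReal_ofNat 2, ← ENNReal.ofReal_mul (by norm_num)]
  conv_lhs => rw [← one_mul (F _)]
  gcongr
  rw [ENNReal.one_le_ofReal]
  linarith

lemma radial_upper (p : ℝ) (hp : 1 ≤ p) (n : ℕ → ℕ) (C : ℝ)
    (hC : ∀ c : ℕ → ℝ≥0∞,
      ∫⁻ x in Set.Ioi (0 : ℝ), (∑' k, c k * ENNReal.ofReal (Real.exp (-((n k : ℝ) * x)))) ^ p
        ≤ ENNReal.ofReal C * ∑' k, c k ^ p * ENNReal.ofReal ((n k : ℝ)⁻¹))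
    (α : ℕ → ℂ) (f : ℂ → ℂ)
    (hf : ∀ z ∈ Metric.ball (0 : ℂ) 1, f z = ∑' k, α k * z ^ n k) (e : ℂ) (he : ‖e‖ = 1) :
    ∫⁻ r in Set.Ioo (0 : ℝ) 1, ‖f ((r : ℂ) * e)‖ₑ ^ p ≤
      ENNReal.ofReal C * ∑' k, ‖α k‖ₑ ^ p * ENNReal.ofReal ((n k : ℝ)⁻¹) := by
  have hp0 : 0 < p := by linarith
  refine le_trans ?_ (hC (fun k => ‖α k‖ₑ))
  set G : ℝ → ℝ≥0∞ := fun x => (∑' k, ‖α k‖ₑ * ENNReal.ofReal (Real.exp (-((n k : ℝ) * x)))) ^ p with hG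
  calc _ ≤ ∫⁻ r in Set.Ioo (0 : ℝ) 1, (Set.Ioi (0 : ℝ)).indicator G (1 - r) := by
        apply setLIntegral_mono' measurableSet_Ioo
        intro r hr
        have hmem : 1 - r ∈ Set.Ioi (0 : ℝ) := by
          have := hr.2
          simp only [Set.mem_Ioi]; linarith
        rw [Set.indicator_of_mem hmem, hG]
        simp only
        gcongr
        rw [hf]
        · refine enorm_tsum_le_tsum_enorm.trans ?_
          apply ENNReal.tsum_le_tsum
          intro k
          rw [enorm_mul]
          gcongr
          rw [← ofReal_norm, norm_pow, norm_mul, he, mul_one, Complex.norm_real, Real.norm_of_nonneg hr.1.le]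
          apply ENNReal.ofReal_le_ofReal
          have h1 := Real.add_one_le_exp (-(1 - r))
          calc r ^ n k ≤ (Real.exp (-(1 - r))) ^ n k := by
                apply pow_le_pow_left₀ hr.1.le; linarith
            _ = _ := by rw [← Real.exp_nat_mul]; congr 1; ring
        · rw [mem_ball_zero_iff, norm_mul, he, mul_one, Complex.norm_real, Real.norm_of_nonneg hr.1.le]
          exact hr.2
    _ ≤ ∫⁻ r : ℝ, (Set.Ioi (0 : ℝ)).indicator G (1 - r) := setLIntegral_le_lintegral _ _
    _ = ∫⁻ r : ℝ, (Set.Ioi (0 : ℝ)).indicator G r := lintegral_sub_left_eq_self _ 1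
    _ = _ := lintegral_indicator measurableSet_Ioi _

lemma radial_lower (p : ℝ) (hp : 1 ≤ p) (n : ℕ → ℕ) (hpos : ∀ k, 0 < n k) (C : ℝ)
    (hC : ∀ (d : ℕ → ℂ) (g : ℝ → ℂ), Continuous g →
      (∑' k, ‖d k‖ₑ ^ p * ENNReal.ofReal ((n k : ℝ)⁻¹) ≠ ⊤) →
      (∀ r ∈ Set.Icc (0 : ℝ) 1, HasSum (fun j => d j * (r : ℂ) ^ n j) (g r)) →
      ∑' k, ‖d k‖ₑ ^ p * ENNReal.ofReal ((n k : ℝ)⁻¹) ≤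
        ENNReal.ofReal C * ∫⁻ r in Set.Ioo (0 : ℝ) 1, ‖g r‖ₑ ^ p)
    (α : ℕ → ℂ) (f : ℂ → ℂ)
    (hsm : ∀ z ∈ Metric.ball (0 : ℂ) 1, Summable (fun k => α k * z ^ n k))
    (hf : ∀ z ∈ Metric.ball (0 : ℂ) 1, f z = ∑' k, α k * z ^ n k) (e : ℂ) (he : ‖e‖ = 1) :
    ∑' k, ‖α k‖ₑ ^ p * ENNReal.ofReal ((n k : ℝ)⁻¹) ≤
      ENNReal.ofReal (2 * C) * ∫⁻ r in Set.Ioo (0 : ℝ) 1, ‖f ((r : ℂ) * e)‖ₑ ^ p := by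
  have hp0 : 0 < p := by linarith
  have hp1 : 0 ≤ p - 1 := by linarith
  set I := ∫⁻ r in Set.Ioo (0 : ℝ) 1, ‖f ((r : ℂ) * e)‖ₑ ^ p with hI
  have hs : ∀ s : ℝ, 1 / 2 ≤ s → s < 1 →
      ∑' k, (‖α k‖ₑ * ENNReal.ofReal s ^ n k) ^ p * ENNReal.ofReal ((n k : ℝ)⁻¹) ≤ ENNReal.ofReal (2 * C) * I := by
    intro s hs hs1
    have hs0 : 0 < s := by linarith
    set d : ℕ → ℂ := fun k => α k * ((s : ℂ) * e) ^ n k with hd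
    have hball : ∀ r : ℝ, 0 ≤ r → r ≤ 1 → (s : ℂ) * e * r ∈ Metric.ball (0 : ℂ) 1 := by
      intro r h0 h1
      rw [mem_ball_zero_iff, norm_mul, norm_mul, he, mul_one, Complex.norm_real, Complex.norm_real,
        Real.norm_of_nonneg hs0.le, Real.norm_of_nonneg h0]
      nlinarith
    have hdn : ∀ k, ‖d k‖ₑ = ‖α k‖ₑ * ENNReal.ofReal s ^ n k := by
      intro k
      rw [hd]
      simp only
      rw [enorm_mul, enorm_pow, enorm_mul, ← ofReal_norm (s : ℂ), ← ofReal_norm e, he, Complex.norm_real,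
        Real.norm_of_nonneg hs0.le]
      simp
    have hds : Summable d := by
      have := hsm _ (hball 1 (by norm_num) le_rfl)
      simpa [hd] using this
    have hdns : Summable (fun k => ‖d k‖) := hds.norm
    have hfin : ∑' k, ‖d k‖ₑ ^ p * ENNReal.ofReal ((n k : ℝ)⁻¹) ≠ ⊤ := by
      have hM : ∑' k, ‖d k‖ₑ ≠ ⊤ := by
        have := hdns.tsum_ofReal_ne_top
        simpa [ofReal_norm] using this
      refine ne_top_of_le_ne_top (ENNReal.mul_ne_top (ENNReal.rpow_ne_top_of_nonneg hp1 hM) hM) ?_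
      rw [← ENNReal.tsum_mul_left]
      apply ENNReal.tsum_le_tsum
      intro k
      have h1 : ENNReal.ofReal ((n k : ℝ)⁻¹) ≤ 1 := by
        rw [ENNReal.ofReal_le_one]
        apply inv_le_one_of_one_le₀
        exact_mod_cast hpos k
      have h2 : ‖d k‖ₑ ^ p = ‖d k‖ₑ ^ (p - 1) * ‖d k‖ₑ := by
        conv_rhs => rw [← ENNReal.rpow_one ‖d k‖ₑ, ← ENNReal.rpow_mul, one_mul]
        rw [← ENNReal.rpow_add_of_nonneg _ _ hp1 zero_le_one]
        congr 1
        ring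
      calc _ ≤ ‖d k‖ₑ ^ p * 1 := by gcongr
        _ = ‖d k‖ₑ ^ (p - 1) * ‖d k‖ₑ := by rw [mul_one, h2]
        _ ≤ _ := by gcongr; exact ENNReal.le_tsum k
    set cl : ℝ → ℝ := fun r => max 0 (min r 1) with hcl
    have hcl0 : ∀ r, 0 ≤ cl r := fun r => le_max_left _ _
    have hcl1 : ∀ r, cl r ≤ 1 := fun r => max_le zero_le_one (min_le_right _ _)
    have hcle : ∀ r ∈ Set.Icc (0 : ℝ) 1, cl r = r := by
      intro r hr
      rw [hcl]
      simp only
      rw [min_eq_left hr.2, max_eq_right hr.1]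
    have hbd : ∀ (k : ℕ) (r : ℝ), ‖d k * ((cl r : ℝ) : ℂ) ^ n k‖ ≤ ‖d k‖ := by
      intro k r
      rw [norm_mul, norm_pow, Complex.norm_real, Real.norm_of_nonneg (hcl0 r)]
      exact mul_le_of_le_one_right (norm_nonneg _) (pow_le_one₀ (hcl0 r) (hcl1 r))
    set g : ℝ → ℂ := fun r => ∑' k, d k * ((cl r : ℝ) : ℂ) ^ n k with hg
    have hgc : Continuous g := by
      apply continuous_tsum (u := fun k => ‖d k‖) _ hdns hbd
      intro k
      fun_prop
    have hgs : ∀ r ∈ Set.Icc (0 : ℝ) 1, HasSum (fun j => d j * (r : ℂ) ^ n j) (g r) := by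
      intro r hr
      have h1 : Summable (fun k => d k * ((cl r : ℝ) : ℂ) ^ n k) :=
        Summable.of_norm_bounded hdns (fun k => hbd k r)
      have h2 := h1.hasSum
      rw [hcle r hr] at h2
      rw [hg]
      simp only
      rw [hcle r hr]
      exact h2
    have hmain := hC d g hgc hfin hgs
    simp_rw [hdn] at hmain
    refine hmain.trans ?_
    rw [mul_comm 2 C, ENNReal.ofReal_mul' (by norm_num), mul_assoc]
    gcongr
    have hsc := scale_int s hs hs1 (fun r => ‖f ((r : ℂ) * e)‖ₑ ^ p)
    rw [ENNReal.ofReal_ofNat]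
    refine le_trans (le_of_eq ?_) hsc
    apply setLIntegral_congr_fun measurableSet_Ioo
    intro r hr
    have hgr := (hgs r ⟨hr.1.le, hr.2.le⟩).tsum_eq
    have e1 : ((s * r : ℝ) : ℂ) * e = (s : ℂ) * e * r := by push_cast; ring
    simp only
    rw [e1, hf _ (hball r hr.1.le hr.2.le), ← hgr]
    congr 2
    apply tsum_congr
    intro k
    rw [hd]
    simp only
    rw [mul_pow ((s : ℂ) * e), mul_assoc]
  rw [ENNReal.tsum_eq_iSup_sum]
  refine iSup_le fun J => ?_
  have hcont : Filter.Tendsto (fun s : ℝ => ∑ k ∈ J, (‖α k‖ₑ * ENNReal.ofReal s ^ n k) ^ p * ENNReal.ofReal ((n k : ℝ)⁻¹))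
      (nhdsWithin 1 (Set.Iio 1)) (nhds (∑ k ∈ J, ‖α k‖ₑ ^ p * ENNReal.ofReal ((n k : ℝ)⁻¹))) := by
    apply tendsto_finsetSum
    intro k _
    have h1 : Filter.Tendsto (fun s : ℝ => ENNReal.ofReal s ^ n k) (nhdsWithin 1 (Set.Iio 1)) (nhds 1) := by
      have h2 : Continuous (fun s : ℝ => ENNReal.ofReal s ^ n k) :=
        (ENNReal.continuous_pow (n k)).comp ENNReal.continuous_ofReal
      have h3 := (h2.tendsto 1).mono_left (nhdsWithin_le_nhds (s := Set.Iio (1 : ℝ)))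
      simpa using h3
    have h2 := ENNReal.Tendsto.const_mul (a := ‖α k‖ₑ) h1 (Or.inr enorm_ne_top)
    rw [mul_one] at h2
    have h3 := (ENNReal.continuous_rpow_const (y := p)).tendsto _ |>.comp h2
    exact ENNReal.Tendsto.mul_const h3 (Or.inr ENNReal.ofReal_ne_top)
  refine le_of_tendsto hcont ?_
  filter_upwards [Ico_mem_nhdsLT (show (1 / 2 : ℝ) < 1 by norm_num)] with s hsm'
  exact (ENNReal.sum_le_tsum J).trans (hs s hsm'.1 hsm'.2)

lemma rho_between (p q : ℝ≥0∞) (hq : 1 ≤ q) (f : ℂ → ℂ) (L U : ℝ≥0∞)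
    (hL : ∀ θ, L ≤ radialLp p f θ) (hU : ∀ θ, radialLp p f θ ≤ U) :
    L ≤ rhoE p q f ∧ rhoE p q f ≤ U := by
  unfold rhoE
  split_ifs with h
  · constructor
    · exact (hL 0).trans (le_iSup (fun θ : Set.Ico (0 : ℝ) (2 * Real.pi) => radialLp p f (θ : ℝ))
        ⟨0, le_rfl, by positivity⟩)
    · exact iSup_le fun θ => hU θ
  · have hq0 : 0 < q.toReal := ENNReal.toReal_pos (by rintro rfl; simp at hq) h
    have h2 : ENNReal.ofReal (2 * Real.pi) ≠ 0 := by
      simp only [ne_eq, ENNReal.ofReal_eq_zero, not_le]; positivity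
    have hc : ∀ V : ℝ≥0∞, ((ENNReal.ofReal (2 * Real.pi))⁻¹ *
        ∫⁻ _ in Set.Ioo (0 : ℝ) (2 * Real.pi), V ^ q.toReal) ^ (1 / q.toReal) = V := by
      intro V
      rw [setLIntegral_const, Real.volume_Ioo, sub_zero, mul_comm (V ^ _), ← mul_assoc,
        ENNReal.inv_mul_cancel h2 ENNReal.ofReal_ne_top, one_mul, ← ENNReal.rpow_mul,
        mul_one_div_cancel hq0.ne', ENNReal.rpow_one]
    constructor
    · conv_lhs => rw [← hc L]
      gcongr with θ
      exact hL θ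
    · conv_rhs => rw [← hc U]
      gcongr with θ
      exact hU θ

/-- Lacunary series in `RM(p,q)`: if `{n_k}` is lacunary, `1 ≤ p < ∞`, `1 ≤ q ≤ ∞` and
`f(z) = Σ_k α_k z^{n_k}`, then `f ∈ RM(p,q)` iff `Σ_k |α_k|^p / n_k < ∞`, and
`ρ_{p,q}(f) ≍ (Σ_k |α_k|^p / n_k)^{1/p}` with constants independent of `q`. -/
theorem stmt_10 (p : ℝ) (hp : 1 ≤ p) (n : ℕ → ℕ) (lam : ℝ) (hlam : 1 < lam)
    (hpos : ∀ k, 0 < n k) (hlac : ∀ k, lam * (n k : ℝ) ≤ (n (k + 1) : ℝ)) :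
    ∃ A B : ℝ, 0 < A ∧ 0 < B ∧
      ∀ (q : ℝ≥0∞), 1 ≤ q → ∀ (α : ℕ → ℂ) (f : ℂ → ℂ),
        (∀ z ∈ Metric.ball (0 : ℂ) 1, Summable (fun k => α k * z ^ n k)) →
        (∀ z ∈ Metric.ball (0 : ℂ) 1, f z = ∑' k, α k * z ^ n k) →
        (ENNReal.ofReal A *
              (∑' k, ENNReal.ofReal (‖α k‖ ^ p / (n k : ℝ))) ^ (1 / p)
            ≤ rhoE (ENNReal.ofReal p) q f ∧
          rhoE (ENNReal.ofReal p) q f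
            ≤ ENNReal.ofReal B *
                (∑' k, ENNReal.ofReal (‖α k‖ ^ p / (n k : ℝ))) ^ (1 / p)) ∧
        (rhoE (ENNReal.ofReal p) q f ≠ ⊤ ↔
          Summable (fun k => ‖α k‖ ^ p / (n k : ℝ))) := by
  have hp0 : 0 < p := by linarith
  obtain ⟨C, hC, hCs⟩ := upper_core p hp n lam hlam hpos hlac
  obtain ⟨C', hC', hCs'⟩ := lower_core p hp n lam hlam hpos hlac
  refine ⟨((2 * C')⁻¹) ^ (1 / p), C ^ (1 / p), by positivity, by positivity, ?_⟩
  intro q hq α f hsm hf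
  have hX : ∑' k, ENNReal.ofReal (‖α k‖ ^ p / (n k : ℝ)) =
      ∑' k, ‖α k‖ₑ ^ p * ENNReal.ofReal ((n k : ℝ)⁻¹) := by
    apply tsum_congr
    intro k
    rw [div_eq_mul_inv, ENNReal.ofReal_mul (by positivity), ← ofReal_norm,
      ENNReal.ofReal_rpow_of_nonneg (norm_nonneg _) hp0.le]
  have hrad : ∀ θ : ℝ, radialLp (ENNReal.ofReal p) f θ =
      (∫⁻ r in Set.Ioo (0 : ℝ) 1, ‖f ((r : ℂ) * Complex.exp ((θ : ℂ) * Complex.I))‖ₑ ^ p) ^ (1 / p) := by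
    intro θ
    unfold radialLp
    rw [if_neg ENNReal.ofReal_ne_top, ENNReal.toReal_ofReal hp0.le]
    congr 1
    apply lintegral_congr
    intro r
    rw [← ofReal_norm, ENNReal.ofReal_rpow_of_nonneg (norm_nonneg _) hp0.le]
  have hbetween := rho_between (ENNReal.ofReal p) q hq f
    (ENNReal.ofReal (((2 * C')⁻¹) ^ (1 / p)) * (∑' k, ENNReal.ofReal (‖α k‖ ^ p / (n k : ℝ))) ^ (1 / p))
    (ENNReal.ofReal (C ^ (1 / p)) * (∑' k, ENNReal.ofReal (‖α k‖ ^ p / (n k : ℝ))) ^ (1 / p))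
    (by
      intro θ
      rw [hrad, hX, ← ENNReal.ofReal_rpow_of_pos (by positivity),
        ← ENNReal.mul_rpow_of_nonneg _ _ (by positivity)]
      gcongr
      have h := radial_lower p hp n hpos C' hCs' α f hsm hf (Complex.exp ((θ : ℂ) * Complex.I))
        (Complex.norm_exp_ofReal_mul_I θ)
      refine (mul_le_mul_right h _).trans (le_of_eq ?_)
      rw [← mul_assoc, ← ENNReal.ofReal_mul (by positivity), inv_mul_cancel₀ (by positivity),
        ENNReal.ofReal_one, one_mul])
    (by
      intro θ
      rw [hrad, hX, ← ENNReal.ofReal_rpow_of_pos (by positivity),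
        ← ENNReal.mul_rpow_of_nonneg _ _ (by positivity)]
      gcongr
      exact radial_upper p hp n C hCs α f hf _ (Complex.norm_exp_ofReal_mul_I θ))
  refine ⟨hbetween, ?_⟩
  have hsumm : Summable (fun k => ‖α k‖ ^ p / (n k : ℝ)) ↔
      ∑' k, ENNReal.ofReal (‖α k‖ ^ p / (n k : ℝ)) ≠ ⊤ := by
    constructor
    · intro h
      exact h.tsum_ofReal_ne_top
    · intro h
      have h1 := ENNReal.summable_toReal h
      refine h1.congr fun k => ?_
      rw [ENNReal.toReal_ofReal (by positivity)]
  rw [hsumm]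
  constructor
  · intro h hX'
    rw [hX', ENNReal.top_rpow_of_pos (by positivity), ENNReal.mul_top] at hbetween
    · exact h (top_le_iff.1 hbetween.1)
    · simp only [ne_eq, ENNReal.ofReal_eq_zero, not_le]
      positivity
  · intro h
    refine ne_top_of_le_ne_top ?_ hbetween.2
    exact ENNReal.mul_ne_top ENNReal.ofReal_ne_top (ENNReal.rpow_ne_top_of_nonneg (by positivity) h)
end
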